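/- Let 0 < α < 1, let U ⊆ ℂ be a bounded open set, and let b ∈ ∂U. Then the following are equivalent: (i) there exists κ > 0 such that |(∇h)(b)| ≤ κ‖h‖_{H^α} for every h ∈ H^α_b(U), where (∇h)(b) := ((∂h/∂x)(b), (∂h/∂y)(b)) ∈ ℂ² is computed from the harmonic extension of h to a neighbourhood of b; (ii) the series Σ_{n=1}^∞ 2^n · M_*^α(A_n(b) ∖ U) converges. -/

import Mathlib

open Metric Set Filter ENNReal

noncomputable section

/-- `f` is harmonic (twice continuously real-differentiable with vanishing Laplacian)
on the open set `U ⊆ ℂ`. -/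
def HarmonicOnC (f : ℂ → ℂ) (U : Set ℂ) : Prop :=
  ContDiffOn ℝ 2 f U ∧
    ∀ z ∈ U,
      fderiv ℝ (fun w => fderiv ℝ f w 1) z 1 +
        fderiv ℝ (fun w => fderiv ℝ f w Complex.I) z Complex.I = 0

/-- `f` satisfies a Lipschitz (Hölder) condition of order `α` on `E`. -/
def HolderOfOrderOn (α : ℝ) (E : Set ℂ) (f : ℂ → ℂ) : Prop :=
  ∃ C : ℝ, ∀ x ∈ E, ∀ y ∈ E, ‖f x - f y‖ ≤ C * ‖x - y‖ ^ α

/-- `f` belongs to the little Lipschitz class of order `α` on `E`. -/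
def LittleHolderOn (α : ℝ) (E : Set ℂ) (f : ℂ → ℂ) : Prop :=
  HolderOfOrderOn α E f ∧
    Tendsto
      (fun δ : ℝ =>
        sSup {q | ∃ x ∈ E, ∃ y ∈ E, x ≠ y ∧ ‖x - y‖ ≤ δ ∧ q = ‖f x - f y‖ / ‖x - y‖ ^ α})
      (nhdsWithin 0 (Set.Ioi 0)) (nhds 0)

/-- Membership in `H^α(U)`: harmonic on `U` and little-Lipschitz-`α` on `closure U`. -/
def MemHalpha (α : ℝ) (U : Set ℂ) (f : ℂ → ℂ) : Prop :=
  HarmonicOnC f U ∧ LittleHolderOn α (closure U) f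

/-- The `H^α` norm: sup of `|f|` over `closure U` plus the Hölder-`α` seminorm on
`closure U`. -/
def HNorm (α : ℝ) (U : Set ℂ) (f : ℂ → ℂ) : ℝ :=
  sSup ((fun x => ‖f x‖) '' closure U) +
    sSup {q | ∃ x ∈ closure U, ∃ y ∈ closure U, x ≠ y ∧ q = ‖f x - f y‖ / ‖x - y‖ ^ α}

/-- The gradient `∇h(b) = (∂h/∂x(b), ∂h/∂y(b)) ∈ ℂ²`, computed from the real Fréchet
derivative. -/
def gradPair (h : ℂ → ℂ) (b : ℂ) : ℂ × ℂ :=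
  (fderiv ℝ h b 1, fderiv ℝ h b Complex.I)

/-- The Hausdorff `h`-content of `E ⊆ ℂ`: infimum of `∑ h(rₙ)` over countable covers of
`E` by closed balls `B̄(aₙ, rₙ)` (with nonnegative radii). -/
def MhContent (h : ℝ → ℝ) (E : Set ℂ) : ℝ≥0∞ :=
  ⨅ (c : ℕ → ℂ × ℝ) (_ : ∀ n, 0 ≤ (c n).2)
    (_ : E ⊆ ⋃ n, Metric.closedBall (c n).1 (c n).2),
    ∑' n, ENNReal.ofReal (h ((c n).2))

/-- The lower `β`-dimensional Hausdorff content `M_*^β`: the sup of `M_h` over increasing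
`h` with `0 ≤ h(r) ≤ r^β` for `r > 0` and `h(r)/r^β → 0` as `r → 0⁺`. -/
def lowerContent (β : ℝ) (E : Set ℂ) : ℝ≥0∞ :=
  ⨆ (h : ℝ → ℝ) (_ : MonotoneOn h (Set.Ici 0) ∧
      (∀ r : ℝ, 0 < r → 0 ≤ h r ∧ h r ≤ r ^ β) ∧
      Tendsto (fun r => h r / r ^ β) (nhdsWithin 0 (Set.Ioi 0)) (nhds 0)),
    MhContent h E

/-- The annulus `A_n(b) = {z : 2^{-(n+1)} ≤ |z - b| ≤ 2^{-n}}`. -/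
def Ann (b : ℂ) (n : ℕ) : Set ℂ :=
  {z | (2:ℝ) ^ (-(n:ℝ) - 1) ≤ ‖z - b‖ ∧ ‖z - b‖ ≤ (2:ℝ) ^ (-(n:ℝ))}

open scoped ContDiff Topology ComplexConjugate
open MeasureTheory

/-- The Laplacian, in the form used by `HarmonicOnC`. -/
def lap (f : ℂ → ℂ) (z : ℂ) : ℂ :=
  fderiv ℝ (fun w => fderiv ℝ f w 1) z 1 +
    fderiv ℝ (fun w => fderiv ℝ f w Complex.I) z Complex.I

lemma lap_congr {f g : ℂ → ℂ} {z : ℂ} (h : f =ᶠ[𝓝 z] g) : lap f z = lap g z := by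
  have h1 := h.fderiv (𝕜 := ℝ)
  have h2 : ∀ v : ℂ, (fun w => fderiv ℝ f w v) =ᶠ[𝓝 z] fun w => fderiv ℝ g w v := fun v => by
    filter_upwards [h1] with w hw
    rw [hw]
  simp only [lap, (h2 1).fderiv_eq, (h2 Complex.I).fderiv_eq]

lemma contDiff_fderiv_apply_const {f : ℂ → ℂ} (hf : ContDiff ℝ 2 f) (v : ℂ) :
    ContDiff ℝ 1 (fun w => fderiv ℝ f w v) :=
  (hf.fderiv_right (m := 1) (by norm_num)).clm_apply contDiff_const

lemma fderiv_fderiv_apply_eq {f : ℂ → ℂ} (hf : ContDiff ℝ 2 f) (z v : ℂ) :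
    fderiv ℝ (fun w => fderiv ℝ f w v) z v = iteratedFDeriv ℝ 2 f z ![v, v] := by
  have hd : DifferentiableAt ℝ (fderiv ℝ f) z :=
    ((hf.fderiv_right (m := 1) (by norm_num)).differentiable (by norm_num)) z
  rw [iteratedFDeriv_two_apply, fderiv_clm_apply hd (differentiableAt_const v)]
  simp

lemma lap_eq_iteratedFDeriv {f : ℂ → ℂ} (hf : ContDiff ℝ 2 f) (z : ℂ) :
    lap f z = iteratedFDeriv ℝ 2 f z ![1, 1] +
      iteratedFDeriv ℝ 2 f z ![Complex.I, Complex.I] := by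
  rw [lap, fderiv_fderiv_apply_eq hf, fderiv_fderiv_apply_eq hf]

lemma norm_lap_le {f : ℂ → ℂ} (hf : ContDiff ℝ 2 f) (z : ℂ) :
    ‖lap f z‖ ≤ 2 * ‖iteratedFDeriv ℝ 2 f z‖ := by
  rw [lap_eq_iteratedFDeriv hf]
  refine (norm_add_le _ _).trans ?_
  have h1 := (iteratedFDeriv ℝ 2 f z).le_opNorm ![1, 1]
  have h2 := (iteratedFDeriv ℝ 2 f z).le_opNorm ![Complex.I, Complex.I]
  simp [Fin.prod_univ_two] at h1 h2
  linarith

lemma continuous_lap {f : ℂ → ℂ} (hf : ContDiff ℝ 2 f) : Continuous (lap f) :=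
  (((contDiff_fderiv_apply_const hf 1).continuous_fderiv (by norm_num)).clm_apply
    continuous_const).add
  (((contDiff_fderiv_apply_const hf Complex.I).continuous_fderiv (by norm_num)).clm_apply
    continuous_const)

lemma tsupport_fderiv_apply_const_subset (f : ℂ → ℂ) (v : ℂ) :
    tsupport (fun w => fderiv ℝ f w v) ⊆ tsupport f := tsupport_fderiv_apply_subset ℝ v

lemma tsupport_lap_subset (f : ℂ → ℂ) : tsupport (lap f) ⊆ tsupport f := by
  refine closure_minimal ?_ (isClosed_tsupport f)
  intro x hx
  by_contra h
  apply hx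
  have : f =ᶠ[𝓝 x] fun _ => (0 : ℂ) := notMem_tsupport_iff_eventuallyEq.mp h
  rw [lap_congr this]
  simp [lap]

lemma hasCompactSupport_lap {f : ℂ → ℂ} (hc : HasCompactSupport f) :
    HasCompactSupport (lap f) :=
  hc.of_isClosed_subset (isClosed_tsupport _) (tsupport_lap_subset f)

lemma lap_sum {ι : Type*} (s : Finset ι) {f : ι → ℂ → ℂ} (hf : ∀ i ∈ s, ContDiff ℝ 2 (f i))
    (z : ℂ) : lap (fun w => ∑ i ∈ s, f i w) z = ∑ i ∈ s, lap (f i) z := by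
  rw [lap_eq_iteratedFDeriv (ContDiff.sum hf)]
  rw [Finset.sum_congr rfl fun i hi => lap_eq_iteratedFDeriv (hf i hi) z,
    iteratedFDeriv_fun_sum_apply fun i hi => (hf i hi).contDiffAt]
  simp [Finset.sum_add_distrib]

lemma lap_add {f g : ℂ → ℂ} (hf : ContDiff ℝ 2 f) (hg : ContDiff ℝ 2 g) (z : ℂ) :
    lap (fun w => f w + g w) z = lap f z + lap g z := by
  have := lap_sum (Finset.univ : Finset (Fin 2)) (f := ![f, g])
    (by intro i _; fin_cases i <;> simpa) z
  simpa [Fin.sum_univ_two] using this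

lemma integrable_mul_of_continuousOn {a b : ℂ → ℂ} {V : Set ℂ} (hV : IsOpen V)
    (ha : ContinuousOn a V) (hb : Continuous b) (hbc : HasCompactSupport b)
    (hs : tsupport b ⊆ V) : Integrable (fun x => a x * b x) := by
  have hsub : tsupport (fun x => a x * b x) ⊆ tsupport b :=
    closure_mono fun x hx h => hx (by simp [h])
  refine Continuous.integrable_of_hasCompactSupport ?_
    (hbc.of_isClosed_subset (isClosed_tsupport _) hsub)
  refine continuous_of_tsupport fun x hx => ?_
  exact ((ha.continuousAt (hV.mem_nhds (hs (hsub hx))))).mul hb.continuousAt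

/-- Green's identity: a harmonic function integrates to zero against the Laplacian of a test
function supported in its domain. -/
lemma integral_mul_lap_eq_zero {H φ : ℂ → ℂ} {V : Set ℂ} (hV : IsOpen V)
    (hH : HarmonicOnC H V) (hφ : ContDiff ℝ 2 φ) (hc : HasCompactSupport φ)
    (hs : tsupport φ ⊆ V) : ∫ z, H z * lap φ z = 0 := by
  obtain ⟨hH2, hlap⟩ := hH
  have hHc : ContinuousOn H V := hH2.continuousOn
  have hd1 : ContDiffOn ℝ 1 (fderiv ℝ H) V := hH2.fderiv_of_isOpen hV (by norm_num)
  have hdv : ∀ v : ℂ, ContDiffOn ℝ 1 (fun w => fderiv ℝ H w v) V := fun v =>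
    hd1.clm_apply contDiffOn_const
  have hdvv : ∀ v : ℂ, ContinuousOn (fun w => fderiv ℝ (fun w => fderiv ℝ H w v) w v) V :=
    fun v => ((hdv v).continuousOn_fderiv_of_isOpen hV (by norm_num)).clm_apply continuousOn_const
  have hφv := fun v => contDiff_fderiv_apply_const hφ v
  have hφs : ∀ v : ℂ, tsupport (fun w => fderiv ℝ φ w v) ⊆ V := fun v =>
    (tsupport_fderiv_apply_const_subset φ v).trans hs
  have hφc : ∀ v : ℂ, HasCompactSupport (fun w => fderiv ℝ φ w v) := fun v =>
    hc.fderiv_apply ℝ v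
  have hφvv : ∀ v : ℂ, Continuous (fun w => fderiv ℝ (fun w => fderiv ℝ φ w v) w v) := fun v =>
    ((hφv v).continuous_fderiv (by norm_num)).clm_apply continuous_const
  have hφss : ∀ v : ℂ, tsupport (fun w => fderiv ℝ (fun w => fderiv ℝ φ w v) w v) ⊆ V := fun v =>
    (tsupport_fderiv_apply_const_subset _ v).trans (hφs v)
  have hφcc : ∀ v : ℂ, HasCompactSupport (fun w => fderiv ℝ (fun w => fderiv ℝ φ w v) w v) :=
    fun v => (hφc v).fderiv_apply ℝ v
  have key : ∀ v : ℂ, ∫ z, H z * fderiv ℝ (fun w => fderiv ℝ φ w v) z v =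
      ∫ z, fderiv ℝ (fun w => fderiv ℝ H w v) z v * φ z := by
    intro v
    rw [integral_mul_fderiv_eq_neg_fderiv_mul_of_integrable
      (integrable_mul_of_continuousOn hV (hdv v).continuousOn (hφv v).continuous (hφc v) (hφs v))
      (integrable_mul_of_continuousOn hV hHc (hφvv v) (hφcc v) (hφss v))
      (integrable_mul_of_continuousOn hV hHc (hφv v).continuous (hφc v) (hφs v))
      (fun x hx => (hH2.differentiableOn (by norm_num)).differentiableAt
        (hV.mem_nhds (hφs v hx)))
      (fun x _ => (hφv v).differentiable (by norm_num) x)]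
    rw [integral_mul_fderiv_eq_neg_fderiv_mul_of_integrable
      (integrable_mul_of_continuousOn hV (hdvv v) hφ.continuous hc hs)
      (integrable_mul_of_continuousOn hV (hdv v).continuousOn (hφv v).continuous (hφc v) (hφs v))
      (integrable_mul_of_continuousOn hV (hdv v).continuousOn hφ.continuous hc hs)
      (fun x hx => ((hdv v).differentiableOn (by norm_num)).differentiableAt
        (hV.mem_nhds (hs hx)))
      (fun x _ => hφ.differentiable (by norm_num) x), neg_neg]
  simp only [lap, mul_add]
  rw [integral_add (integrable_mul_of_continuousOn hV hHc (hφvv 1) (hφcc 1) (hφss 1))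
    (integrable_mul_of_continuousOn hV hHc (hφvv _) (hφcc _) (hφss _)), key, key,
    ← integral_add (integrable_mul_of_continuousOn hV (hdvv 1) hφ.continuous hc hs)
    (integrable_mul_of_continuousOn hV (hdvv _) hφ.continuous hc hs)]
  rw [← integral_zero ℂ ℂ]
  congr 1 with z
  by_cases hz : z ∈ tsupport φ
  · rw [← add_mul, hlap z (hs hz), zero_mul]
  · simp [image_eq_zero_of_notMem_tsupport hz]

lemma integral_lap_eq_zero {φ : ℂ → ℂ} (hφ : ContDiff ℝ 2 φ) (hc : HasCompactSupport φ) :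
    ∫ z, lap φ z = 0 := by
  have h : HarmonicOnC (fun _ => (1 : ℂ)) Set.univ := ⟨contDiffOn_const, by simp⟩
  simpa using integral_mul_lap_eq_zero isOpen_univ h hφ hc (Set.subset_univ _)

/-- The complex-valued unit bump: `1` on the ball of radius `2`, supported in radius `3`. -/
def unitBump (z : ℂ) : ℂ := (((⟨2, 3, by norm_num, by norm_num⟩ : ContDiffBump (0 : ℂ)) z : ℝ) : ℂ)

lemma contDiff_unitBump : ContDiff ℝ ∞ unitBump :=
  Complex.ofRealCLM.contDiff.comp (ContDiffBump.contDiff _)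

lemma unitBump_eq_one {z : ℂ} (hz : ‖z‖ ≤ 2) : unitBump z = 1 := by
  unfold unitBump
  rw [ContDiffBump.one_of_mem_closedBall]
  · simp
  · simpa using hz

lemma unitBump_eq_zero {z : ℂ} (hz : 3 ≤ ‖z‖) : unitBump z = 0 := by
  unfold unitBump
  rw [ContDiffBump.zero_of_le_dist]
  · simp
  · simpa using hz

lemma norm_one_sub_unitBump_le (z : ℂ) : ‖1 - unitBump z‖ ≤ 1 := by
  unfold unitBump
  set f : ContDiffBump (0 : ℂ) := ⟨2, 3, by norm_num, by norm_num⟩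
  have h0 : 0 ≤ f z := f.nonneg
  have h1 : f z ≤ 1 := f.le_one
  rw [← Complex.ofReal_one, ← Complex.ofReal_sub, Complex.norm_real, Real.norm_eq_abs, abs_le]
  constructor <;> linarith

lemma tsupport_unitBump_subset : tsupport unitBump ⊆ closedBall 0 3 := by
  refine closure_minimal (fun z hz => ?_) isClosed_closedBall
  by_contra h
  exact hz (unitBump_eq_zero (by simpa using (not_le.mp (by simpa using h)).le))

lemma natCast_le_infty (n : ℕ) : ((n : ℕ) : WithTop ℕ∞) ≤ (∞ : WithTop ℕ∞) := by
  exact_mod_cast le_top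

/-- Derivatives up to order two of a smooth compactly supported function are bounded. -/
lemma exists_iteratedFDeriv_bound {f : ℂ → ℂ} (hf : ContDiff ℝ ∞ f) (hc : HasCompactSupport f) :
    ∃ A : ℝ, 1 ≤ A ∧ ∀ i ≤ 2, ∀ z, ‖iteratedFDeriv ℝ i f z‖ ≤ A := by
  have h : ∀ i : ℕ, ∃ A : ℝ, ∀ z, ‖iteratedFDeriv ℝ i f z‖ ≤ A := fun i =>
    (hc.iteratedFDeriv i).exists_bound_of_continuous
      (hf.continuous_iteratedFDeriv (by exact_mod_cast le_top))
  choose A hA using h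
  refine ⟨max 1 (max (A 0) (max (A 1) (A 2))), le_max_left _ _, fun i hi z => ?_⟩
  refine (hA i z).trans ?_
  interval_cases i <;> simp

/-- The label of a grid point, as a complex number. -/
def gridLabel (q : ℕ ×ₗ ℤ ×ₗ ℤ) : ℂ := ⟨(ofLex (ofLex q).2).1, (ofLex (ofLex q).2).2⟩

/-- The bump adapted to the square of side `2 ^ (-k)` with label `(m, n)`. -/
def gridBump (q : ℕ ×ₗ ℤ ×ₗ ℤ) (z : ℂ) : ℂ :=
  unitBump ((2 : ℝ) ^ (ofLex q).1 • z - gridLabel q)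

lemma gridBump_apply (q : ℕ ×ₗ ℤ ×ₗ ℤ) (z : ℂ) :
    gridBump q z = unitBump ((2 : ℝ) ^ (ofLex q).1 • z - gridLabel q) := rfl

lemma contDiff_gridBump (q : ℕ ×ₗ ℤ ×ₗ ℤ) : ContDiff ℝ ∞ (gridBump q) :=
  contDiff_unitBump.comp ((contDiff_id.const_smul _).sub contDiff_const)

lemma iteratedFDeriv_gridBump (q : ℕ ×ₗ ℤ ×ₗ ℤ) (i : ℕ) (z : ℂ) :
    iteratedFDeriv ℝ i (gridBump q) z = ((2 : ℝ) ^ (ofLex q).1) ^ i •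
      iteratedFDeriv ℝ i unitBump ((2 : ℝ) ^ (ofLex q).1 • z - gridLabel q) := by
  have h1 : ContDiff ℝ i (fun w => unitBump (w - gridLabel q)) :=
    (contDiff_unitBump.comp (contDiff_id.sub contDiff_const)).of_le (by exact_mod_cast le_top)
  have h2 := iteratedFDeriv_comp_const_smul ((2 : ℝ) ^ (ofLex q).1) h1
  have h3 := congrFun h2 z
  rw [iteratedFDeriv_comp_sub] at h3
  exact h3

lemma norm_iteratedFDeriv_gridBump_le {A : ℝ}
    (hA : ∀ i ≤ 2, ∀ z, ‖iteratedFDeriv ℝ i unitBump z‖ ≤ A)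
    (q : ℕ ×ₗ ℤ ×ₗ ℤ) {i : ℕ} (hi : i ≤ 2) (z : ℂ) :
    ‖iteratedFDeriv ℝ i (gridBump q) z‖ ≤ A * ((2 : ℝ) ^ (ofLex q).1) ^ i := by
  rw [iteratedFDeriv_gridBump, norm_smul, Real.norm_of_nonneg (by positivity), mul_comm]
  gcongr
  exact hA i hi _

lemma iteratedFDeriv_gridBump_eq_zero {q : ℕ ×ₗ ℤ ×ₗ ℤ} {z : ℂ}
    (hz : 3 < ‖(2 : ℝ) ^ (ofLex q).1 • z - gridLabel q‖) (i : ℕ) :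
    iteratedFDeriv ℝ i (gridBump q) z = 0 := by
  rw [iteratedFDeriv_gridBump]
  have : (2 : ℝ) ^ (ofLex q).1 • z - gridLabel q ∉ tsupport unitBump := fun h => by
    have := tsupport_unitBump_subset h
    simp only [mem_closedBall, dist_zero_right] at this
    linarith
  rw [show iteratedFDeriv ℝ i unitBump ((2 : ℝ) ^ (ofLex q).1 • z - gridLabel q) = 0 from ?_,
    smul_zero]
  by_contra h
  exact this (support_iteratedFDeriv_subset i h)

lemma card_grid_near_le (Q : Finset (ℕ ×ₗ ℤ ×ₗ ℤ)) (k : ℕ) (w : ℂ) :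
    ((Q.filter fun q => (ofLex q).1 = k).filter fun q => ‖w - gridLabel q‖ ≤ 3).card ≤ 49 := by
  have hbox : ∀ a : ℝ, (Finset.Icc ⌈a - 3⌉ ⌊a + 3⌋).card ≤ 7 := fun a => by
    rw [Int.card_Icc]
    have h1 : ((⌊a + 3⌋ : ℤ) : ℝ) ≤ a + 3 := Int.floor_le _
    have h2 : a - 3 ≤ (⌈a - 3⌉ : ℤ) := Int.le_ceil _
    have h3 : ((⌊a + 3⌋ - ⌈a - 3⌉ : ℤ) : ℝ) ≤ (6 : ℤ) := by push_cast; linarith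
    have h4 : ⌊a + 3⌋ - ⌈a - 3⌉ ≤ 6 := by exact_mod_cast h3
    omega
  calc _ ≤ ((Finset.Icc ⌈w.re - 3⌉ ⌊w.re + 3⌋) ×ˢ (Finset.Icc ⌈w.im - 3⌉ ⌊w.im + 3⌋)).card := by
        refine Finset.card_le_card_of_injOn
          (fun q => ((ofLex (ofLex q).2).1, (ofLex (ofLex q).2).2)) ?_ ?_
        · intro q hq
          simp only [Finset.coe_filter, Finset.mem_filter, Set.mem_ofPred_eq] at hq
          have h1 := (Complex.abs_re_le_norm _).trans hq.2
          have h2 := (Complex.abs_im_le_norm _).trans hq.2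
          simp only [gridLabel, Complex.sub_re, Complex.sub_im, abs_le] at h1 h2
          simp only [Finset.coe_product, Set.mem_prod, Finset.coe_Icc, Set.mem_Icc, Int.ceil_le,
            Int.le_floor]
          refine ⟨⟨?_, ?_⟩, ?_, ?_⟩ <;> linarith
        · intro q hq q' hq' h
          simp only [Finset.coe_filter, Finset.mem_filter, Set.mem_ofPred_eq] at hq hq'
          simp only [Prod.mk.injEq] at h
          have h1 : (ofLex q).1 = (ofLex q').1 := by rw [hq.1.2, hq'.1.2]
          have h2 : (ofLex q).2 = (ofLex q').2 :=
            ofLex.injective (Prod.ext h.1 h.2)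
          exact ofLex.injective (Prod.ext h1 h2)
    _ ≤ 7 * 7 := by
        rw [Finset.card_product]
        exact Nat.mul_le_mul (hbox _) (hbox _)
    _ = 49 := by norm_num

lemma sum_norm_iteratedFDeriv_gridBump_le {A : ℝ} (hA0 : 0 ≤ A)
    (hA : ∀ i ≤ 2, ∀ z, ‖iteratedFDeriv ℝ i unitBump z‖ ≤ A)
    (Q : Finset (ℕ ×ₗ ℤ ×ₗ ℤ)) (k : ℕ) (hQ : ∀ q ∈ Q, (ofLex q).1 ≤ k)
    {i : ℕ} (hi0 : 1 ≤ i) (hi : i ≤ 2) (z : ℂ) :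
    ∑ q ∈ Q, ‖iteratedFDeriv ℝ i (gridBump q) z‖ ≤ 98 * A * ((2 : ℝ) ^ k) ^ i := by
  have hlevel : ∀ k' : ℕ, ∑ q ∈ Q.filter (fun q => (ofLex q).1 = k'),
      ‖iteratedFDeriv ℝ i (gridBump q) z‖ ≤ 49 * A * ((2 : ℝ) ^ k') ^ i := fun k' => by
    rw [← Finset.sum_filter_add_sum_filter_not (Q.filter fun q => (ofLex q).1 = k')
      (fun q => ‖(2 : ℝ) ^ k' • z - gridLabel q‖ ≤ 3)]
    have h2 : ∑ q ∈ (Q.filter fun q => (ofLex q).1 = k').filter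
        (fun q => ¬ ‖(2 : ℝ) ^ k' • z - gridLabel q‖ ≤ 3),
        ‖iteratedFDeriv ℝ i (gridBump q) z‖ = 0 := by
      refine Finset.sum_eq_zero fun q hq => ?_
      simp only [Finset.mem_filter, not_le] at hq
      rw [iteratedFDeriv_gridBump_eq_zero (by rw [hq.1.2]; exact hq.2), norm_zero]
    rw [h2, add_zero]
    refine (Finset.sum_le_card_nsmul _ _ (A * ((2 : ℝ) ^ k') ^ i) fun q hq => ?_).trans ?_
    · simp only [Finset.mem_filter] at hq
      have := norm_iteratedFDeriv_gridBump_le hA q hi z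
      rwa [hq.1.2] at this
    · rw [nsmul_eq_mul, mul_assoc]
      gcongr
      exact_mod_cast card_grid_near_le Q k' _
  have hgeom : ∀ n : ℕ, ∑ k' ∈ Finset.range (n + 1), ((2 : ℝ) ^ k') ^ i ≤
      2 * ((2 : ℝ) ^ n) ^ i := by
    intro n
    induction n with
    | zero => simp
    | succ n ih =>
      rw [Finset.sum_range_succ]
      have : 2 * ((2 : ℝ) ^ n) ^ i ≤ ((2 : ℝ) ^ (n + 1)) ^ i := by
        rw [pow_succ, mul_pow, mul_comm]
        gcongr
        exact le_self_pow₀ (by norm_num) (by omega)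
      linarith
  rw [← Finset.sum_fiberwise_of_maps_to (s := Q) (t := Finset.range (k + 1))
    (g := fun q => (ofLex q).1) (fun q hq => by simpa using Nat.lt_succ_of_le (hQ q hq))]
  calc _ ≤ ∑ k' ∈ Finset.range (k + 1), 49 * A * ((2 : ℝ) ^ k') ^ i :=
        Finset.sum_le_sum fun k' _ => hlevel k'
    _ = 49 * A * ∑ k' ∈ Finset.range (k + 1), ((2 : ℝ) ^ k') ^ i := by rw [Finset.mul_sum]
    _ ≤ 49 * A * (2 * ((2 : ℝ) ^ k) ^ i) := by gcongr; exact hgeom k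
    _ = _ := by ring

lemma norm_iteratedFDeriv_mul_le_of_scale {u v : ℂ → ℂ} (hu : ContDiff ℝ ∞ u)
    (hv : ContDiff ℝ ∞ v) {a b s : ℝ} (ha : 0 ≤ a) (hs : 0 ≤ s) {z : ℂ}
    (hua : ∀ i ≤ 2, ‖iteratedFDeriv ℝ i u z‖ ≤ a * s ^ i)
    (hvb : ∀ i ≤ 2, ‖iteratedFDeriv ℝ i v z‖ ≤ b * s ^ i) (i : ℕ) (hi : i ≤ 2) :
    ‖iteratedFDeriv ℝ i (fun w => u w * v w) z‖ ≤ 4 * (a * b) * s ^ i := by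
  have hb : 0 ≤ b := by simpa using (norm_nonneg _).trans (hvb 0 (by norm_num))
  refine (norm_iteratedFDeriv_mul_le (N := ∞) hu hv z (by exact_mod_cast le_top)).trans ?_
  calc _ ≤ ∑ j ∈ Finset.range (i + 1), (i.choose j : ℝ) * (a * b * s ^ i) := by
        refine Finset.sum_le_sum fun j hj => ?_
        have hj' : j ≤ i := by simpa [Nat.lt_succ_iff] using hj
        rw [mul_assoc]
        refine mul_le_mul_of_nonneg_left ?_ (by positivity)
        calc _ ≤ (a * s ^ j) * (b * s ^ (i - j)) :=
              mul_le_mul (hua j (hj'.trans hi)) (hvb _ ((Nat.sub_le _ _).trans hi))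
                (norm_nonneg _) (by positivity)
          _ = a * b * (s ^ j * s ^ (i - j)) := by ring
          _ = _ := by rw [← pow_add, Nat.add_sub_cancel' hj']
    _ = 2 ^ i * (a * b * s ^ i) := by
        rw [← Finset.sum_mul, ← Nat.cast_sum, Nat.sum_range_choose]; push_cast; ring
    _ ≤ 4 * (a * b * s ^ i) := by
        gcongr
        calc (2 : ℝ) ^ i ≤ 2 ^ 2 := pow_le_pow_right₀ (by norm_num) hi
          _ = 4 := by norm_num
    _ = _ := by ring

lemma norm_iteratedFDeriv_prod_one_sub_le {ι : Type*} (J : Finset ι) {ψ : ι → ℂ → ℂ}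
    (hψ : ∀ j, ContDiff ℝ ∞ (ψ j)) (h1 : ∀ j z, ‖1 - ψ j z‖ ≤ 1) (z : ℂ) :
    ‖∏ j ∈ J, (1 - ψ j z)‖ ≤ 1 ∧
    ‖iteratedFDeriv ℝ 1 (fun w => ∏ j ∈ J, (1 - ψ j w)) z‖ ≤
      ∑ j ∈ J, ‖iteratedFDeriv ℝ 1 (ψ j) z‖ ∧
    ‖iteratedFDeriv ℝ 2 (fun w => ∏ j ∈ J, (1 - ψ j w)) z‖ ≤
      ∑ j ∈ J, ‖iteratedFDeriv ℝ 2 (ψ j) z‖ + (∑ j ∈ J, ‖iteratedFDeriv ℝ 1 (ψ j) z‖) ^ 2 := by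
  classical
  induction J using Finset.induction_on with
  | empty => simp [iteratedFDeriv_const_of_ne]
  | insert j J hj ih =>
    obtain ⟨i0, i1, i2⟩ := ih
    have hF : ContDiff ℝ ∞ (fun w => ∏ j ∈ J, (1 - ψ j w)) :=
      contDiff_prod fun i _ => contDiff_const.sub (hψ i)
    have hG : ContDiff ℝ ∞ (fun w => 1 - ψ j w) := contDiff_const.sub (hψ j)
    have hder : ∀ i : ℕ, 1 ≤ i → ‖iteratedFDeriv ℝ i (fun w => 1 - ψ j w) z‖ =
        ‖iteratedFDeriv ℝ i (ψ j) z‖ := fun i hi => by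
      have := iteratedFDeriv_sub_apply (𝕜 := ℝ) (i := i) (x := z) (f := fun _ : ℂ => (1 : ℂ))
        (g := ψ j) contDiff_const.contDiffAt ((hψ j).of_le (by exact_mod_cast le_top)).contDiffAt
      have h' : (fun w => 1 - ψ j w) = (fun _ : ℂ => (1 : ℂ)) - ψ j := rfl
      rw [h', this, iteratedFDeriv_const_of_ne (by omega)]
      simp
    simp only [Finset.prod_insert hj, Finset.sum_insert hj]
    refine ⟨?_, ?_, ?_⟩
    · rw [norm_mul]
      exact mul_le_one₀ (h1 j z) (norm_nonneg _) i0
    · have h := norm_iteratedFDeriv_mul_le (N := ∞) hG hF z (n := 1) (natCast_le_infty 1)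
      simp only [Finset.sum_range_succ, Finset.range_zero, Finset.sum_empty] at h
      have d0 : ‖iteratedFDeriv ℝ (1 - 1) (fun w => ∏ j ∈ J, (1 - ψ j w)) z‖ =
        ‖∏ j ∈ J, (1 - ψ j z)‖ := norm_iteratedFDeriv_zero
      simp only [Nat.choose_self, Nat.choose_zero_right, Nat.cast_one, one_mul,
        norm_iteratedFDeriv_zero, zero_add, Nat.sub_zero, hder 1 le_rfl] at h
      rw [d0] at h
      have e1 := mul_le_mul (h1 j z) i1 (norm_nonneg _) zero_le_one
      have e2 := mul_le_mul_of_nonneg_left i0 (norm_nonneg (iteratedFDeriv ℝ 1 (ψ j) z))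
      linarith
    · have h := norm_iteratedFDeriv_mul_le (N := ∞) hG hF z (n := 2) (natCast_le_infty 2)
      simp only [Finset.sum_range_succ, Finset.range_zero, Finset.sum_empty] at h
      have d0 : ‖iteratedFDeriv ℝ (2 - 2) (fun w => ∏ j ∈ J, (1 - ψ j w)) z‖ =
        ‖∏ j ∈ J, (1 - ψ j z)‖ := norm_iteratedFDeriv_zero
      have d1 : ‖iteratedFDeriv ℝ (2 - 1) (fun w => ∏ j ∈ J, (1 - ψ j w)) z‖ =
        ‖iteratedFDeriv ℝ 1 (fun w => ∏ j ∈ J, (1 - ψ j w)) z‖ := rfl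
      simp only [Nat.choose_self, Nat.choose_zero_right, Nat.cast_one, one_mul,
        norm_iteratedFDeriv_zero, zero_add, Nat.sub_zero, hder 1 le_rfl,
        hder 2 (by norm_num), Nat.choose_one_right, Nat.cast_ofNat] at h
      rw [d0, d1] at h
      have e1 := mul_le_mul (h1 j z) i2 (norm_nonneg _) zero_le_one
      have e2 := mul_le_mul_of_nonneg_left i0 (norm_nonneg (iteratedFDeriv ℝ 2 (ψ j) z))
      have e3 := mul_le_mul_of_nonneg_left i1 (norm_nonneg (iteratedFDeriv ℝ 1 (ψ j) z))
      have e4 := sq_nonneg ‖iteratedFDeriv ℝ 1 (ψ j) z‖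
      nlinarith

/-- The product of the complementary bumps over the grid squares preceding `q`. -/
def gridCut (Q : Finset (ℕ ×ₗ ℤ ×ₗ ℤ)) (z : ℂ) : ℂ := ∏ q ∈ Q, (1 - gridBump q z)

lemma norm_one_sub_gridBump_le (q : ℕ ×ₗ ℤ ×ₗ ℤ) (z : ℂ) : ‖1 - gridBump q z‖ ≤ 1 :=
  norm_one_sub_unitBump_le _

lemma contDiff_gridCut (Q : Finset (ℕ ×ₗ ℤ ×ₗ ℤ)) : ContDiff ℝ ∞ (gridCut Q) :=
  contDiff_prod fun q _ => contDiff_const.sub (contDiff_gridBump q)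

lemma norm_iteratedFDeriv_gridCut_le {A : ℝ} (hA1 : 1 ≤ A)
    (hA : ∀ i ≤ 2, ∀ z, ‖iteratedFDeriv ℝ i unitBump z‖ ≤ A)
    (Q : Finset (ℕ ×ₗ ℤ ×ₗ ℤ)) (k : ℕ) (hQ : ∀ q ∈ Q, (ofLex q).1 ≤ k) (z : ℂ) (i : ℕ)
    (hi : i ≤ 2) : ‖iteratedFDeriv ℝ i (gridCut Q) z‖ ≤
      (98 * A + (98 * A) ^ 2) * ((2 : ℝ) ^ k) ^ i := by
  obtain ⟨h0, h1, h2⟩ := norm_iteratedFDeriv_prod_one_sub_le Q contDiff_gridBump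
    norm_one_sub_gridBump_le z
  have s1 := sum_norm_iteratedFDeriv_gridBump_le (by linarith) hA Q k hQ le_rfl
    (by norm_num : 1 ≤ 2) z
  have s2 := sum_norm_iteratedFDeriv_gridBump_le (by linarith) hA Q k hQ
    (by norm_num : 1 ≤ 2) le_rfl z
  have hp : (0 : ℝ) < 2 ^ k := by positivity
  interval_cases i
  · rw [norm_iteratedFDeriv_zero, pow_zero]
    refine h0.trans ?_
    nlinarith
  · refine h1.trans (s1.trans ?_)
    gcongr
    nlinarith
  · refine h2.trans ?_
    have : (∑ j ∈ Q, ‖iteratedFDeriv ℝ 1 (gridBump j) z‖) ^ 2 ≤ (98 * A * ((2 : ℝ) ^ k) ^ 1) ^ 2 :=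
      pow_le_pow_left₀ (Finset.sum_nonneg fun _ _ => norm_nonneg _) s1 2
    nlinarith

/-- The pieces of the partition have Laplacian of size `4 ^ k`. -/
lemma exists_norm_lap_piece_le {φ : ℂ → ℂ} (hφ : ContDiff ℝ ∞ φ) (hc : HasCompactSupport φ) :
    ∃ C : ℝ, 0 ≤ C ∧ ∀ (q : ℕ ×ₗ ℤ ×ₗ ℤ) (Q : Finset (ℕ ×ₗ ℤ ×ₗ ℤ)),
      (∀ p ∈ Q, (ofLex p).1 ≤ (ofLex q).1) → ∀ z,
      ‖lap (fun w => φ w * gridBump q w * gridCut Q w) z‖ ≤ C * ((2 : ℝ) ^ (ofLex q).1) ^ 2 := by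
  obtain ⟨A, hA1, hA⟩ := exists_iteratedFDeriv_bound contDiff_unitBump
    (HasCompactSupport.of_support_subset_isCompact (isCompact_closedBall 0 3)
      (subset_closure.trans tsupport_unitBump_subset))
  obtain ⟨B, hB1, hB⟩ := exists_iteratedFDeriv_bound hφ hc
  refine ⟨2 * (4 * ((4 * (B * A)) * (98 * A + (98 * A) ^ 2))), by positivity,
    fun q Q hQ z => ?_⟩
  have hs1 : (1 : ℝ) ≤ 2 ^ (ofLex q).1 := one_le_pow₀ (by norm_num)
  have h1 : ∀ i ≤ 2, ‖iteratedFDeriv ℝ i φ z‖ ≤ B * ((2 : ℝ) ^ (ofLex q).1) ^ i := fun i hi =>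
    (hB i hi z).trans (le_mul_of_one_le_right (by linarith) (one_le_pow₀ hs1))
  have h2 : ∀ i ≤ 2, ‖iteratedFDeriv ℝ i (gridBump q) z‖ ≤ A * ((2 : ℝ) ^ (ofLex q).1) ^ i :=
    fun i hi => norm_iteratedFDeriv_gridBump_le hA q hi z
  have h3 := norm_iteratedFDeriv_mul_le_of_scale hφ (contDiff_gridBump q) (by linarith)
    (by positivity) h1 h2
  have h4 := norm_iteratedFDeriv_mul_le_of_scale (hφ.mul (contDiff_gridBump q))
    (contDiff_gridCut Q) (by positivity) (by positivity) h3
    (norm_iteratedFDeriv_gridCut_le hA1 hA Q _ hQ z) 2 le_rfl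
  have h5 := norm_lap_le (f := fun w => φ w * gridBump q w * gridCut Q w)
    (((hφ.mul (contDiff_gridBump q)).mul (contDiff_gridCut Q)).of_le (natCast_le_infty 2)) z
  calc _ ≤ _ := h5
    _ ≤ 2 * _ := mul_le_mul_of_nonneg_left h4 (by norm_num)
    _ = _ := by ring

/-- If `H` is harmonic near the part of the support of a test function not covered by finitely many
grid squares, the pairing with the Laplacian is controlled by the modulus of continuity on them. -/
lemma exists_norm_integral_mul_lap_le_sum {φ : ℂ → ℂ} (hφ : ContDiff ℝ ∞ φ)
    (hc : HasCompactSupport φ) :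
    ∃ C : ℝ, 0 ≤ C ∧ ∀ (H : ℂ → ℂ) (m : ℝ → ℝ) (V : Set ℂ) (Q : Finset (ℕ ×ₗ ℤ ×ₗ ℤ)),
      Continuous H → IsOpen V → HarmonicOnC H V → MonotoneOn m (Set.Ici 0) →
      (∀ t, 0 ≤ t → m (2 * t) ≤ 2 * m t) → (∀ x y, ‖H x - H y‖ ≤ m ‖x - y‖) →
      (∀ z ∈ tsupport φ \ V, ∃ q ∈ Q, ‖(2 : ℝ) ^ (ofLex q).1 • z - gridLabel q‖ < 2) →
      ‖∫ z, H z * lap φ z‖ ≤ C * ∑ q ∈ Q, m (((2 : ℝ) ^ (ofLex q).1)⁻¹) := by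
  obtain ⟨C, hC0, hC⟩ := exists_norm_lap_piece_le hφ hc
  refine ⟨4 * C * (9 * Real.pi), by positivity, ?_⟩
  intro H m V Q hHc hV hH hmono hdbl hmod hcov
  set g : (ℕ ×ₗ ℤ ×ₗ ℤ) → ℂ → ℂ := fun q w => φ w * gridBump q w * gridCut (Q.filter (· < q)) w
    with hg
  have hgs : ∀ q, ContDiff ℝ 2 (g q) := fun q =>
    ((hφ.mul (contDiff_gridBump q)).mul (contDiff_gridCut _)).of_le (natCast_le_infty 2)
  have hgc : ∀ q, HasCompactSupport (g q) := fun q => (hc.mul_right).mul_right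
  set g0 : ℂ → ℂ := fun w => φ w * gridCut Q w with hg0
  have hg0s : ContDiff ℝ 2 g0 := (hφ.mul (contDiff_gridCut _)).of_le (natCast_le_infty 2)
  have hg0c : HasCompactSupport g0 := hc.mul_right
  have hdecomp : φ = fun w => g0 w + ∑ q ∈ Q, g q w := by
    funext w
    have := Finset.prod_one_sub_ordered Q (fun q => gridBump q w)
    simp only [hg0, hg, gridCut]
    rw [this, mul_sub, mul_one, Finset.mul_sum]
    simp [mul_assoc]
  have hint : ∀ u : ℂ → ℂ, ContDiff ℝ 2 u → HasCompactSupport u →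
      Integrable (fun z => H z * lap u z) := fun u hu huc =>
    integrable_mul_of_continuousOn isOpen_univ hHc.continuousOn (continuous_lap hu)
      (hasCompactSupport_lap huc) (Set.subset_univ _)
  have hlap : ∀ z, lap φ z = lap g0 z + ∑ q ∈ Q, lap (g q) z := fun z => by
    conv_lhs => rw [hdecomp]
    rw [lap_add hg0s (ContDiff.sum fun q _ => hgs q), lap_sum Q fun q _ => hgs q]
  have hzero : ∫ z, H z * lap g0 z = 0 := by
    refine integral_mul_lap_eq_zero hV hH hg0s hg0c fun z hz => ?_
    by_contra hzV
    have hsupp : Function.support g0 ⊆ Function.support φ :=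
      fun x hx h => hx (by simp [hg0, h])
    have hzφ : z ∈ tsupport φ := closure_mono hsupp hz
    obtain ⟨q, hq, hlt⟩ := hcov z ⟨hzφ, hzV⟩
    have hev : ∀ᶠ w in 𝓝 z, ‖(2 : ℝ) ^ (ofLex q).1 • w - gridLabel q‖ < 2 := by
      have : Continuous fun w : ℂ => ‖(2 : ℝ) ^ (ofLex q).1 • w - gridLabel q‖ := by fun_prop
      exact this.continuousAt.eventually (gt_mem_nhds hlt)
    have : g0 =ᶠ[𝓝 z] 0 := by
      filter_upwards [hev] with w hw
      simp only [hg0, gridCut, Pi.zero_apply]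
      rw [Finset.prod_eq_zero hq (by rw [gridBump_apply, unitBump_eq_one hw.le, sub_self]),
        mul_zero]
    exact (notMem_tsupport_iff_eventuallyEq.mpr this) hz
  have hpiece : ∀ q, ‖∫ z, H z * lap (g q) z‖ ≤
      4 * C * (9 * Real.pi) * m (((2 : ℝ) ^ (ofLex q).1)⁻¹) := by
    intro q
    set s : ℝ := (2 : ℝ) ^ (ofLex q).1 with hs
    have hs0 : 0 < s := by positivity
    set p : ℂ := s⁻¹ • gridLabel q with hp
    have hball : ∀ z, z ∉ closedBall p (3 * s⁻¹) → lap (g q) z = 0 := by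
      intro z hz
      by_contra hne
      have hz1 : z ∈ tsupport (g q) := tsupport_lap_subset _ (subset_tsupport _ hne)
      have hsub : tsupport (g q) ⊆ closedBall p (3 * s⁻¹) := ?_
      · exact hz (hsub hz1)
      refine closure_minimal (fun w hw => ?_) isClosed_closedBall
      by_contra hw2
      apply hw
      have : gridBump q w = 0 := by
        rw [gridBump_apply, ← hs]
        apply unitBump_eq_zero
        have e : s • w - gridLabel q = s • (w - p) := by
          rw [hp, smul_sub, smul_smul, mul_inv_cancel₀ hs0.ne', one_smul]
        rw [mem_closedBall, not_le, dist_eq_norm] at hw2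
        rw [e, norm_smul, Real.norm_of_nonneg hs0.le]
        calc (3 : ℝ) = s * (3 * s⁻¹) := by field_simp
          _ ≤ _ := by gcongr
      simp [hg, this]
    have e1 : ∫ z, H z * lap (g q) z = ∫ z, (H z - H p) * lap (g q) z := by
      simp only [sub_mul]
      rw [integral_sub (hint _ (hgs q) (hgc q))
        (((continuous_lap (hgs q)).integrable_of_hasCompactSupport
          (hasCompactSupport_lap (hgc q))).const_mul _), integral_const_mul,
        integral_lap_eq_zero (hgs q) (hgc q), mul_zero, sub_zero]
    have e2 : ∫ z, (H z - H p) * lap (g q) z =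
        ∫ z in closedBall p (3 * s⁻¹), (H z - H p) * lap (g q) z := by
      rw [setIntegral_eq_integral_of_forall_compl_eq_zero]
      intro z hz
      rw [hball z hz, mul_zero]
    have hmod3 : m (3 * s⁻¹) ≤ 4 * m s⁻¹ := by
      have hi : 0 ≤ s⁻¹ := by positivity
      have a1 := hmono (show (0 : ℝ) ≤ 3 * s⁻¹ by positivity)
        (show (0 : ℝ) ≤ 2 * (2 * s⁻¹) by positivity) (by linarith)
      have a2 := hdbl (2 * s⁻¹) (by positivity)
      have a3 := hdbl s⁻¹ hi
      linarith
    rw [e1, e2]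
    refine (norm_setIntegral_le_of_norm_le_const (C := 4 * m s⁻¹ * (C * s ^ 2))
      measure_closedBall_lt_top fun z hz => ?_).trans ?_
    · rw [norm_mul]
      have b1 : ‖H z - H p‖ ≤ 4 * m s⁻¹ := (hmod z p).trans <|
        (hmono (norm_nonneg _) (show (0 : ℝ) ≤ 3 * s⁻¹ by positivity)
          (by simpa [dist_eq_norm] using hz)).trans hmod3
      refine mul_le_mul b1 (hC q _ (fun r hr => ?_) z) (norm_nonneg _)
        ((norm_nonneg _).trans b1)
      have hlt := (Finset.mem_filter.mp hr).2
      rcases Prod.Lex.lt_iff.mp hlt with h | h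
      · exact h.le
      · exact h.1.le
    · rw [Measure.real, Complex.volume_closedBall]
      simp only [ENNReal.toReal_mul, ENNReal.toReal_pow, ENNReal.coe_toReal, NNReal.coe_real_pi]
      rw [ENNReal.toReal_ofReal (by positivity)]
      apply le_of_eq
      field_simp
      ring
  calc ‖∫ z, H z * lap φ z‖ = ‖∑ q ∈ Q, ∫ z, H z * lap (g q) z‖ := by
        congr 1
        simp only [hlap, mul_add, Finset.mul_sum]
        rw [integral_add (hint _ hg0s hg0c) (integrable_finsetSum _ fun q _ => hint _ (hgs q)
          (hgc q)), hzero, zero_add, integral_finsetSum _ fun q _ => hint _ (hgs q) (hgc q)]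
    _ ≤ ∑ q ∈ Q, ‖∫ z, H z * lap (g q) z‖ := norm_sum_le _ _
    _ ≤ ∑ q ∈ Q, 4 * C * (9 * Real.pi) * m (((2 : ℝ) ^ (ofLex q).1)⁻¹) :=
        Finset.sum_le_sum fun q _ => hpiece q
    _ = _ := by rw [Finset.mul_sum]

/-- The trivial bound on the pairing with a Laplacian. -/
lemma exists_norm_integral_mul_lap_le_one {φ : ℂ → ℂ} (hφ : ContDiff ℝ ∞ φ)
    (hc : HasCompactSupport φ) :
    ∃ C : ℝ, 0 ≤ C ∧ ∀ (H : ℂ → ℂ) (m : ℝ → ℝ), Continuous H → MonotoneOn m (Set.Ici 0) →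
      (∀ t, 0 ≤ t → m (2 * t) ≤ 2 * m t) → (∀ x y, ‖H x - H y‖ ≤ m ‖x - y‖) →
      ‖∫ z, H z * lap φ z‖ ≤ C * m 1 := by
  have h2 : ContDiff ℝ 2 φ := hφ.of_le (natCast_le_infty 2)
  have hcl := hasCompactSupport_lap hc
  have hlc := continuous_lap h2
  obtain ⟨R, hR⟩ := hcl.isCompact.isBounded.subset_closedBall 0
  obtain ⟨j, hj⟩ : ∃ j : ℕ, R ≤ 2 ^ j := by
    obtain ⟨j, hj⟩ := exists_nat_gt R
    exact ⟨j, hj.le.trans (by exact_mod_cast Nat.lt_two_pow_self.le)⟩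
  refine ⟨2 ^ j * ∫ z, ‖lap φ z‖, by positivity, fun H m hH hmono hdbl hmod => ?_⟩
  have hint : Integrable (lap φ) := hlc.integrable_of_hasCompactSupport hcl
  have hint2 : Integrable (fun z => H z * lap φ z) :=
    (hH.mul hlc).integrable_of_hasCompactSupport hcl.mul_left
  have e : ∫ z, H z * lap φ z = ∫ z, (H z - H 0) * lap φ z := by
    simp only [sub_mul]
    rw [integral_sub hint2 (hint.const_mul _), integral_const_mul, integral_lap_eq_zero h2 hc,
      mul_zero, sub_zero]
  have hpow : ∀ i : ℕ, m (2 ^ i) ≤ 2 ^ i * m 1 := fun i => by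
    induction i with
    | zero => simp
    | succ i ih =>
      have := hdbl (2 ^ i) (by positivity)
      rw [pow_succ, mul_comm ((2 : ℝ) ^ i) 2]
      linarith
  rw [e]
  calc ‖∫ z, (H z - H 0) * lap φ z‖ ≤ ∫ z, ‖(H z - H 0) * lap φ z‖ :=
        norm_integral_le_integral_norm _
    _ ≤ ∫ z, 2 ^ j * m 1 * ‖lap φ z‖ := by
        refine integral_mono_of_nonneg (Eventually.of_forall fun _ => norm_nonneg _)
          (hint.norm.const_mul _) (Eventually.of_forall fun z => ?_)
        simp only [norm_mul]
        by_cases hz : lap φ z = 0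
        · simp [hz]
        · gcongr
          have h3 : ‖z‖ ≤ R := by simpa using hR (subset_tsupport _ hz)
          refine ((hmod z 0).trans ?_).trans (hpow j)
          rw [sub_zero]
          exact hmono (norm_nonneg _) (show (0 : ℝ) ≤ 2 ^ j by positivity) (h3.trans hj)
    _ = _ := by rw [integral_const_mul]; ring

/-- Every ball of radius at most one lies well inside the grid ball of a comparable grid square. -/
lemma exists_grid_cover (a : ℂ) {r ρ : ℝ} (hr : r ≤ ρ) (hρ0 : 0 < ρ) (hρ1 : ρ ≤ 1) :
    ∃ q : ℕ ×ₗ ℤ ×ₗ ℤ, ((2 : ℝ) ^ (ofLex q).1)⁻¹ ≤ 2 * ρ ∧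
      ∀ z ∈ closedBall a r, ‖(2 : ℝ) ^ (ofLex q).1 • z - gridLabel q‖ < 2 := by
  obtain ⟨k, hk1, hk2⟩ := exists_nat_pow_near_of_lt_one hρ0 hρ1 (by norm_num : (0 : ℝ) < 2⁻¹)
    (by norm_num)
  set s : ℝ := (2 : ℝ) ^ k with hs
  have hs0 : 0 < s := by positivity
  refine ⟨toLex (k, toLex (round (s • a).re, round (s • a).im)), ?_, fun z hz => ?_⟩
  · simp only [ofLex_toLex]
    rw [pow_succ, inv_pow] at hk1
    linarith
  · set p : ℂ := gridLabel (toLex (k, toLex (round (s • a).re, round (s • a).im))) with hp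
    have h2 := abs_sub_round (s • a).re
    have h3 := abs_sub_round (s • a).im
    have h4 : ‖s • (z - a)‖ ≤ 1 := by
      rw [norm_smul, Real.norm_of_nonneg hs0.le]
      have h5 : ‖z - a‖ ≤ (2⁻¹) ^ k := by
        rw [← dist_eq_norm]
        exact (mem_closedBall.mp hz).trans (hr.trans hk2)
      calc s * ‖z - a‖ ≤ s * (2⁻¹) ^ k := by gcongr
        _ = 1 := by rw [hs, ← mul_pow]; norm_num
    have h6 : ‖s • a - p‖ < 1 := by
      rw [← sq_lt_one_iff₀ (norm_nonneg _), Complex.sq_norm, Complex.normSq_apply]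
      have h7 : (s • a - p).re = (s • a).re - round (s • a).re := by simp [hp, gridLabel]
      have h8 : (s • a - p).im = (s • a).im - round (s • a).im := by simp [hp, gridLabel]
      rw [h7, h8]
      rw [abs_le] at h2 h3
      nlinarith
    calc ‖s • z - p‖ = ‖s • (z - a) + (s • a - p)‖ := by rw [smul_sub]; congr 1; ring
      _ ≤ ‖s • (z - a)‖ + ‖s • a - p‖ := norm_add_le _ _
      _ < 2 := by linarith

lemma exists_norm_integral_mul_lap_le_content {φ : ℂ → ℂ} (hφ : ContDiff ℝ ∞ φ)
    (hc : HasCompactSupport φ) :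
    ∃ C : ℝ, 0 < C ∧ ∀ (H : ℂ → ℂ) (m : ℝ → ℝ) (V : Set ℂ),
      Continuous H → IsOpen V → HarmonicOnC H V → MonotoneOn m (Set.Ici 0) →
      (∀ t, 0 ≤ t → m (2 * t) ≤ 2 * m t) → Tendsto m (𝓝[>] 0) (𝓝 0) →
      (∀ x y, ‖H x - H y‖ ≤ m ‖x - y‖) →
      ENNReal.ofReal ‖∫ z, H z * lap φ z‖ ≤ ENNReal.ofReal C * MhContent m (tsupport φ \ V) := by
  obtain ⟨C₁, hC₁, h₁⟩ := exists_norm_integral_mul_lap_le_one hφ hc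
  obtain ⟨C₂, hC₂, h₂⟩ := exists_norm_integral_mul_lap_le_sum hφ hc
  refine ⟨C₁ + 2 * C₂ + 1, by positivity, fun H m V hH hV hHV hmono hdbl hm0 hmod => ?_⟩
  have hmnn : ∀ t, 0 ≤ t → 0 ≤ m t := fun t ht => by
    have := hmod (t : ℂ) 0
    rw [sub_zero, Complex.norm_real, Real.norm_of_nonneg ht] at this
    exact (norm_nonneg _).trans this
  have hCne : ENNReal.ofReal (C₁ + 2 * C₂ + 1) ≠ 0 := by
    rw [Ne, ENNReal.ofReal_eq_zero, not_le]; positivity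
  rw [mul_comm, ← ENNReal.div_le_iff hCne ENNReal.ofReal_ne_top]
  refine le_iInf fun c => le_iInf fun hc0 => le_iInf fun hcov => ?_
  rw [ENNReal.div_le_iff hCne ENNReal.ofReal_ne_top, mul_comm]
  by_cases hbig : ∃ n, 1 < (c n).2
  · obtain ⟨n, hn⟩ := hbig
    calc ENNReal.ofReal ‖∫ z, H z * lap φ z‖ ≤ ENNReal.ofReal (C₁ * m 1) :=
          ENNReal.ofReal_le_ofReal (h₁ H m hH hmono hdbl hmod)
      _ = ENNReal.ofReal C₁ * ENNReal.ofReal (m 1) := ENNReal.ofReal_mul hC₁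
      _ ≤ _ := by
          refine mul_le_mul' (ENNReal.ofReal_le_ofReal (by linarith)) ?_
          refine (ENNReal.ofReal_le_ofReal (hmono (show (0 : ℝ) ≤ 1 by norm_num) (hc0 n)
            hn.le)).trans ?_
          exact ENNReal.le_tsum (f := fun n => ENNReal.ofReal (m (c n).2)) n
  push Not at hbig
  have hK : IsCompact (tsupport φ \ V) := hc.isCompact.diff hV
  refine ENNReal.le_of_forall_pos_le_add fun ε hε _ => ?_
  obtain ⟨e, he0, hesum⟩ := ENNReal.exists_pos_sum_of_countable
    (ε := (ε / (2 * C₂ + 1).toNNReal : NNReal)) (by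
      have : 0 < ε / (2 * C₂ + 1).toNNReal := div_pos hε (Real.toNNReal_pos.mpr (by positivity))
      exact_mod_cast this.ne') ℕ
  have hη : ∀ n, ∃ η : ℝ, 0 < η ∧ η ≤ 1 ∧ m η ≤ e n := fun n => by
    have h3 : ∀ᶠ t in 𝓝[>] (0 : ℝ), m t < e n :=
      hm0.eventually (gt_mem_nhds (by exact_mod_cast he0 n))
    have h4 : ∀ᶠ t in 𝓝[>] (0 : ℝ), t < 1 :=
      eventually_nhdsWithin_of_eventually_nhds (gt_mem_nhds one_pos)
    obtain ⟨t, ⟨ht1, ht2⟩, ht3⟩ := ((h3.and h4).and self_mem_nhdsWithin).exists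
    exact ⟨t, ht3, ht2.le, ht1.le⟩
  choose η hη0 hη1 hηe using hη
  have hq : ∀ n, ∃ q : ℕ ×ₗ ℤ ×ₗ ℤ, ((2 : ℝ) ^ (ofLex q).1)⁻¹ ≤ 2 * max (c n).2 (η n) ∧
      ∀ z ∈ closedBall (c n).1 (c n).2, ‖(2 : ℝ) ^ (ofLex q).1 • z - gridLabel q‖ < 2 := fun n =>
    exists_grid_cover _ (le_max_left _ _) (lt_max_of_lt_right (hη0 n)) (max_le (hbig n) (hη1 n))
  choose q hq1 hq2 using hq
  obtain ⟨F, hF⟩ := hK.elim_finite_subcover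
    (fun n => {z | ‖(2 : ℝ) ^ (ofLex (q n)).1 • z - gridLabel (q n)‖ < 2})
    (fun n => isOpen_lt (by fun_prop) continuous_const)
    (fun z hz => by
      obtain ⟨n, hn⟩ := Set.mem_iUnion.mp (hcov hz)
      exact Set.mem_iUnion.mpr ⟨n, hq2 n z hn⟩)
  have hmain := h₂ H m V (F.image q) hH hV hHV hmono hdbl hmod (fun z hz => by
    obtain ⟨n, hn, hz2⟩ := Set.mem_iUnion₂.mp (hF hz)
    exact ⟨q n, Finset.mem_image_of_mem _ hn, hz2⟩)
  have hsum : ∑ p ∈ F.image q, m (((2 : ℝ) ^ (ofLex p).1)⁻¹) ≤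
      ∑ n ∈ F, 2 * (m (c n).2 + e n) := by
    refine (Finset.sum_image_le_of_nonneg fun n _ => hmnn _ (by positivity)).trans
      (Finset.sum_le_sum fun n _ => ?_)
    have hmax : 0 ≤ max (c n).2 (η n) := le_max_of_le_left (hc0 n)
    have h3 : m (max (c n).2 (η n)) ≤ m (c n).2 + e n := by
      rcases max_choice (c n).2 (η n) with h | h <;> rw [h]
      · linarith [(e n).coe_nonneg]
      · linarith [hηe n, hmnn _ (hc0 n)]
    have h4 := hmono (show (0 : ℝ) ≤ ((2 : ℝ) ^ (ofLex (q n)).1)⁻¹ by positivity)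
      (show (0 : ℝ) ≤ 2 * max (c n).2 (η n) by positivity) (hq1 n)
    linarith [hdbl _ hmax]
  have hF2 : ENNReal.ofReal (∑ n ∈ F, (m (c n).2 + e n)) ≤
      ∑' n, ENNReal.ofReal (m (c n).2) + ∑' n, (e n : ℝ≥0∞) := by
    rw [ENNReal.ofReal_sum_of_nonneg fun n _ => add_nonneg (hmnn _ (hc0 n)) (e n).coe_nonneg,
      ← ENNReal.tsum_add]
    refine (Finset.sum_le_sum fun n _ => ?_).trans (ENNReal.sum_le_tsum F)
    exact (ENNReal.ofReal_add_le).trans (by simp)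
  calc ENNReal.ofReal ‖∫ z, H z * lap φ z‖
      ≤ ENNReal.ofReal ((2 * C₂) * ∑ n ∈ F, (m (c n).2 + e n)) := by
        refine ENNReal.ofReal_le_ofReal (hmain.trans ((mul_le_mul_of_nonneg_left hsum hC₂).trans
            ?_))
        rw [← Finset.mul_sum]
        linarith
    _ = ENNReal.ofReal (2 * C₂) * ENNReal.ofReal (∑ n ∈ F, (m (c n).2 + e n)) :=
        ENNReal.ofReal_mul (by positivity)
    _ ≤ ENNReal.ofReal (2 * C₂) * (∑' n, ENNReal.ofReal (m (c n).2) + ∑' n, (e n : ℝ≥0∞)) := by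
        gcongr
    _ ≤ ENNReal.ofReal (2 * C₂) * ∑' n, ENNReal.ofReal (m (c n).2) +
        ENNReal.ofReal (2 * C₂ + 1) * (ε / (2 * C₂ + 1).toNNReal : NNReal) := by
        rw [mul_add]
        gcongr
        linarith
    _ ≤ _ := by
        refine add_le_add (mul_le_mul' (ENNReal.ofReal_le_ofReal (by linarith)) le_rfl)
          (le_of_eq ?_)
        rw [ENNReal.ofReal, ← ENNReal.coe_mul, mul_div_cancel₀]
        exact ne_of_gt (Real.toNNReal_pos.mpr (by positivity))

/-- A modulus of continuity of `f` on `E` which is monotone and subadditive. -/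
def modulus (E : Set ℂ) (f : ℂ → ℂ) (t : ℝ) : ℝ :=
  sSup {q | ∃ x ∈ E, ∃ y ∈ E, q = ‖f x - f y‖ * min 1 (t / ‖x - y‖)}

lemma mul_min_le_of_le_rpow {α A a d t : ℝ} (hα0 : 0 < α) (hα1 : α < 1) (hA : 0 ≤ A) (hd : 0 ≤ d)
    (ht : 0 ≤ t) (ha : a ≤ A * d ^ α) : a * min 1 (t / d) ≤ A * t ^ α := by
  rcases hd.eq_or_lt with rfl | hd
  · rw [_root_.div_zero, min_eq_right zero_le_one, mul_zero]
    positivity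
  have hmin : 0 ≤ min 1 (t / d) := le_min zero_le_one (by positivity)
  refine (mul_le_mul_of_nonneg_right ha hmin).trans ?_
  rw [mul_assoc]
  refine mul_le_mul_of_nonneg_left ?_ hA
  rcases le_total d t with h | h
  · calc d ^ α * min 1 (t / d) ≤ d ^ α * 1 := by gcongr; exact min_le_left _ _
      _ ≤ t ^ α := by rw [mul_one]; exact Real.rpow_le_rpow hd.le h hα0.le
  · rcases ht.eq_or_lt with rfl | ht
    · simp [Real.zero_rpow hα0.ne']
    calc d ^ α * min 1 (t / d) ≤ d ^ α * (t / d) ^ α := by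
          gcongr
          refine (min_le_right _ _).trans ?_
          have := Real.rpow_le_rpow_of_exponent_ge (div_pos ht hd) ((div_le_one hd).mpr h) hα1.le
          rwa [Real.rpow_one] at this
      _ = t ^ α := by
          rw [← Real.mul_rpow hd.le (by positivity), mul_div_cancel₀ _ hd.ne']

section
variable {α N : ℝ} {E : Set ℂ} {f : ℂ → ℂ}

lemma modulus_bddAbove (hα0 : 0 < α) (hα1 : α < 1) (hN : 0 ≤ N)
    (hf : ∀ x ∈ E, ∀ y ∈ E, ‖f x - f y‖ ≤ N * ‖x - y‖ ^ α) {t : ℝ} (ht : 0 ≤ t) :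
    BddAbove {q | ∃ x ∈ E, ∃ y ∈ E, q = ‖f x - f y‖ * min 1 (t / ‖x - y‖)} := by
  refine ⟨N * t ^ α, ?_⟩
  rintro q ⟨x, hx, y, hy, rfl⟩
  exact mul_min_le_of_le_rpow hα0 hα1 hN (norm_nonneg _) ht (hf x hx y hy)

lemma le_modulus (hα0 : 0 < α) (hα1 : α < 1) (hN : 0 ≤ N)
    (hf : ∀ x ∈ E, ∀ y ∈ E, ‖f x - f y‖ ≤ N * ‖x - y‖ ^ α) {t : ℝ} (ht : 0 ≤ t) {x y : ℂ}
    (hx : x ∈ E) (hy : y ∈ E) : ‖f x - f y‖ * min 1 (t / ‖x - y‖) ≤ modulus E f t :=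
  le_csSup (modulus_bddAbove hα0 hα1 hN hf ht) ⟨x, hx, y, hy, rfl⟩

lemma modulus_le (hE : E.Nonempty) {t B : ℝ}
    (h : ∀ x ∈ E, ∀ y ∈ E, ‖f x - f y‖ * min 1 (t / ‖x - y‖) ≤ B) : modulus E f t ≤ B := by
  obtain ⟨x, hx⟩ := hE
  refine csSup_le ⟨_, x, hx, x, hx, rfl⟩ ?_
  rintro q ⟨x, hx, y, hy, rfl⟩
  exact h x hx y hy

lemma modulus_add_le (hα0 : 0 < α) (hα1 : α < 1) (hN : 0 ≤ N) (hE : E.Nonempty)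
    (hf : ∀ x ∈ E, ∀ y ∈ E, ‖f x - f y‖ ≤ N * ‖x - y‖ ^ α) {s t : ℝ} (hs : 0 ≤ s) (ht : 0 ≤ t) :
    modulus E f (s + t) ≤ modulus E f s + modulus E f t := by
  refine modulus_le hE fun x hx y hy => ?_
  have h1 := le_modulus hα0 hα1 hN hf hs hx hy
  have h2 := le_modulus hα0 hα1 hN hf ht hx hy
  have h3 : min 1 ((s + t) / ‖x - y‖) ≤ min 1 (s / ‖x - y‖) + min 1 (t / ‖x - y‖) := by
    rw [add_div]
    have a : 0 ≤ s / ‖x - y‖ := by positivity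
    have b : 0 ≤ t / ‖x - y‖ := by positivity
    rcases min_choice 1 (s / ‖x - y‖) with h | h <;> rcases min_choice 1 (t / ‖x - y‖) with h' | h'
      <;> rw [h, h']
    · linarith [min_le_left 1 (s / ‖x - y‖ + t / ‖x - y‖)]
    · linarith [min_le_left 1 (s / ‖x - y‖ + t / ‖x - y‖)]
    · linarith [min_le_left 1 (s / ‖x - y‖ + t / ‖x - y‖)]
    · exact min_le_right _ _
  have := mul_le_mul_of_nonneg_left h3 (norm_nonneg (f x - f y))
  linarith

lemma modulus_mono (hα0 : 0 < α) (hα1 : α < 1) (hN : 0 ≤ N) (hE : E.Nonempty)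
    (hf : ∀ x ∈ E, ∀ y ∈ E, ‖f x - f y‖ ≤ N * ‖x - y‖ ^ α) :
    MonotoneOn (modulus E f) (Set.Ici 0) := by
  intro s _ t (ht : 0 ≤ t) hst
  refine modulus_le hE fun x hx y hy => le_trans ?_ (le_modulus hα0 hα1 hN hf ht hx hy)
  gcongr

lemma norm_sub_le_modulus (hα0 : 0 < α) (hα1 : α < 1) (hN : 0 ≤ N)
    (hf : ∀ x ∈ E, ∀ y ∈ E, ‖f x - f y‖ ≤ N * ‖x - y‖ ^ α) {x y : ℂ}
    (hx : x ∈ E) (hy : y ∈ E) : ‖f x - f y‖ ≤ modulus E f ‖x - y‖ := by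
  have h := le_modulus hα0 hα1 hN hf (norm_nonneg (x - y)) hx hy
  by_cases hxy : x = y
  · subst hxy
    simpa using h
  · rwa [div_self (norm_ne_zero_iff.mpr (sub_ne_zero.mpr hxy)), min_self, mul_one] at h

lemma modulus_le_rpow (hα0 : 0 < α) (hα1 : α < 1) (hN : 0 ≤ N) (hE : E.Nonempty)
    (hf : ∀ x ∈ E, ∀ y ∈ E, ‖f x - f y‖ ≤ N * ‖x - y‖ ^ α) {t : ℝ} (ht : 0 ≤ t) :
    modulus E f t ≤ N * t ^ α :=
  modulus_le hE fun x hx y hy =>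
    mul_min_le_of_le_rpow hα0 hα1 hN (norm_nonneg _) ht (hf x hx y hy)

lemma modulus_nonneg (hα0 : 0 < α) (hα1 : α < 1) (hN : 0 ≤ N) (hE : E.Nonempty)
    (hf : ∀ x ∈ E, ∀ y ∈ E, ‖f x - f y‖ ≤ N * ‖x - y‖ ^ α) {t : ℝ} (ht : 0 ≤ t) :
    0 ≤ modulus E f t := by
  obtain ⟨x, hx⟩ := hE
  simpa using le_modulus hα0 hα1 hN hf ht hx hx

lemma tendsto_modulus_div (hα0 : 0 < α) (hα1 : α < 1) (hN : 0 ≤ N) (hE : E.Nonempty)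
    (hf : ∀ x ∈ E, ∀ y ∈ E, ‖f x - f y‖ ≤ N * ‖x - y‖ ^ α)
    (hl : ∀ ε > 0, ∃ δ > 0, ∀ x ∈ E, ∀ y ∈ E, ‖x - y‖ ≤ δ → ‖f x - f y‖ ≤ ε * ‖x - y‖ ^ α) :
    Tendsto (fun t => modulus E f t / t ^ α) (𝓝[>] 0) (𝓝 0) := by
  rw [Metric.tendsto_nhds]
  intro ε hε
  obtain ⟨δ, hδ, hδ2⟩ := hl (ε / 2) (by positivity)
  have h1 : Tendsto (fun t : ℝ => N * (t / δ) ^ (1 - α)) (𝓝[>] 0) (𝓝 0) := by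
    have : ContinuousAt (fun t : ℝ => N * (t / δ) ^ (1 - α)) 0 :=
      continuousAt_const.mul ((continuousAt_id.div_const δ).rpow_const (Or.inr (by linarith)))
    have h2 := this.tendsto.mono_left (nhdsWithin_le_nhds (s := Set.Ioi 0))
    simpa [Real.zero_rpow (show 1 - α ≠ 0 by linarith)] using h2
  filter_upwards [h1.eventually (gt_mem_nhds (half_pos hε)), self_mem_nhdsWithin] with t ht1 ht
  have ht : 0 < t := ht
  have htα : 0 < t ^ α := Real.rpow_pos_of_pos ht _
  rw [Real.dist_eq, sub_zero, abs_of_nonneg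
    (div_nonneg (modulus_nonneg hα0 hα1 hN hE hf ht.le) htα.le), div_lt_iff₀ htα]
  refine lt_of_le_of_lt (b := ε / 2 * t ^ α) (modulus_le hE fun x hx y hy => ?_)
    (by nlinarith)
  rcases le_or_gt ‖x - y‖ δ with h | h
  · exact mul_min_le_of_le_rpow hα0 hα1 (half_pos hε).le (norm_nonneg _) ht.le (hδ2 x hx y hy h)
  · have hd : 0 < ‖x - y‖ := hδ.trans h
    have e1 : ‖x - y‖ ^ α * (t / ‖x - y‖) = t ^ α * (t / ‖x - y‖) ^ (1 - α) := by
      rw [Real.div_rpow ht.le hd.le, Real.rpow_sub ht, Real.rpow_sub hd, Real.rpow_one,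
        Real.rpow_one]
      have := Real.rpow_pos_of_pos hd α
      field_simp
    calc ‖f x - f y‖ * min 1 (t / ‖x - y‖) ≤ (N * ‖x - y‖ ^ α) * (t / ‖x - y‖) :=
          mul_le_mul (hf x hx y hy) (min_le_right _ _) (le_min zero_le_one (by positivity))
            (by positivity)
      _ = N * (t / ‖x - y‖) ^ (1 - α) * t ^ α := by rw [mul_assoc, e1]; ring
      _ ≤ N * (t / δ) ^ (1 - α) * t ^ α := by
          gcongr
      _ ≤ ε / 2 * t ^ α := by gcongr

end

/-- McShane's extension theorem for a subadditive modulus of continuity. -/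
lemma exists_real_extension {E : Set ℂ} (hE : E.Nonempty) {m : ℝ → ℝ}
    (hmono : MonotoneOn m (Set.Ici 0)) (hadd : ∀ s t, 0 ≤ s → 0 ≤ t → m (s + t) ≤ m s + m t)
    (h0 : m 0 = 0) {g : ℂ → ℝ} (hg : ∀ x ∈ E, ∀ y ∈ E, |g x - g y| ≤ m ‖x - y‖) :
    ∃ F : ℂ → ℝ, (∀ z ∈ E, F z = g z) ∧ ∀ x y, |F x - F y| ≤ m ‖x - y‖ := by
  have : Nonempty E := hE.to_subtype
  have htri : ∀ x y z : ℂ, m ‖x - z‖ ≤ m ‖x - y‖ + m ‖y - z‖ := fun x y z =>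
    (hmono (norm_nonneg (x - z)) (show (0 : ℝ) ≤ ‖x - y‖ + ‖y - z‖ by positivity)
      (norm_sub_le_norm_sub_add_norm_sub x y z)).trans (hadd _ _ (norm_nonneg _) (norm_nonneg _))
  have hlow : ∀ x : ℂ, ∀ y₀ ∈ E, ∀ y : E, g y₀ - m ‖y₀ - x‖ ≤ g y + m ‖x - y‖ :=
      fun x y₀ hy₀ y => by
    have h1 := (abs_le.mp (hg y₀ hy₀ y y.2)).2
    have h2 := htri y₀ x y
    linarith
  have hbdd : ∀ x : ℂ, BddBelow (Set.range fun y : E => g y + m ‖x - y‖) := fun x => by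
    obtain ⟨y₀, hy₀⟩ := hE
    exact ⟨_, by rintro _ ⟨y, rfl⟩; exact hlow x y₀ hy₀ y⟩
  have hle : ∀ x x' : ℂ, (⨅ y : E, g y + m ‖x - y‖) ≤ (⨅ y : E, g y + m ‖x' - y‖) + m ‖x - x'‖ := by
    intro x x'
    rw [← sub_le_iff_le_add]
    refine le_ciInf fun y => ?_
    have : (⨅ y : E, g y + m ‖x - y‖) ≤ g y + m ‖x - y‖ := ciInf_le (hbdd x) y
    have h2 := htri x x' y
    linarith
  refine ⟨fun x => ⨅ y : E, g y + m ‖x - y‖, fun z hz => le_antisymm ?_ ?_, fun x y => ?_⟩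
  · have := ciInf_le (hbdd z) ⟨z, hz⟩
    simpa [h0] using this
  · refine le_ciInf fun y => ?_
    have := hlow z z hz y
    simpa [h0] using this
  · rw [abs_le]
    have h1 := hle x y
    have h2 := hle y x
    rw [norm_sub_rev y x] at h2
    constructor <;> linarith

/-- A function in the little Lipschitz class has an extension with an admissible modulus. -/
lemma exists_extension_modulus {α N : ℝ} {E : Set ℂ} {f : ℂ → ℂ} (hα0 : 0 < α) (hα1 : α < 1)
    (hN : 0 ≤ N) (hE : E.Nonempty) (hf : ∀ x ∈ E, ∀ y ∈ E, ‖f x - f y‖ ≤ N * ‖x - y‖ ^ α)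
    (hl : ∀ ε > 0, ∃ δ > 0, ∀ x ∈ E, ∀ y ∈ E, ‖x - y‖ ≤ δ → ‖f x - f y‖ ≤ ε * ‖x - y‖ ^ α) :
    ∃ (H : ℂ → ℂ) (m : ℝ → ℝ), (∀ z ∈ E, H z = f z) ∧ MonotoneOn m (Set.Ici 0) ∧
      (∀ t, 0 ≤ t → m (2 * t) ≤ 2 * m t) ∧ (∀ t, 0 ≤ t → 0 ≤ m t ∧ m t ≤ 2 * N * t ^ α) ∧
      Tendsto (fun t => m t / t ^ α) (𝓝[>] 0) (𝓝 0) ∧ ∀ x y, ‖H x - H y‖ ≤ m ‖x - y‖ := by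
  have hmono := modulus_mono hα0 hα1 hN hE hf
  have hadd : ∀ s t, 0 ≤ s → 0 ≤ t → modulus E f (s + t) ≤ modulus E f s + modulus E f t :=
    fun s t hs ht => modulus_add_le hα0 hα1 hN hE hf hs ht
  have hnn : ∀ t, 0 ≤ t → 0 ≤ modulus E f t := fun t ht => modulus_nonneg hα0 hα1 hN hE hf ht
  have hle : ∀ t, 0 ≤ t → modulus E f t ≤ N * t ^ α := fun t ht =>
    modulus_le_rpow hα0 hα1 hN hE hf ht
  have h0 : modulus E f 0 = 0 := le_antisymm
    (by simpa [Real.zero_rpow hα0.ne'] using hle 0 le_rfl) (hnn 0 le_rfl)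
  obtain ⟨F, hF1, hF2⟩ := exists_real_extension hE hmono hadd h0 (g := fun z => (f z).re)
    fun x hx y hy => (by rw [← Complex.sub_re]; exact Complex.abs_re_le_norm _ :
      |(f x).re - (f y).re| ≤ ‖f x - f y‖).trans (norm_sub_le_modulus hα0 hα1 hN hf hx hy)
  obtain ⟨G, hG1, hG2⟩ := exists_real_extension hE hmono hadd h0 (g := fun z => (f z).im)
    fun x hx y hy => (by rw [← Complex.sub_im]; exact Complex.abs_im_le_norm _ :
      |(f x).im - (f y).im| ≤ ‖f x - f y‖).trans (norm_sub_le_modulus hα0 hα1 hN hf hx hy)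
  refine ⟨fun z => ⟨F z, G z⟩, fun t => 2 * modulus E f t, fun z hz => ?_, ?_, ?_, ?_, ?_, ?_⟩
  · exact Complex.ext (hF1 z hz) (hG1 z hz)
  · exact fun s hs t ht hst => mul_le_mul_of_nonneg_left (hmono hs ht hst) zero_le_two
  · intro t ht
    have := hadd t t ht ht
    rw [← two_mul] at this
    linarith
  · intro t ht
    have := hnn t ht
    have := hle t ht
    constructor <;> linarith
  · have := (tendsto_modulus_div hα0 hα1 hN hE hf hl).const_mul 2
    simpa [mul_div_assoc] using this
  · intro x y
    have h1 := Complex.norm_le_abs_re_add_abs_im ((⟨F x, G x⟩ : ℂ) - ⟨F y, G y⟩)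
    rw [Complex.sub_re, Complex.sub_im] at h1
    linarith [hF2 x y, hG2 x y]

lemma LittleHolderOn.forall_exists {α : ℝ} {E : Set ℂ} {f : ℂ → ℂ} (h : LittleHolderOn α E f) :
    ∀ ε > 0, ∃ δ > 0, ∀ x ∈ E, ∀ y ∈ E, ‖x - y‖ ≤ δ → ‖f x - f y‖ ≤ ε * ‖x - y‖ ^ α := by
  intro ε hε
  obtain ⟨⟨C, hC⟩, hlim⟩ := h
  obtain ⟨δ, hδ, hδ0⟩ := ((hlim.eventually (gt_mem_nhds hε)).and self_mem_nhdsWithin).exists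
  refine ⟨δ, hδ0, fun x hx y hy hxy => ?_⟩
  by_cases hne : x = y
  · subst hne
    simp only [sub_self, norm_zero]
    have := Real.rpow_nonneg (le_refl (0 : ℝ)) α
    positivity
  · have hpos : 0 < ‖x - y‖ ^ α :=
      Real.rpow_pos_of_pos (norm_pos_iff.mpr (sub_ne_zero.mpr hne)) _
    rw [← div_le_iff₀ hpos]
    have hbdd : BddAbove {q | ∃ x ∈ E, ∃ y ∈ E, x ≠ y ∧ ‖x - y‖ ≤ δ ∧
        q = ‖f x - f y‖ / ‖x - y‖ ^ α} := ⟨C, ?_⟩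
    · exact le_trans (le_csSup hbdd ⟨x, hx, y, hy, hne, hxy, rfl⟩) hδ.le
    rintro q ⟨x, hx, y, hy, hne, -, rfl⟩
    rw [div_le_iff₀ (Real.rpow_pos_of_pos (norm_pos_iff.mpr (sub_ne_zero.mpr hne)) _)]
    exact hC x hx y hy

lemma continuous_of_modulus {H : ℂ → ℂ} {m : ℝ → ℝ} (h0 : m 0 = 0) (hm : Tendsto m (𝓝[>] 0) (𝓝 0))
    (hmod : ∀ x y, ‖H x - H y‖ ≤ m ‖x - y‖) : Continuous H := by
  rw [Metric.continuous_iff]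
  intro x ε hε
  obtain ⟨δ, hδ, h⟩ := Metric.mem_nhdsWithin_iff.mp (hm.eventually (gt_mem_nhds hε))
  refine ⟨δ, hδ, fun y hy => ?_⟩
  rw [dist_eq_norm]
  refine (hmod y x).trans_lt ?_
  rcases (norm_nonneg (y - x)).eq_or_lt with h1 | h1
  · rwa [← h1, h0]
  · exact h ⟨by rw [mem_ball_zero_iff, norm_norm, ← dist_eq_norm]; exact hy, h1⟩

lemma tendsto_of_tendsto_div_rpow {m : ℝ → ℝ} {α : ℝ} (hα0 : 0 < α)
    (hm : Tendsto (fun t => m t / t ^ α) (𝓝[>] 0) (𝓝 0)) : Tendsto m (𝓝[>] 0) (𝓝 0) := by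
  have h1 : Tendsto (fun t : ℝ => t ^ α) (𝓝[>] 0) (𝓝 0) := by
    have : ContinuousAt (fun t : ℝ => t ^ α) 0 :=
      continuousAt_id.rpow_const (Or.inr hα0.le)
    have h2 := this.tendsto.mono_left (nhdsWithin_le_nhds (s := Set.Ioi 0))
    simpa [Real.zero_rpow hα0.ne'] using h2
  have h2 := hm.mul h1
  rw [mul_zero] at h2
  refine h2.congr' ?_
  filter_upwards [self_mem_nhdsWithin] with t ht
  exact div_mul_cancel₀ _ (Real.rpow_pos_of_pos ht _).ne'

lemma lap_of_hasFDerivAt {ψ : ℂ → ℂ} {ψ' : ℂ → ℂ →L[ℝ] ℂ}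
    (h : ∀ v, HasFDerivAt ψ (ψ' v) v) (v : ℂ) :
    lap ψ v = fderiv ℝ (fun w => ψ' w 1) v 1 + fderiv ℝ (fun w => ψ' w Complex.I) v Complex.I := by
  have : ∀ w, fderiv ℝ ψ w = ψ' w := fun w => (h w).fderiv
  simp only [lap, this]

lemma hasFDerivAt_normSq (v : ℂ) : HasFDerivAt (fun w : ℂ => Complex.normSq w)
    ((2 * v.re) • Complex.reCLM + (2 * v.im) • Complex.imCLM) v := by
  have h1 : HasFDerivAt (fun w : ℂ => w.re) Complex.reCLM v := Complex.reCLM.hasFDerivAt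
  have h2 : HasFDerivAt (fun w : ℂ => w.im) Complex.imCLM v := Complex.imCLM.hasFDerivAt
  have h3 := (h1.mul h1).add (h2.mul h2)
  refine (h3.congr_of_eventuallyEq (Eventually.of_forall fun w => ?_)).congr_fderiv ?_
  · simp [Complex.normSq_apply]
  · ext
    simp
    ring

lemma hasFDerivAt_radial {p p' : ℝ → ℝ} (hp : ∀ s, HasDerivAt p (p' s) s) (v : ℂ) :
    HasFDerivAt (fun w : ℂ => ((p (Complex.normSq w) : ℝ) : ℂ))
      (Complex.ofRealCLM.comp
        (p' (Complex.normSq v) • ((2 * v.re) • Complex.reCLM + (2 * v.im) • Complex.imCLM))) v :=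
  Complex.ofRealCLM.hasFDerivAt.comp v ((hp _).comp_hasFDerivAt v (hasFDerivAt_normSq v))

/-- The Laplacian of a radial function times the conjugate coordinate. -/
lemma lap_radial_mul_conj {p p' p'' : ℝ → ℝ} (hp : ∀ s, HasDerivAt p (p' s) s)
    (hp' : ∀ s, HasDerivAt p' (p'' s) s) (v : ℂ) :
    lap (fun w => ((p (Complex.normSq w) : ℝ) : ℂ) * conj w) v =
      4 * ((2 * p' (Complex.normSq v) + Complex.normSq v * p'' (Complex.normSq v) : ℝ) : ℂ)
        * conj v := by
  have hconj : ∀ w : ℂ, HasFDerivAt (fun w : ℂ => conj w) (Complex.conjCLE : ℂ →L[ℝ] ℂ) w :=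
    fun w => Complex.conjCLE.hasFDerivAt
  have h1 := fun w : ℂ => (hasFDerivAt_radial hp w).mul (hconj w)
  rw [lap_of_hasFDerivAt (ψ := fun w => ((p (Complex.normSq w) : ℝ) : ℂ) * conj w) h1]
  have hre : ∀ w : ℂ, HasFDerivAt (fun w : ℂ => ((w.re : ℝ) : ℂ))
      (Complex.ofRealCLM.comp Complex.reCLM) w :=
    fun w => (Complex.ofRealCLM.comp Complex.reCLM).hasFDerivAt
  have him : ∀ w : ℂ, HasFDerivAt (fun w : ℂ => ((w.im : ℝ) : ℂ))
      (Complex.ofRealCLM.comp Complex.imCLM) w :=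
    fun w => (Complex.ofRealCLM.comp Complex.imCLM).hasFDerivAt
  have e1 := ((((hasFDerivAt_radial hp' v).mul (hre v)).mul (hconj v)).const_mul 2).add
    (hasFDerivAt_radial hp v)
  have e2 := ((((hasFDerivAt_radial hp' v).mul (him v)).mul (hconj v)).const_mul 2).sub
    ((hasFDerivAt_radial hp v).mul_const Complex.I)
  rw [(e1.congr_of_eventuallyEq (Eventually.of_forall fun w => ?_)).fderiv,
    (e2.congr_of_eventuallyEq (Eventually.of_forall fun w => ?_)).fderiv]
  · apply Complex.ext <;> simp [Complex.normSq_apply] <;> ring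
  · simp
    ring
  · simp
    ring

/-- A smooth cutoff on the half-line. -/
def cutoff (t : ℝ) : ℝ := Real.smoothTransition (4 / 3 * (1 - t))

lemma contDiff_cutoff : ContDiff ℝ ∞ cutoff :=
  Real.smoothTransition.contDiff.comp (contDiff_const.mul (contDiff_const.sub contDiff_id))

lemma cutoff_eq_one {t : ℝ} (ht : t ≤ 1 / 4) : cutoff t = 1 :=
  Real.smoothTransition.one_of_one_le (by linarith)

lemma cutoff_eq_zero {t : ℝ} (ht : 1 ≤ t) : cutoff t = 0 :=
  Real.smoothTransition.zero_of_nonpos (by linarith)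

lemma contDiff_deriv_cutoff : ContDiff ℝ ∞ (deriv cutoff) :=
  (contDiff_infty_iff_deriv.mp contDiff_cutoff).2

lemma contDiff_deriv_deriv_cutoff : ContDiff ℝ ∞ (deriv (deriv cutoff)) :=
  (contDiff_infty_iff_deriv.mp contDiff_deriv_cutoff).2

lemma hasDerivAt_cutoff (t : ℝ) : HasDerivAt cutoff (deriv cutoff t) t :=
  (contDiff_cutoff.differentiable (by simp) t).hasDerivAt

lemma hasDerivAt_deriv_cutoff (t : ℝ) : HasDerivAt (deriv cutoff) (deriv (deriv cutoff) t) t :=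
  (contDiff_deriv_cutoff.differentiable (by simp) t).hasDerivAt

lemma deriv_cutoff_eq_zero_of_lt {t : ℝ} (ht : t < 1 / 4) : deriv cutoff t = 0 := by
  have : cutoff =ᶠ[𝓝 t] fun _ => 1 := by
    filter_upwards [gt_mem_nhds ht] with s hs using cutoff_eq_one hs.le
  rw [this.deriv_eq, deriv_const]

lemma deriv_cutoff_eq_zero_of_gt {t : ℝ} (ht : 1 < t) : deriv cutoff t = 0 := by
  have : cutoff =ᶠ[𝓝 t] fun _ => 0 := by
    filter_upwards [lt_mem_nhds ht] with s hs using cutoff_eq_zero hs.le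
  rw [this.deriv_eq, deriv_const]

lemma deriv_deriv_cutoff_eq_zero_of_lt {t : ℝ} (ht : t < 1 / 4) : deriv (deriv cutoff) t = 0 := by
  have : deriv cutoff =ᶠ[𝓝 t] fun _ => 0 := by
    filter_upwards [gt_mem_nhds ht] with s hs using deriv_cutoff_eq_zero_of_lt hs
  rw [this.deriv_eq, deriv_const]

lemma deriv_deriv_cutoff_eq_zero_of_gt {t : ℝ} (ht : 1 < t) : deriv (deriv cutoff) t = 0 := by
  have : deriv cutoff =ᶠ[𝓝 t] fun _ => 0 := by
    filter_upwards [lt_mem_nhds ht] with s hs using deriv_cutoff_eq_zero_of_gt hs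
  rw [this.deriv_eq, deriv_const]

/-- The radial profile of the difference of two truncations of `1 / v`. -/
def annProfile (s : ℝ) : ℝ := (cutoff s - cutoff (4 * s)) / s

lemma mul_annProfile (s : ℝ) : s * annProfile s = cutoff s - cutoff (4 * s) := by
  by_cases hs : s = 0
  · subst hs
    simp
  · exact mul_div_cancel₀ _ hs

lemma annProfile_eq_zero_of_le {s : ℝ} (hs : s ≤ 1 / 16) : annProfile s = 0 := by
  rw [annProfile, cutoff_eq_one (by linarith), cutoff_eq_one (by linarith), sub_self,
      _root_.zero_div]

lemma annProfile_eq_zero_of_ge {s : ℝ} (hs : 1 ≤ s) : annProfile s = 0 := by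
  rw [annProfile, cutoff_eq_zero (by linarith), cutoff_eq_zero (by linarith), sub_self,
    _root_.zero_div]

lemma contDiff_annProfile : ContDiff ℝ ∞ annProfile := by
  rw [contDiff_iff_contDiffAt]
  intro s
  by_cases hs : s = 0
  · have : annProfile =ᶠ[𝓝 s] fun _ => 0 := by
      have h : s < 1 / 16 := by rw [hs]; norm_num
      filter_upwards [gt_mem_nhds h] with t ht using annProfile_eq_zero_of_le ht.le
    exact contDiffAt_const.congr_of_eventuallyEq this
  · exact (contDiff_cutoff.sub (contDiff_cutoff.comp (contDiff_const.mul
      contDiff_id))).contDiffAt.div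
      contDiffAt_id hs

lemma contDiff_deriv_annProfile : ContDiff ℝ ∞ (deriv annProfile) :=
  (contDiff_infty_iff_deriv.mp contDiff_annProfile).2

lemma hasDerivAt_annProfile (t : ℝ) : HasDerivAt annProfile (deriv annProfile t) t :=
  (contDiff_annProfile.differentiable (by simp) t).hasDerivAt

lemma hasDerivAt_deriv_annProfile (t : ℝ) :
    HasDerivAt (deriv annProfile) (deriv (deriv annProfile) t) t :=
  (contDiff_deriv_annProfile.differentiable (by simp) t).hasDerivAt

lemma two_mul_deriv_annProfile_add (s : ℝ) :
    2 * deriv annProfile s + s * deriv (deriv annProfile) s =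
      deriv (deriv cutoff) s - 16 * deriv (deriv cutoff) (4 * s) := by
  have h1 : ∀ t, annProfile t + t * deriv annProfile t =
      deriv cutoff t - 4 * deriv cutoff (4 * t) := fun t => by
    have a := (hasDerivAt_id t).mul (hasDerivAt_annProfile t)
    have b := (hasDerivAt_cutoff t).sub ((hasDerivAt_cutoff (4 * t)).comp t
      ((hasDerivAt_id t).const_mul 4))
    have e : (id * annProfile) = (cutoff - cutoff ∘ fun y => 4 * id y) := by
      funext y
      simpa using mul_annProfile y
    rw [e] at a
    have := a.unique b
    simp only [id] at this
    linarith
  have a := (hasDerivAt_annProfile s).add ((hasDerivAt_id s).mul (hasDerivAt_deriv_annProfile s))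
  have b := (hasDerivAt_deriv_cutoff s).sub (((hasDerivAt_deriv_cutoff (4 * s)).comp s
      ((hasDerivAt_id s).const_mul 4)).const_mul 4)
  have a' := a.congr_of_eventuallyEq (f₁ := fun y => deriv cutoff y - 4 * deriv cutoff (4 * y))
    (Eventually.of_forall fun y => by simpa using (h1 y).symm)
  have := a'.unique b
  simp only [id] at this
  linarith

/-- The test function `(g(|v|²) - g(4|v|²)) / v`. -/
def annTest (v : ℂ) : ℂ := ((annProfile (Complex.normSq v) : ℝ) : ℂ) * conj v

/-- The Laplacian of `g(|v|²) / v` off the origin. -/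
def cauchyKer (v : ℂ) : ℂ := 4 * ((deriv (deriv cutoff) (Complex.normSq v) : ℝ) : ℂ) * conj v

lemma contDiff_normSq : ContDiff ℝ ∞ (fun v : ℂ => Complex.normSq v) := by
  have : (fun v : ℂ => Complex.normSq v) = fun v : ℂ => ‖v‖ ^ 2 := by
    funext v; rw [Complex.sq_norm]
  rw [this]
  exact contDiff_norm_sq ℝ

lemma contDiff_annTest : ContDiff ℝ ∞ annTest :=
  (Complex.ofRealCLM.contDiff.comp (contDiff_annProfile.comp contDiff_normSq)).mul
    Complex.conjCLE.contDiff

lemma continuous_cauchyKer : Continuous cauchyKer := by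
  have h1 : Continuous (deriv (deriv cutoff)) := contDiff_deriv_deriv_cutoff.continuous
  have h2 : Continuous (fun v : ℂ => Complex.normSq v) := contDiff_normSq.continuous
  unfold cauchyKer
  fun_prop

lemma lap_annTest (v : ℂ) : lap annTest v = cauchyKer v - 8 * cauchyKer ((2 : ℝ) • v) := by
  have := lap_radial_mul_conj hasDerivAt_annProfile hasDerivAt_deriv_annProfile v
  rw [two_mul_deriv_annProfile_add] at this
  unfold annTest
  rw [this]
  simp only [cauchyKer, Complex.real_smul, map_mul, Complex.normSq_ofReal, Complex.conj_ofReal]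
  norm_num
  ring

lemma support_annTest {v : ℂ} (h : annTest v ≠ 0) : 1 / 4 ≤ ‖v‖ ∧ ‖v‖ ≤ 1 := by
  by_contra hcon
  apply h
  rw [annTest, ← Complex.sq_norm]
  rw [not_and_or, not_le, not_le] at hcon
  have h0 := norm_nonneg v
  rcases hcon with h1 | h1
  · rw [annProfile_eq_zero_of_le (by nlinarith)]; simp
  · rw [annProfile_eq_zero_of_ge (by nlinarith)]; simp

lemma tsupport_annTest_subset : tsupport annTest ⊆ {v | 1 / 4 ≤ ‖v‖ ∧ ‖v‖ ≤ 1} := by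
  refine closure_minimal (fun v hv => support_annTest hv) ?_
  exact (isClosed_le continuous_const continuous_norm).inter
    (isClosed_le continuous_norm continuous_const)

lemma hasCompactSupport_annTest : HasCompactSupport annTest :=
  HasCompactSupport.of_support_subset_isCompact (isCompact_closedBall 0 1) fun v hv => by
    simpa using (support_annTest hv).2

lemma cauchyKer_support {v : ℂ} (h : cauchyKer v ≠ 0) : 1 / 2 ≤ ‖v‖ ∧ ‖v‖ ≤ 1 := by
  by_contra hcon
  apply h
  rw [cauchyKer, ← Complex.sq_norm]
  rw [not_and_or, not_le, not_le] at hcon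
  have h0 := norm_nonneg v
  rcases hcon with h1 | h1
  · rw [deriv_deriv_cutoff_eq_zero_of_lt (by nlinarith)]; simp
  · rw [deriv_deriv_cutoff_eq_zero_of_gt (by nlinarith)]; simp

lemma hasCompactSupport_cauchyKer : HasCompactSupport cauchyKer :=
  HasCompactSupport.of_support_subset_isCompact (isCompact_closedBall 0 1) fun v hv => by
    simpa using (cauchyKer_support hv).2

lemma cauchyKer_I_mul (v : ℂ) : cauchyKer (Complex.I * v) = -Complex.I * cauchyKer v := by
  simp [cauchyKer]
  ring

lemma integral_comp_I_mul (F : ℂ → ℂ) : ∫ v, F (Complex.I * v) = ∫ v, F v := by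
  let c : Circle := ⟨Complex.I, by simp [Submonoid.unitSphere]⟩
  have h := (rotation c).measurePreserving.integral_comp
    (rotation c).toHomeomorph.measurableEmbedding F
  have e : ∀ v, rotation c v = Complex.I * v := fun v => rfl
  simpa only [e] using h

lemma integral_cauchyKer : ∫ v, cauchyKer v = 0 := by
  have h := integral_comp_I_mul cauchyKer
  simp only [cauchyKer_I_mul] at h
  rw [integral_const_mul] at h
  have : (1 + Complex.I) * ∫ v, cauchyKer v = 0 := by linear_combination -h
  refine (mul_eq_zero.mp this).resolve_left fun h => ?_
  simpa using congrArg Complex.re h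

lemma integral_conj_mul_cauchyKer : ∫ v, conj v * cauchyKer v = 0 := by
  have h := integral_comp_I_mul fun v => conj v * cauchyKer v
  have e : ∀ v, conj (Complex.I * v) * cauchyKer (Complex.I * v) =
      -1 * (conj v * cauchyKer v) := fun v => by
    rw [cauchyKer_I_mul, map_mul, Complex.conj_I]
    linear_combination conj v * cauchyKer v * Complex.I_mul_I
  simp only [e] at h
  rw [integral_const_mul] at h
  linear_combination -(1 / 2) * h

lemma integral_id_mul_cauchyKer : ∫ v, v * cauchyKer v = 4 * Real.pi := by
  have e : ∀ v : ℂ, v * cauchyKer v =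
      (((fun r : ℝ => 4 * r ^ 2 * deriv (deriv cutoff) (r ^ 2)) ‖v‖ : ℝ) : ℂ) := fun v => by
    have := Complex.mul_conj v
    rw [← Complex.sq_norm] at this
    simp only [cauchyKer, ← Complex.sq_norm]
    push_cast at *
    linear_combination (4 * ((deriv (deriv cutoff) (‖v‖ ^ 2) : ℝ) : ℂ)) * this
  simp only [e]
  rw [integral_complex_ofReal,
    integral_fun_norm_addHaar volume fun r : ℝ => 4 * r ^ 2 * deriv (deriv cutoff) (r ^ 2)]
  have hI : ∫ y in Set.Ioi (0 : ℝ), y ^ (Module.finrank ℝ ℂ - 1) •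
      (4 * y ^ 2 * deriv (deriv cutoff) (y ^ 2)) = 2 := by
    rw [Complex.finrank_real_complex]
    have hd : ∀ y : ℝ, HasDerivAt
        (fun y : ℝ => 2 * (y ^ 2 * deriv cutoff (y ^ 2) - cutoff (y ^ 2)))
        (y ^ (2 - 1) • (4 * y ^ 2 * deriv (deriv cutoff) (y ^ 2))) y := fun y => by
      have h2 : HasDerivAt (fun y : ℝ => y ^ 2) (2 * y) y := by simpa using hasDerivAt_pow 2 y
      have := ((h2.mul ((hasDerivAt_deriv_cutoff (y ^ 2)).comp y h2)).sub
        ((hasDerivAt_cutoff (y ^ 2)).comp y h2)).const_mul 2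
      refine (this.congr_of_eventuallyEq (Eventually.of_forall fun _ => rfl)).congr_deriv ?_
      simp only [Function.comp_apply, smul_eq_mul]
      ring
    have hcont : Continuous fun y : ℝ =>
        y ^ (2 - 1) • (4 * y ^ 2 * deriv (deriv cutoff) (y ^ 2)) := by
      have h1 : Continuous (deriv (deriv cutoff)) := contDiff_deriv_deriv_cutoff.continuous
      fun_prop
    have hcs : HasCompactSupport fun y : ℝ =>
        y ^ (2 - 1) • (4 * y ^ 2 * deriv (deriv cutoff) (y ^ 2)) := by
      refine HasCompactSupport.of_support_subset_isCompact (isCompact_Icc (a := -1) (b := 1))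
        fun y hy => ?_
      rw [Set.mem_Icc, ← abs_le]
      by_contra hcon
      apply hy
      have : 1 < y ^ 2 := by rw [← sq_abs]; nlinarith [not_le.mp hcon]
      simp [deriv_deriv_cutoff_eq_zero_of_gt this]
    have htend : Tendsto (fun y : ℝ => 2 * (y ^ 2 * deriv cutoff (y ^ 2) - cutoff (y ^ 2)))
        atTop (𝓝 0) := by
      refine tendsto_const_nhds.congr' ?_
      filter_upwards [eventually_gt_atTop 1] with y hy
      have : 1 < y ^ 2 := by nlinarith
      rw [deriv_cutoff_eq_zero_of_gt this, cutoff_eq_zero this.le]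
      simp
    rw [integral_Ioi_of_hasDerivAt_of_tendsto (hd 0).continuousAt.continuousWithinAt
      (fun y _ => hd y) (hcont.integrable_of_hasCompactSupport hcs).integrableOn htend]
    simp [cutoff_eq_one]
  rw [hI, Complex.finrank_real_complex]
  simp [Measure.real]
  ring

lemma lap_comp_affine (H : ℂ → ℂ) (b : ℂ) (s : ℝ) (v : ℂ) :
    lap (fun v => H (b + s • v)) v = s ^ 2 • lap H (b + s • v) := by
  have h1 : ∀ (F : ℂ → ℂ) (v : ℂ), fderiv ℝ (fun v => F (b + s • v)) v =
      s • fderiv ℝ F (b + s • v) := fun F v => by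
    rw [fderiv_comp_smul (f := fun w => F (b + w)) (x := v) (c := s), fderiv_comp_add_left]
  have h2 : ∀ u : ℂ, fderiv ℝ (fun w => fderiv ℝ (fun v => H (b + s • v)) w u) v =
      s • s • fderiv ℝ (fun w => fderiv ℝ H w u) (b + s • v) := fun u => by
    simp only [h1, _root_.smul_apply]
    have := congrFun (fderiv_const_smul_field (𝕜 := ℝ) (f := fun w =>
        (fderiv ℝ H (b + s • w)) u) s) v
    exact this.trans (by rw [Pi.smul_apply, h1 (fun w => fderiv ℝ H w u)])
  simp only [lap, h2, _root_.smul_apply]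
  rw [smul_add, sq, mul_smul, mul_smul]

lemma HarmonicOnC.comp_affine {H : ℂ → ℂ} {V : Set ℂ} (h : HarmonicOnC H V) (b : ℂ) (s : ℝ) :
    HarmonicOnC (fun v => H (b + s • v)) {v | b + s • v ∈ V} := by
  refine ⟨h.1.comp (contDiff_const.add (contDiff_id.const_smul s)).contDiffOn fun v hv => hv,
    fun v hv => ?_⟩
  have := lap_comp_affine H b s v
  rw [show lap H (b + s • v) = 0 from h.2 _ hv, smul_zero] at this
  exact this

lemma HarmonicOnC.congr {f g : ℂ → ℂ} {V : Set ℂ} (h : HarmonicOnC f V) (hV : IsOpen V)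
    (hfg : ∀ z ∈ V, g z = f z) : HarmonicOnC g V := by
  refine ⟨h.1.congr hfg, fun z hz => ?_⟩
  have : g =ᶠ[𝓝 z] f := by
    filter_upwards [hV.mem_nhds hz] with w hw using hfg w hw
  exact (lap_congr this).trans (h.2 z hz)

lemma HarmonicOnC.conj {f : ℂ → ℂ} {V : Set ℂ} (h : HarmonicOnC f V) :
    HarmonicOnC (fun z => conj (f z)) V := by
  refine ⟨Complex.conjCLE.contDiff.comp_contDiffOn h.1, fun z hz => ?_⟩
  have h1 : ∀ (F : ℂ → ℂ) (w u : ℂ), fderiv ℝ (fun z => conj (F z)) w u = conj (fderiv ℝ F w u) :=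
    fun F w u => by
      have := Complex.conjCLE.comp_fderiv (f := F) (x := w)
      exact DFunLike.congr_fun this u
  simp only [h1]
  rw [← map_add, h.2 z hz, map_zero]

lemma mem_Ann_iff {b z : ℂ} {n : ℕ} :
    z ∈ Ann b n ↔ ((2 : ℝ) ^ n)⁻¹ / 2 ≤ ‖z - b‖ ∧ ‖z - b‖ ≤ ((2 : ℝ) ^ n)⁻¹ := by
  rw [Ann, Set.mem_ofPred_eq, Real.rpow_sub two_pos, Real.rpow_neg zero_le_two, Real.rpow_natCast,
    Real.rpow_one]

lemma MhContent_le {h : ℝ → ℝ} {E : Set ℂ} (c : ℕ → ℂ × ℝ) (hc : ∀ n, 0 ≤ (c n).2)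
    (hE : E ⊆ ⋃ n, closedBall (c n).1 (c n).2) :
    MhContent h E ≤ ∑' n, ENNReal.ofReal (h (c n).2) :=
  iInf_le_of_le c (iInf_le_of_le hc (iInf_le_of_le hE le_rfl))

lemma MhContent_mono {h : ℝ → ℝ} {E F : Set ℂ} (hEF : E ⊆ F) : MhContent h E ≤ MhContent h F :=
  le_iInf fun c => le_iInf fun hc => le_iInf fun hF => MhContent_le c hc (hEF.trans hF)

lemma MhContent_comp_mul_le {m : ℝ → ℝ} {E F : Set ℂ} (b : ℂ) {s : ℝ} (hs : 0 < s)
    (hEF : ∀ v ∈ E, b + s • v ∈ F) : MhContent (fun t => m (s * t)) E ≤ MhContent m F := by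
  refine le_iInf fun c => le_iInf fun hc => le_iInf fun hF => ?_
  refine (MhContent_le (fun n => (s⁻¹ • ((c n).1 - b), s⁻¹ * (c n).2))
    (fun n => mul_nonneg (by positivity) (hc n)) fun v hv => ?_).trans (le_of_eq ?_)
  · obtain ⟨n, hn⟩ := Set.mem_iUnion.mp (hF (hEF v hv))
    refine Set.mem_iUnion.mpr ⟨n, ?_⟩
    rw [mem_closedBall, dist_eq_norm] at hn ⊢
    have e : v - s⁻¹ • ((c n).1 - b) = s⁻¹ • (b + s • v - (c n).1) := by
      rw [smul_sub, smul_sub, smul_add, smul_smul, inv_mul_cancel₀ hs.ne', one_smul]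
      ring
    rw [e, norm_smul, Real.norm_of_nonneg (by positivity)]
    exact mul_le_mul_of_nonneg_left hn (by positivity)
  · congr 1
    funext n
    rw [mul_inv_cancel_left₀ hs.ne']

lemma MhContent_union_le (m : ℝ → ℝ) (E F : Set ℂ) :
    MhContent m (E ∪ F) ≤ MhContent m E + MhContent m F := by
  simp only [MhContent, ENNReal.iInf_add, ENNReal.add_iInf]
  refine le_iInf fun c => le_iInf fun hc => le_iInf fun hF => le_iInf fun d => le_iInf fun hd =>
    le_iInf fun hE => ?_
  set e : ℕ → ℂ × ℝ := fun n => if n % 2 = 0 then c (n / 2) else d (n / 2) with he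
  have e0 : ∀ k, e (2 * k) = c k := fun k => by simp [he]
  have e1 : ∀ k, e (2 * k + 1) = d k := fun k => by
    simp only [he]
    rw [if_neg (by omega), show (2 * k + 1) / 2 = k by omega]
  refine (MhContent_le e (fun n => ?_) ?_).trans (le_of_eq ?_)
  · simp only [he]
    split_ifs
    · exact hc _
    · exact hd _
  · rintro z (hz | hz)
    · obtain ⟨n, hn⟩ := Set.mem_iUnion.mp (hE hz)
      exact Set.mem_iUnion.mpr ⟨2 * n + 1, by rwa [e1]⟩
    · obtain ⟨n, hn⟩ := Set.mem_iUnion.mp (hF hz)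
      exact Set.mem_iUnion.mpr ⟨2 * n, by rwa [e0]⟩
  · rw [← tsum_even_add_odd ENNReal.summable ENNReal.summable]
    simp only [e0, e1]
    exact add_comm _ _

lemma MhContent_le_lowerContent {α N : ℝ} {m : ℝ → ℝ} (hN : 0 < N)
    (hmono : MonotoneOn m (Set.Ici 0)) (hm : ∀ t, 0 < t → 0 ≤ m t ∧ m t ≤ N * t ^ α)
    (ht : Tendsto (fun t => m t / t ^ α) (𝓝[>] 0) (𝓝 0)) (E : Set ℂ) :
    MhContent m E ≤ ENNReal.ofReal N * lowerContent α E := by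
  have h1 : MhContent (fun t => m t / N) E ≤ lowerContent α E := by
    refine le_iSup_of_le (fun t => m t / N) (le_iSup_of_le ⟨?_, fun r hr => ⟨?_, ?_⟩, ?_⟩ le_rfl)
    · exact fun s hs t ht hst => div_le_div_of_nonneg_right (hmono hs ht hst) hN.le
    · exact div_nonneg (hm r hr).1 hN.le
    · rw [div_le_iff₀ hN, mul_comm]
      exact (hm r hr).2
    · have := ht.div_const N
      rw [_root_.zero_div] at this
      exact this.congr fun t => by rw [div_right_comm]
  refine le_trans ?_ (mul_le_mul_right h1 _)
  have hN0 : ENNReal.ofReal N ≠ 0 := by simpa using hN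
  rw [mul_comm, ← ENNReal.div_le_iff hN0 ENNReal.ofReal_ne_top]
  refine le_iInf fun c => le_iInf fun hc => le_iInf fun hF => ?_
  rw [ENNReal.div_le_iff hN0 ENNReal.ofReal_ne_top, mul_comm, ← ENNReal.tsum_mul_left]
  refine (MhContent_le c hc hF).trans (le_of_eq (tsum_congr fun n => ?_))
  rw [← ENNReal.ofReal_mul hN.le, mul_div_cancel₀ _ (ne_of_gt hN)]

/-- Area is controlled by the content of the truncated square gauge. -/
lemma volume_le_MhContent {E : Set ℂ} (hE : E ⊆ closedBall 0 1) :
    volume E ≤ ENNReal.ofReal Real.pi * MhContent (fun t => min t 1 ^ 2) E := by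
  have hp : ENNReal.ofReal Real.pi ≠ 0 := by simpa using Real.pi_pos
  have hball : ∀ (a : ℂ) (r : ℝ), 0 ≤ r →
      volume (closedBall a r) = ENNReal.ofReal Real.pi * ENNReal.ofReal (r ^ 2) := fun a r hr => by
    rw [Complex.volume_closedBall, ENNReal.ofReal_pow hr, mul_comm]
    congr 1
    rw [ENNReal.ofReal, NNReal.coe_real_pi.symm, Real.toNNReal_coe]
  rw [mul_comm, ← ENNReal.div_le_iff hp ENNReal.ofReal_ne_top]
  refine le_iInf fun c => le_iInf fun hc => le_iInf fun hF => ?_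
  rw [ENNReal.div_le_iff hp ENNReal.ofReal_ne_top, mul_comm, ← ENNReal.tsum_mul_left]
  calc volume E ≤ volume (⋃ n, closedBall (c n).1 (c n).2 ∩ closedBall 0 1) :=
        measure_mono fun z hz => by
          obtain ⟨n, hn⟩ := Set.mem_iUnion.mp (hF hz)
          exact Set.mem_iUnion.mpr ⟨n, hn, hE hz⟩
    _ ≤ ∑' n, volume (closedBall (c n).1 (c n).2 ∩ closedBall 0 1) := measure_iUnion_le _
    _ ≤ _ := by
        refine ENNReal.tsum_le_tsum fun n => ?_
        beta_reduce
        rcases min_choice (c n).2 1 with h | h <;> rw [h]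
        · exact (measure_mono Set.inter_subset_left).trans (hball _ _ (hc n)).le
        · exact (measure_mono Set.inter_subset_right).trans (hball _ _ zero_le_one).le

lemma integrable_mul_cauchyKer {G : ℂ → ℂ} (hG : Continuous G) :
    Integrable fun v => G v * cauchyKer v :=
  (hG.mul continuous_cauchyKer).integrable_of_hasCompactSupport hasCompactSupport_cauchyKer.mul_left

lemma integral_mul_lap_annTest {G : ℂ → ℂ} (hG : Continuous G) :
    ∫ v, G v * lap annTest v =
      (∫ v, G v * cauchyKer v) - 2 * ∫ v, G ((2⁻¹ : ℝ) • v) * cauchyKer v := by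
  have h2 : ∫ v, G v * cauchyKer ((2 : ℝ) • v) =
      4⁻¹ * ∫ v, G ((2⁻¹ : ℝ) • v) * cauchyKer v := by
    have := Measure.integral_comp_smul (volume : Measure ℂ)
      (fun v => G ((2⁻¹ : ℝ) • v) * cauchyKer v) 2
    simp only [smul_smul] at this
    rw [Complex.finrank_real_complex] at this
    norm_num at this
    simpa using this
  have hi : Integrable fun v : ℂ => G v * cauchyKer ((2 : ℝ) • v) := by
    have := (integrable_mul_cauchyKer (G := fun v => G ((2⁻¹ : ℝ) • v))
      (hG.comp (continuous_const_smul _))).comp_smul (R := (2 : ℝ)) two_ne_zero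
    simpa [smul_smul] using this
  have : ∀ v : ℂ, G v * lap annTest v = G v * cauchyKer v - 8 * (G v * cauchyKer ((2 : ℝ) • v)) :=
    fun v => by rw [lap_annTest]; ring
  simp only [this]
  rw [integral_sub (integrable_mul_cauchyKer hG) (hi.const_mul 8), integral_const_mul, h2]
  ring

/-- The scaled moment of `H` against `cauchyKer` at scale `2⁻ⁿ` about `b`. -/
def dyadicMoment (H : ℂ → ℂ) (b : ℂ) (n : ℕ) : ℂ :=
  2 ^ n * ∫ v, H (b + ((2 : ℝ) ^ n)⁻¹ • v) * cauchyKer v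

lemma exists_dyadicMoment_sub_le : ∃ C : ℝ, 0 < C ∧ ∀ (α N : ℝ) (H : ℂ → ℂ) (m : ℝ → ℝ) (U : Set ℂ)
    (b : ℂ) (n : ℕ), 0 < α → 0 < N → IsOpen U → HarmonicOnC H U → MonotoneOn m (Set.Ici 0) →
    (∀ t, 0 ≤ t → m (2 * t) ≤ 2 * m t) → (∀ t, 0 ≤ t → 0 ≤ m t ∧ m t ≤ 2 * N * t ^ α) →
    Tendsto (fun t => m t / t ^ α) (𝓝[>] 0) (𝓝 0) → (∀ x y, ‖H x - H y‖ ≤ m ‖x - y‖) →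
    ENNReal.ofReal ‖dyadicMoment H b n - dyadicMoment H b (n + 1)‖ ≤
      ENNReal.ofReal (C * N) *
        (2 ^ n * (lowerContent α (Ann b n \ U) + lowerContent α (Ann b (n + 1) \ U))) := by
  obtain ⟨C, hC, hB⟩ := exists_norm_integral_mul_lap_le_content contDiff_annTest
    hasCompactSupport_annTest
  refine ⟨C * 2, by positivity, fun α N H m U b n hα hN hU hH hmono hdoub hm ht hmod => ?_⟩
  have hm0 : m 0 = 0 := by
    have := hm 0 le_rfl
    rw [Real.zero_rpow hα.ne', mul_zero] at this
    exact le_antisymm this.2 this.1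
  have htm := tendsto_of_tendsto_div_rpow hα ht
  have hHc := continuous_of_modulus hm0 htm hmod
  set s : ℝ := ((2 : ℝ) ^ n)⁻¹ with hs
  have hs0 : 0 < s := by positivity
  have hGc : Continuous fun v : ℂ => H (b + s • v) :=
    hHc.comp (continuous_const.add (continuous_const_smul _))
  have e1 : dyadicMoment H b n - dyadicMoment H b (n + 1) =
      2 ^ n * ∫ v, H (b + s • v) * lap annTest v := by
    rw [integral_mul_lap_annTest hGc, dyadicMoment, dyadicMoment]
    have : ∀ v : ℂ, s • (2⁻¹ : ℝ) • v = ((2 : ℝ) ^ (n + 1))⁻¹ • v := fun v => by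
      rw [smul_smul, hs, pow_succ, mul_inv]
    simp only [this]
    rw [pow_succ]
    ring
  have key := hB (fun v => H (b + s • v)) (fun t => m (s * t)) {v | b + s • v ∈ U} hGc
    (hU.preimage (continuous_const.add (continuous_const_smul _))) (hH.comp_affine b s)
    (fun x hx y hy hxy => hmono (mul_nonneg hs0.le hx) (mul_nonneg hs0.le hy)
      (mul_le_mul_of_nonneg_left hxy hs0.le))
    (fun t ht => by
      have := hdoub (s * t) (by positivity)
      rwa [mul_left_comm] at this)
    (htm.comp (by
      refine tendsto_nhdsWithin_iff.mpr ⟨?_, ?_⟩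
      · have : Tendsto (fun t : ℝ => s * t) (𝓝 0) (𝓝 (s * 0)) := tendsto_id.const_mul s
        rw [mul_zero] at this
        exact this.mono_left nhdsWithin_le_nhds
      · filter_upwards [self_mem_nhdsWithin] with t ht using mul_pos hs0 ht))
    (fun x y => by
      refine (hmod _ _).trans (le_of_eq ?_)
      rw [add_sub_add_left_eq_sub, ← smul_sub, norm_smul, Real.norm_of_nonneg hs0.le])
  have hcov : MhContent (fun t => m (s * t)) (tsupport annTest \ {v | b + s • v ∈ U}) ≤
      MhContent m ((Ann b n \ U) ∪ (Ann b (n + 1) \ U)) := by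
    refine MhContent_comp_mul_le b hs0 fun v hv => ?_
    have h1 := tsupport_annTest_subset hv.1
    rw [Set.mem_ofPred_eq] at h1
    have h2 : b + s • v ∉ U := hv.2
    have e : ‖b + s • v - b‖ = s * ‖v‖ := by
      rw [add_sub_cancel_left, norm_smul, Real.norm_of_nonneg hs0.le]
    rcases le_total (1 / 2) ‖v‖ with h | h
    · refine Or.inl ⟨mem_Ann_iff.mpr ?_, h2⟩
      rw [e]
      constructor <;> nlinarith
    · refine Or.inr ⟨mem_Ann_iff.mpr ?_, h2⟩
      rw [e, pow_succ, mul_inv, ← hs]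
      constructor <;> nlinarith
  have hlc : ∀ E : Set ℂ, MhContent m E ≤ ENNReal.ofReal (2 * N) * lowerContent α E :=
    MhContent_le_lowerContent (by positivity) hmono (fun t ht => hm t ht.le) ht
  rw [e1, norm_mul, ENNReal.ofReal_mul (norm_nonneg _), norm_pow, Complex.norm_ofNat,
    ENNReal.ofReal_pow zero_le_two, ENNReal.ofReal_ofNat]
  calc _ ≤ 2 ^ n * (ENNReal.ofReal C * (ENNReal.ofReal (2 * N) * lowerContent α (Ann b n \ U) +
        ENNReal.ofReal (2 * N) * lowerContent α (Ann b (n + 1) \ U))) := by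
        gcongr
        refine key.trans ?_
        gcongr
        exact hcov.trans ((MhContent_union_le _ _ _).trans (add_le_add (hlc _) (hlc _)))
    _ = _ := by
        rw [mul_assoc C, ENNReal.ofReal_mul hC.le]
        ring

lemma exists_dyadicMoment_le : ∃ C : ℝ, 0 < C ∧ ∀ (α N : ℝ) (H : ℂ → ℂ) (m : ℝ → ℝ) (U : Set ℂ)
    (b : ℂ) (n : ℕ), 0 < α → α < 1 → 0 < N → IsOpen U → HarmonicOnC H U →
    MonotoneOn m (Set.Ici 0) →
    (∀ t, 0 ≤ t → m (2 * t) ≤ 2 * m t) → (∀ t, 0 ≤ t → 0 ≤ m t ∧ m t ≤ 2 * N * t ^ α) →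
    Tendsto (fun t => m t / t ^ α) (𝓝[>] 0) (𝓝 0) → (∀ x y, ‖H x - H y‖ ≤ m ‖x - y‖) →
    ENNReal.ofReal ‖dyadicMoment H b (n + 1)‖ ≤ ENNReal.ofReal (C * N) *
      (1 + 2 * ∑' k : ℕ, (2 : ℝ≥0∞) ^ (k + 1) * lowerContent α (Ann b (k + 1) \ U)) := by
  obtain ⟨C, hC, hstep⟩ := exists_dyadicMoment_sub_le
  set I : ℝ := ∫ v, ‖cauchyKer v‖ with hI
  have hI0 : 0 ≤ I := integral_nonneg fun _ => norm_nonneg _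
  refine ⟨C + 4 * I, by positivity,
    fun α N H m U b n hα hα1 hN hU hH hmono hdoub hm ht hmod => ?_⟩
  set S := ∑' k : ℕ, (2 : ℝ≥0∞) ^ (k + 1) * lowerContent α (Ann b (k + 1) \ U) with hS
  have hm0 : m 0 = 0 := by
    have := hm 0 le_rfl
    rw [Real.zero_rpow hα.ne', mul_zero] at this
    exact le_antisymm this.2 this.1
  have hHc := continuous_of_modulus hm0 (tendsto_of_tendsto_div_rpow hα ht) hmod
  have hKi : Integrable cauchyKer :=
    continuous_cauchyKer.integrable_of_hasCompactSupport hasCompactSupport_cauchyKer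
  have h1 : ‖dyadicMoment H b 1‖ ≤ 4 * I * N := by
    have hGc : Continuous fun v : ℂ => H (b + ((2 : ℝ) ^ 1)⁻¹ • v) :=
      hHc.comp (continuous_const.add (continuous_const_smul _))
    have e : ∫ v, H (b + ((2 : ℝ) ^ 1)⁻¹ • v) * cauchyKer v =
        ∫ v, (H (b + ((2 : ℝ) ^ 1)⁻¹ • v) - H b) * cauchyKer v := by
      simp only [sub_mul]
      rw [integral_sub (integrable_mul_cauchyKer hGc) (hKi.const_mul _), integral_const_mul,
        integral_cauchyKer, mul_zero, sub_zero]
    have hb : ‖∫ v, (H (b + ((2 : ℝ) ^ 1)⁻¹ • v) - H b) * cauchyKer v‖ ≤ 2 * N * I := by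
      rw [hI, ← integral_const_mul]
      refine norm_integral_le_of_norm_le (hKi.norm.const_mul _) (ae_of_all _ fun v => ?_)
      rw [norm_mul]
      by_cases hv : cauchyKer v = 0
      · simp [hv]
      refine mul_le_mul_of_nonneg_right ?_ (norm_nonneg _)
      refine (hmod _ _).trans ((hm _ (norm_nonneg _)).2.trans ?_)
      have : ‖b + ((2 : ℝ) ^ 1)⁻¹ • v - b‖ ≤ 1 := by
        rw [add_sub_cancel_left, norm_smul]
        have := (cauchyKer_support hv).2
        norm_num
        linarith
      have := Real.rpow_le_one (norm_nonneg _) this hα.le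
      nlinarith
    rw [dyadicMoment, e, norm_mul]
    norm_num at hb ⊢
    linarith
  have htel : ∀ n, ENNReal.ofReal ‖dyadicMoment H b (n + 1)‖ ≤ ENNReal.ofReal (4 * I * N) +
      ENNReal.ofReal (C * N) * ∑ k ∈ Finset.range n,
        ((2 : ℝ≥0∞) ^ (k + 1) * lowerContent α (Ann b (k + 1) \ U) +
          (2 : ℝ≥0∞) ^ (k + 1 + 1) * lowerContent α (Ann b (k + 1 + 1) \ U)) := fun n => by
    induction n with
    | zero => simpa using ENNReal.ofReal_le_ofReal h1
    | succ n ih =>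
      rw [Finset.sum_range_succ, mul_add, ← add_assoc]
      have h2 := hstep α N H m U b (n + 1) hα hN hU hH hmono hdoub hm ht hmod
      have h3 : ‖dyadicMoment H b (n + 1 + 1)‖ ≤ ‖dyadicMoment H b (n + 1)‖ +
          ‖dyadicMoment H b (n + 1) - dyadicMoment H b (n + 1 + 1)‖ := by
        rw [norm_sub_rev]
        exact norm_le_norm_add_norm_sub' _ _
      refine (ENNReal.ofReal_le_ofReal h3).trans ?_
      rw [ENNReal.ofReal_add (norm_nonneg _) (norm_nonneg _)]
      refine add_le_add ih (h2.trans ?_)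
      gcongr
      rw [mul_add]
      gcongr
      · norm_num
      · omega
  have hsum : ∑ k ∈ Finset.range n,
        ((2 : ℝ≥0∞) ^ (k + 1) * lowerContent α (Ann b (k + 1) \ U) +
          (2 : ℝ≥0∞) ^ (k + 1 + 1) * lowerContent α (Ann b (k + 1 + 1) \ U)) ≤ 2 * S := by
    rw [Finset.sum_add_distrib, two_mul]
    refine add_le_add (ENNReal.sum_le_tsum _) ((ENNReal.sum_le_tsum _).trans ?_)
    exact ENNReal.tsum_comp_le_tsum_of_injective (add_left_injective 1)
      (fun k : ℕ => (2 : ℝ≥0∞) ^ (k + 1) * lowerContent α (Ann b (k + 1) \ U))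
  calc _ ≤ ENNReal.ofReal (4 * I * N) * 1 + ENNReal.ofReal (C * N) * (2 * S) := by
        rw [mul_one]
        exact (htel n).trans (by gcongr)
    _ ≤ ENNReal.ofReal ((C + 4 * I) * N) * 1 + ENNReal.ofReal ((C + 4 * I) * N) * (2 * S) := by
        gcongr <;> nlinarith
    _ = _ := by rw [mul_add]

lemma volume_le_lowerContent {α s : ℝ} (hα0 : 0 < α) (hα1 : α < 1) (hs : 0 < s) {b : ℂ}
    {E F : Set ℂ} (hE : E ⊆ closedBall 0 1) (hEF : ∀ v ∈ E, b + s • v ∈ F) :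
    ENNReal.ofReal (s ^ α) * volume E ≤ ENNReal.ofReal Real.pi * lowerContent α F := by
  have hsα : 0 < s ^ α := Real.rpow_pos_of_pos hs α
  have h1 : MhContent (fun t => min t 1 ^ 2) E ≤ MhContent (fun t => min (s⁻¹ * t) 1 ^ 2) F := by
    refine le_trans (le_of_eq ?_) (MhContent_comp_mul_le b hs hEF)
    congr 1
    funext t
    rw [inv_mul_cancel_left₀ hs.ne']
  have hle : ∀ x : ℝ, 0 < x → min x 1 ^ 2 ≤ x ^ α := fun x hx => by
    rcases le_total x 1 with h | h
    · rw [min_eq_left h, ← Real.rpow_natCast]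
      exact Real.rpow_le_rpow_of_exponent_ge hx h (by norm_num; linarith)
    · rw [min_eq_right h, one_pow]
      exact Real.one_le_rpow h hα0.le
  have h2 := MhContent_le_lowerContent (α := α) (N := (s ^ α)⁻¹)
    (m := fun t => min (s⁻¹ * t) 1 ^ 2) (by positivity)
    (fun x hx y hy hxy => by
      have h0 : 0 ≤ min (s⁻¹ * x) 1 := le_min (mul_nonneg (by positivity) hx) zero_le_one
      exact pow_le_pow_left₀ h0
        (min_le_min_right _ (mul_le_mul_of_nonneg_left hxy (by positivity))) 2)
    (fun t ht => ⟨by positivity, by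
      refine (hle _ (by positivity)).trans (le_of_eq ?_)
      rw [Real.mul_rpow (by positivity) ht.le, Real.inv_rpow hs.le]⟩)
    (by
      have h0 : Tendsto (fun t : ℝ => (s⁻¹) ^ 2 * t ^ (2 - α)) (𝓝[>] 0) (𝓝 0) := by
        have : ContinuousAt (fun t : ℝ => (s⁻¹) ^ 2 * t ^ (2 - α)) 0 :=
          continuousAt_const.mul (Real.continuousAt_rpow_const _ _ (Or.inr (by linarith)))
        have h := this.tendsto
        rw [Real.zero_rpow (by linarith), mul_zero] at h
        exact h.mono_left nhdsWithin_le_nhds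
      refine squeeze_zero' ?_ ?_ h0
      · filter_upwards [self_mem_nhdsWithin] with t ht
        have ht : (0 : ℝ) < t := ht
        positivity
      · filter_upwards [self_mem_nhdsWithin] with t ht
        have ht : (0 : ℝ) < t := ht
        rw [Real.rpow_sub ht, Real.rpow_ofNat, ← mul_div_assoc, ← mul_pow]
        gcongr
        exact min_le_left _ _) F
  calc ENNReal.ofReal (s ^ α) * volume E
      ≤ ENNReal.ofReal (s ^ α) * (ENNReal.ofReal Real.pi *
        (ENNReal.ofReal (s ^ α)⁻¹ * lowerContent α F)) := by
        gcongr
        exact (volume_le_MhContent hE).trans (by gcongr; exact h1.trans h2)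
    _ = (ENNReal.ofReal (s ^ α) * ENNReal.ofReal (s ^ α)⁻¹) *
        (ENNReal.ofReal Real.pi * lowerContent α F) := by ring
    _ = _ := by
        rw [← ENNReal.ofReal_mul hsα.le, mul_inv_cancel₀ hsα.ne', ENNReal.ofReal_one, one_mul]

lemma integral_clm_mul_cauchyKer (L : ℂ →L[ℝ] ℂ) :
    ∫ v, L v * cauchyKer v = 2 * Real.pi * (L 1 - Complex.I * L Complex.I) := by
  have e : ∀ v : ℂ, L v * cauchyKer v = ((L 1 - Complex.I * L Complex.I) / 2) * (v * cauchyKer v) +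
      ((L 1 + Complex.I * L Complex.I) / 2) * (conj v * cauchyKer v) := fun v => by
    have h1 : L v = v.re * L 1 + v.im * L Complex.I := by
      conv_lhs => rw [show v = v.re • (1 : ℂ) + v.im • Complex.I by
        simp [Complex.re_add_im]]
      rw [map_add, map_smul, map_smul, Complex.real_smul, Complex.real_smul]
    have h2 : (v.re : ℂ) = (v + conj v) / 2 := Complex.re_eq_add_conj v
    have h3 : (v.im : ℂ) = -Complex.I * (v - conj v) / 2 := by
      rw [Complex.im_eq_sub_conj, div_eq_div_iff (by simp) two_ne_zero]
      ring_nf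
      rw [Complex.I_sq]
      ring
    rw [h1, h2, h3]
    ring
  simp only [e]
  rw [integral_add, integral_const_mul, integral_const_mul, integral_conj_mul_cauchyKer,
    integral_id_mul_cauchyKer]
  · ring
  · exact (integrable_mul_cauchyKer continuous_id).const_mul _
  · exact (integrable_mul_cauchyKer Complex.continuous_conj).const_mul _

lemma tendsto_dyadicMoment {α N : ℝ} {H h : ℂ → ℂ} {U : Set ℂ} {b : ℂ} {L : ℂ →L[ℝ] ℂ}
    (hα0 : 0 < α) (hα1 : α < 1) (hU : IsOpen U) (hHc : Continuous H)
    (hmod : ∀ x y, ‖H x - H y‖ ≤ N * ‖x - y‖ ^ α) (hd : HasFDerivAt h L b)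
    (hHh : ∀ z ∈ U, H z = h z) (hb : H b = h b)
    (hlc : Tendsto (fun n : ℕ => (2 : ℝ≥0∞) ^ n * lowerContent α (Ann b n \ U)) atTop (𝓝 0)) :
    Tendsto (dyadicMoment H b) atTop (𝓝 (2 * Real.pi * (L 1 - Complex.I * L Complex.I))) := by
  set I : ℝ := ∫ v, ‖cauchyKer v‖ with hI
  have hI0 : 0 ≤ I := integral_nonneg fun _ => norm_nonneg _
  have hKi : Integrable cauchyKer :=
    continuous_cauchyKer.integrable_of_hasCompactSupport hasCompactSupport_cauchyKer
  obtain ⟨B, hB⟩ := hasCompactSupport_cauchyKer.exists_bound_of_continuous continuous_cauchyKer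
  have hB0 : 0 ≤ B := (norm_nonneg _).trans (hB 0)
  have hN : 0 ≤ N := by
    have := (norm_nonneg _).trans (hmod 1 0)
    simpa using this
  set M : ℝ := (N + ‖L‖) * B with hM
  have hM0 : 0 ≤ M := by positivity
  set E : ℕ → Set ℂ := fun n => {v | 1 / 2 ≤ ‖v‖ ∧ ‖v‖ ≤ 1 ∧ b + ((2 : ℝ) ^ n)⁻¹ • v ∉ U} with hE
  have hEm : ∀ n, MeasurableSet (E n) := fun n => by
    have hc : Continuous fun v : ℂ => b + ((2 : ℝ) ^ n)⁻¹ • v :=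
      continuous_const.add (continuous_const_smul _)
    exact ((measurableSet_le measurable_const measurable_norm).inter
      ((measurableSet_le measurable_norm measurable_const).inter
        (hU.preimage hc).measurableSet.compl))
  have hE1 : ∀ n, E n ⊆ closedBall 0 1 := fun n v hv => by
    rw [mem_closedBall_zero_iff]
    exact hv.2.1
  set a : ℕ → ℝ := fun n => (2 ^ n * lowerContent α (Ann b n \ U)).toReal with ha
  have hvol : ∀ᶠ n in atTop, (2 : ℝ) ^ n * (((2 : ℝ) ^ n)⁻¹ ^ α * volume.real (E n)) ≤
      Real.pi * a n := by
    have : ∀ᶠ n in atTop, (2 : ℝ≥0∞) ^ n * lowerContent α (Ann b n \ U) < 1 :=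
      hlc.eventually_lt_const zero_lt_one
    filter_upwards [this] with n hn
    have h1 := volume_le_lowerContent (α := α) (s := ((2 : ℝ) ^ n)⁻¹) hα0 hα1 (by positivity)
      (b := b) (hE1 n) (F := Ann b n \ U) fun v hv => ⟨mem_Ann_iff.mpr (by
        rw [add_sub_cancel_left, norm_smul, Real.norm_of_nonneg (by positivity)]
        have h0 : 0 < ((2 : ℝ) ^ n)⁻¹ := by positivity
        have h1 := hv.1
        have h2 := hv.2.1
        constructor <;> nlinarith), hv.2.2⟩
    have h2 : (2 : ℝ≥0∞) ^ n * (ENNReal.ofReal (((2 : ℝ) ^ n)⁻¹ ^ α) * volume (E n)) ≤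
        ENNReal.ofReal Real.pi * (2 ^ n * lowerContent α (Ann b n \ U)) := by
      rw [mul_left_comm (ENNReal.ofReal Real.pi)]
      gcongr
    have h3 := ENNReal.toReal_mono
      (ENNReal.mul_ne_top ENNReal.ofReal_ne_top (hn.trans one_lt_top).ne) h2
    rw [ENNReal.toReal_mul, ENNReal.toReal_mul, ENNReal.toReal_mul (a := ENNReal.ofReal Real.pi),
      ENNReal.toReal_ofReal Real.pi_pos.le,
      ENNReal.toReal_ofReal (by positivity), ENNReal.toReal_pow, ENNReal.toReal_ofNat] at h3
    exact h3
  have ha0 : Tendsto a atTop (𝓝 0) := by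
    have := (ENNReal.tendsto_toReal zero_ne_top).comp hlc
    rw [ENNReal.toReal_zero] at this
    exact this
  have hs0 : Tendsto (fun n : ℕ => ((2 : ℝ) ^ n)⁻¹) atTop (𝓝 0) := by
    simpa [inv_pow] using tendsto_pow_atTop_nhds_zero_of_lt_one (r := (2⁻¹ : ℝ)) (by norm_num)
      (by norm_num)
  have hfin : ∀ ε : ℝ, 0 < ε → ∀ᶠ n in atTop,
      ‖dyadicMoment H b n - 2 * Real.pi * (L 1 - Complex.I * L Complex.I)‖ ≤
        ε * I + M * (Real.pi * a n) := fun ε hε => by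
    have hT := hd.isLittleO.def hε
    rw [Metric.eventually_nhds_iff] at hT
    obtain ⟨δ, hδ, hT⟩ := hT
    filter_upwards [hvol, hs0.eventually_lt_const hδ] with n hn hsδ
    set s : ℝ := ((2 : ℝ) ^ n)⁻¹ with hs
    have hsp : 0 < s := by positivity
    have hs1 : s ≤ 1 := inv_le_one_of_one_le₀ (one_le_pow₀ one_le_two)
    have h2s : (2 : ℝ) ^ n * s = 1 := mul_inv_cancel₀ (by positivity)
    have hGc : Continuous fun v : ℂ => H (b + s • v) :=
      hHc.comp (continuous_const.add (continuous_const_smul _))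
    have e : dyadicMoment H b n - 2 * Real.pi * (L 1 - Complex.I * L Complex.I) =
        2 ^ n * ∫ v, (H (b + s • v) - h b - L (s • v)) * cauchyKer v := by
      have h1 : ∫ v, L (s • v) * cauchyKer v =
          s * (2 * Real.pi * (L 1 - Complex.I * L Complex.I)) := by
        rw [← integral_clm_mul_cauchyKer, ← integral_const_mul]
        refine integral_congr_ae (ae_of_all _ fun v => ?_)
        beta_reduce
        rw [L.map_smul, Complex.real_smul]
        ring
      simp only [sub_mul]
      rw [integral_sub, integral_sub, integral_const_mul, integral_cauchyKer, h1, mul_zero,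
        sub_zero, mul_sub (2 ^ n), ← mul_assoc (2 ^ n) (s : ℂ), dyadicMoment]
      · have : (2 : ℂ) ^ n * (s : ℂ) = 1 := by exact_mod_cast h2s
        rw [this, one_mul]
      · exact integrable_mul_cauchyKer hGc
      · exact hKi.const_mul _
      · exact (integrable_mul_cauchyKer hGc).sub (hKi.const_mul _)
      · exact integrable_mul_cauchyKer (L.continuous.comp (continuous_const_smul s))
    have hEfin : volume (E n) ≠ ⊤ :=
      ((measure_mono (hE1 n)).trans_lt measure_closedBall_lt_top).ne
    have hpt : ∀ v : ℂ, ‖(H (b + s • v) - h b - L (s • v)) * cauchyKer v‖ ≤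
        ε * s * ‖cauchyKer v‖ + (E n).indicator (fun _ => M * s ^ α) v := fun v => by
      have hi0 : 0 ≤ (E n).indicator (fun _ => M * s ^ α) v :=
        Set.indicator_nonneg (fun _ _ => by positivity) _
      by_cases hv : cauchyKer v = 0
      · simpa [hv] using hi0
      obtain ⟨hv1, hv2⟩ := cauchyKer_support hv
      rw [norm_mul]
      by_cases hvU : b + s • v ∈ U
      · refine le_trans ?_ (le_add_of_nonneg_right hi0)
        refine mul_le_mul_of_nonneg_right ?_ (norm_nonneg _)
        have hsv : ‖s • v‖ ≤ s := by
          rw [norm_smul, Real.norm_of_nonneg hsp.le]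
          nlinarith
        have := hT (y := b + s • v) (by
          rw [dist_eq_norm, add_sub_cancel_left]
          exact hsv.trans_lt hsδ)
        rw [add_sub_cancel_left] at this
        rw [hHh _ hvU]
        exact this.trans (mul_le_mul_of_nonneg_left hsv hε.le)
      · have hmem : v ∈ E n := ⟨hv1, hv2, hvU⟩
        rw [Set.indicator_of_mem hmem]
        refine le_trans ?_ (le_add_of_nonneg_left (by positivity))
        rw [hM]
        have hsα : s ≤ s ^ α := by
          conv_lhs => rw [← Real.rpow_one s]
          exact Real.rpow_le_rpow_of_exponent_ge hsp hs1 hα1.le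
        have h1 : ‖H (b + s • v) - h b‖ ≤ N * s ^ α := by
          rw [← hb]
          refine (hmod _ _).trans (mul_le_mul_of_nonneg_left ?_ hN)
          refine Real.rpow_le_rpow (norm_nonneg _) ?_ hα0.le
          rw [add_sub_cancel_left, norm_smul, Real.norm_of_nonneg hsp.le]
          nlinarith
        have h2 : ‖L (s • v)‖ ≤ ‖L‖ * s ^ α := by
          refine (L.le_opNorm _).trans (mul_le_mul_of_nonneg_left ?_ (norm_nonneg _))
          rw [norm_smul, Real.norm_of_nonneg hsp.le]
          nlinarith
        have h3 : ‖H (b + s • v) - h b - L (s • v)‖ ≤ (N + ‖L‖) * s ^ α := by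
          refine (norm_sub_le _ _).trans ?_
          linarith
        calc _ ≤ (N + ‖L‖) * s ^ α * B :=
              mul_le_mul h3 (hB v) (norm_nonneg _) (by positivity)
          _ = _ := by ring
    have hint : ‖∫ v, (H (b + s • v) - h b - L (s • v)) * cauchyKer v‖ ≤
        ε * s * I + volume.real (E n) * (M * s ^ α) := by
      refine (norm_integral_le_of_norm_le (((hKi.norm.const_mul (ε * s))).add
        ((integrable_indicator_iff (hEm n)).mpr (integrableOn_const hEfin))) (ae_of_all _
            hpt)).trans
        (le_of_eq ?_)
      rw [integral_add' (hKi.norm.const_mul (ε * s))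
        ((integrable_indicator_iff (hEm n)).mpr (integrableOn_const hEfin)),
        integral_const_mul, integral_indicator (hEm n), setIntegral_const, smul_eq_mul]
    rw [e, norm_mul, norm_pow, Complex.norm_ofNat]
    calc _ ≤ (2 : ℝ) ^ n * (ε * s * I + volume.real (E n) * (M * s ^ α)) := by gcongr
      _ = ε * I * (2 ^ n * s) + M * (2 ^ n * (s ^ α * volume.real (E n))) := by ring
      _ ≤ _ := by
        rw [h2s, mul_one]
        gcongr
  rw [Metric.tendsto_atTop']
  intro ε hε
  have h1 := hfin (ε / (2 * (I + 1))) (by positivity)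
  have h2 : ∀ᶠ n in atTop, M * (Real.pi * a n) < ε / 2 := by
    have := (ha0.const_mul Real.pi).const_mul M
    rw [mul_zero, mul_zero] at this
    exact this.eventually_lt_const (by positivity)
  obtain ⟨n0, hn0⟩ := eventually_atTop.mp (h1.and h2)
  refine ⟨n0, fun n hn => ?_⟩
  obtain ⟨h3, h4⟩ := hn0 n hn.le
  rw [dist_eq_norm]
  have : ε / (2 * (I + 1)) * I ≤ ε / 2 := by
    rw [div_mul_eq_mul_div, div_le_div_iff₀ (by positivity) two_pos]
    nlinarith
  linarith

lemma HolderOfOrderOn.le_sSup {α : ℝ} {E : Set ℂ} {f : ℂ → ℂ} (hf : HolderOfOrderOn α E f)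
    (hα : 0 < α) {x y : ℂ} (hx : x ∈ E) (hy : y ∈ E) : ‖f x - f y‖ ≤
      sSup {q | ∃ x ∈ E, ∃ y ∈ E, x ≠ y ∧ q = ‖f x - f y‖ / ‖x - y‖ ^ α} * ‖x - y‖ ^ α := by
  obtain ⟨C, hC⟩ := hf
  rcases eq_or_ne x y with rfl | hxy
  · simp [Real.zero_rpow hα.ne']
  have hp : ∀ {x y : ℂ}, x ≠ y → 0 < ‖x - y‖ ^ α := fun h =>
    Real.rpow_pos_of_pos (norm_pos_iff.mpr (sub_ne_zero.mpr h)) α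
  rw [← div_le_iff₀ (hp hxy)]
  refine le_csSup ⟨C, ?_⟩ ⟨x, hx, y, hy, hxy, rfl⟩
  rintro q ⟨u, hu, v, hv, huv, rfl⟩
  rw [div_le_iff₀ (hp huv)]
  exact hC u hu v hv

lemma LittleHolderOn.conj {α : ℝ} {E : Set ℂ} {f : ℂ → ℂ} (hf : LittleHolderOn α E f) :
    LittleHolderOn α E (fun z => conj (f z)) := by
  have e : ∀ x y : ℂ, ‖conj (f x) - conj (f y)‖ = ‖f x - f y‖ := fun x y => by
    rw [← map_sub, RCLike.norm_conj]
  simpa only [LittleHolderOn, HolderOfOrderOn, e] using hf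

/-- The bound on one complex derivative in terms of the Hölder constant, with a constant depending
only on the sum of the contents. -/
lemma exists_norm_fderiv_sub_le : ∃ C : ℝ, 0 < C ∧ ∀ (α N r : ℝ) (f h : ℂ → ℂ) (U : Set ℂ)
    (b : ℂ), 0 < α → α < 1 → 0 < N → 0 < r → IsOpen U → b ∈ closure U → MemHalpha α U f →
    HarmonicOnC h (U ∪ ball b r) → (∀ z ∈ closure U, h z = f z) →
    (∀ x ∈ closure U, ∀ y ∈ closure U, ‖f x - f y‖ ≤ N * ‖x - y‖ ^ α) →
    ∑' n : ℕ, (2 : ℝ≥0∞) ^ (n + 1) * lowerContent α (Ann b (n + 1) \ U) < ⊤ →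
    ENNReal.ofReal ‖fderiv ℝ h b 1 - Complex.I * fderiv ℝ h b Complex.I‖ ≤
      ENNReal.ofReal (C * N) *
        (1 + 2 * ∑' n : ℕ, (2 : ℝ≥0∞) ^ (n + 1) * lowerContent α (Ann b (n + 1) \ U)) := by
  obtain ⟨C, hC, hmain⟩ := exists_dyadicMoment_le
  refine ⟨C, hC, fun α N r f h U b hα0 hα1 hN hr hU hb hf hh hhf hfN hS => ?_⟩
  obtain ⟨H, m, hHf, hmono, hdoub, hm, ht, hmod⟩ :=
    exists_extension_modulus hα0 hα1 hN.le ⟨b, hb⟩ hfN hf.2.forall_exists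
  have hm0 : m 0 = 0 := by
    have := hm 0 le_rfl
    rw [Real.zero_rpow hα0.ne', mul_zero] at this
    exact le_antisymm this.2 this.1
  have hHc := continuous_of_modulus hm0 (tendsto_of_tendsto_div_rpow hα0 ht) hmod
  have hHU : HarmonicOnC H U := hf.1.congr hU fun z hz => hHf z (subset_closure hz)
  have hd : HasFDerivAt h (fderiv ℝ h b) b := by
    have hopen : IsOpen (U ∪ ball b r) := hU.union isOpen_ball
    have := hh.1.contDiffAt (hopen.mem_nhds (Or.inr (mem_ball_self hr)))
    exact (this.differentiableAt two_ne_zero).hasFDerivAt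
  have hlc : Tendsto (fun n : ℕ => (2 : ℝ≥0∞) ^ n * lowerContent α (Ann b n \ U)) atTop (𝓝 0) :=
    (tendsto_add_atTop_iff_nat 1).mp (ENNReal.tendsto_atTop_zero_of_tsum_ne_top hS.ne)
  have hlim := tendsto_dyadicMoment (N := 2 * N) hα0 hα1 hU hHc
    (fun x y => (hmod x y).trans (hm _ (norm_nonneg _)).2) hd
    (fun z hz => (hHf z (subset_closure hz)).trans (hhf z (subset_closure hz)).symm)
    ((hHf b hb).trans (hhf b hb).symm) hlc
  have hlim' := ((ENNReal.continuous_ofReal.comp continuous_norm).tendsto _).comp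
    ((tendsto_add_atTop_iff_nat 1).mpr hlim)
  refine le_trans ?_ (le_of_tendsto' hlim' fun n =>
    hmain α N H m U b n hα0 hα1 hN hU hHU hmono hdoub hm ht hmod)
  refine ENNReal.ofReal_le_ofReal ?_
  beta_reduce
  rw [norm_mul (2 * (Real.pi : ℂ))]
  refine le_mul_of_one_le_left (norm_nonneg _) ?_
  rw [norm_mul, Complex.norm_ofNat, Complex.norm_real, Real.norm_of_nonneg Real.pi_pos.le]
  linarith [Real.pi_gt_three]

theorem exists_gradPair_le_of_tsum_lt_top {α : ℝ} (hα0 : 0 < α) (hα1 : α < 1) {U : Set ℂ}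
    (hU : IsOpen U) {b : ℂ} (hb : b ∈ closure U)
    (hS : ∑' n : ℕ, (2 : ℝ≥0∞) ^ (n + 1) * lowerContent α (Ann b (n + 1) \ U) < ⊤) :
    ∃ κ : ℝ, 0 < κ ∧ ∀ f h : ℂ → ℂ, ∀ r : ℝ, 0 < r → MemHalpha α U f →
      HarmonicOnC h (U ∪ ball b r) → (∀ z ∈ closure U, h z = f z) →
      ‖gradPair h b‖ ≤ κ * HNorm α U f := by
  obtain ⟨C, hC, hmain⟩ := exists_norm_fderiv_sub_le
  set S := ∑' n : ℕ, (2 : ℝ≥0∞) ^ (n + 1) * lowerContent α (Ann b (n + 1) \ U) with hSdef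
  have hST : 1 + 2 * S ≠ ⊤ :=
    ENNReal.add_ne_top.mpr ⟨one_ne_top, ENNReal.mul_ne_top ofNat_ne_top hS.ne⟩
  set T : ℝ := (1 + 2 * S).toReal with hT
  have hT0 : 0 ≤ T := toReal_nonneg
  refine ⟨C * (T + 1), by positivity, fun f h r hr hf hh hhf => ?_⟩
  set σ := sSup {q | ∃ x ∈ closure U, ∃ y ∈ closure U, x ≠ y ∧ q = ‖f x - f y‖ / ‖x - y‖ ^ α}
    with hσ
  have hσ0 : 0 ≤ σ := Real.sSup_nonneg (by
    rintro q ⟨x, -, y, -, -, rfl⟩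
    positivity)
  have hle : ∀ N : ℝ, σ < N → ‖gradPair h b‖ ≤ C * T * N := fun N hN => by
    have hN0 : 0 < N := hσ0.trans_lt hN
    have hfN : ∀ x ∈ closure U, ∀ y ∈ closure U, ‖f x - f y‖ ≤ N * ‖x - y‖ ^ α :=
      fun x hx y hy => (hf.2.1.le_sSup hα0 hx hy).trans
        (mul_le_mul_of_nonneg_right hN.le (by positivity))
    have toR : ∀ x : ℝ, ENNReal.ofReal x ≤ ENNReal.ofReal (C * N) * (1 + 2 * S) →
        x ≤ C * T * N := fun x hx => by
      rw [← ENNReal.ofReal_toReal hST, ← ENNReal.ofReal_mul (by positivity),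
        ENNReal.ofReal_le_ofReal_iff (by positivity)] at hx
      linarith
    have h1 := toR _ (hmain α N r f h U b hα0 hα1 hN0 hr hU hb hf hh hhf hfN hS)
    have h2 := toR _ (hmain α N r (fun z => conj (f z)) (fun z => conj (h z)) U b hα0 hα1 hN0 hr
      hU hb ⟨hf.1.conj, hf.2.conj⟩ hh.conj (fun z hz => by rw [hhf z hz]) (fun x hx y hy => by
        rw [← map_sub, RCLike.norm_conj]
        exact hfN x hx y hy) hS)
    have h3 : ∀ u : ℂ, fderiv ℝ (fun z => conj (h z)) b u = conj (fderiv ℝ h b u) := fun u =>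
      DFunLike.congr_fun (Complex.conjCLE.comp_fderiv (f := h) (x := b)) u
    have h4 : ‖fderiv ℝ h b 1 + Complex.I * fderiv ℝ h b Complex.I‖ ≤ C * T * N := by
      rw [h3, h3, ← RCLike.norm_conj] at h2
      simpa using h2
    set p := fderiv ℝ h b 1
    set q := fderiv ℝ h b Complex.I
    have h5 : ‖p‖ ≤ C * T * N := by
      have := norm_add_le (p - Complex.I * q) (p + Complex.I * q)
      rw [show p - Complex.I * q + (p + Complex.I * q) = 2 * p by ring, norm_mul,
        Complex.norm_ofNat] at this
      linarith
    have h6 : ‖q‖ ≤ C * T * N := by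
      have := norm_sub_le (p + Complex.I * q) (p - Complex.I * q)
      rw [show p + Complex.I * q - (p - Complex.I * q) = 2 * (Complex.I * q) by ring, norm_mul,
        norm_mul, Complex.norm_I, Complex.norm_ofNat] at this
      linarith
    exact max_le h5 h6
  have h1 : ‖gradPair h b‖ ≤ C * T * σ := by
    refine ge_of_tendsto (x := 𝓝[>] σ) (f := fun N => C * T * N)
      ((tendsto_id.const_mul (C * T)).mono_left nhdsWithin_le_nhds) ?_
    filter_upwards [self_mem_nhdsWithin] with N hN using hle N hN
  have h2 : σ ≤ HNorm α U f := by
    rw [HNorm, ← hσ]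
    refine le_add_of_nonneg_left (Real.sSup_nonneg ?_)
    rintro _ ⟨x, -, rfl⟩
    exact norm_nonneg _
  calc _ ≤ C * T * σ := h1
    _ ≤ C * (T + 1) * HNorm α U f := by
      gcongr
      linarith

lemma exists_le_sum_eq {ι : Type*} [DecidableEq ι] (c : ι → ℝ≥0∞) (s : Finset ι) (τ : ℝ≥0∞)
    (hτ : τ ≤ ∑ i ∈ s, c i) : ∃ t : ι → ℝ≥0∞, (∀ i, t i ≤ c i) ∧ ∑ i ∈ s, t i = τ := by
  induction s using Finset.induction_on generalizing τ with
  | empty => exact ⟨0, fun i => zero_le, by simpa [eq_comm] using hτ⟩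
  | insert a s ha ih =>
    rw [Finset.sum_insert ha] at hτ
    obtain ⟨t, ht, hts⟩ := ih (τ - min τ (c a)) (by
      rw [tsub_le_iff_left]
      rcases le_total τ (c a) with h | h
      · rw [min_eq_left h]
        exact le_self_add
      · rwa [min_eq_right h])
    refine ⟨Function.update t a (min τ (c a)), fun i => ?_, ?_⟩
    · rcases eq_or_ne i a with rfl | hi
      · simp
      · simpa [hi] using ht i
    · rw [Finset.sum_insert ha, Function.update_self, Finset.sum_congr rfl fun i hi =>
        Function.update_of_ne (ne_of_mem_of_not_mem hi ha) _ _, hts]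
      exact add_tsub_cancel_of_le (min_le_left _ _)

/-- Distribution of mass along a finite number of generations of a nested sequence of partitions. -/
lemma exists_measure_le_of_partition {ι : Type*} [DecidableEq ι] {D : ℕ → ℂ → ι}
    (hD : ∀ k z w, D (k + 1) z = D (k + 1) w → D k z = D k w) {c : Set ℂ → ℝ≥0∞}
    (hsub : ∀ (A : Set ℂ) (k : ℕ) (s : Finset ι), (∀ z ∈ A, D k z ∈ s) →
      c A ≤ ∑ q ∈ s, c (A ∩ {z | D k z = q})) (h0 : c ∅ = 0) (j : ℕ) :
    ∀ (k : ℕ) (A : Set ℂ), (∀ l, (D l '' A).Finite) → (∀ z ∈ A, ∀ w ∈ A, D k z = D k w) →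
      ∀ τ ≤ c A, ∃ μ : Measure ℂ, μ Aᶜ = 0 ∧ μ Set.univ = τ ∧
        ∀ l, k ≤ l → l ≤ k + j → ∀ q, μ {z | D l z = q} ≤ c (A ∩ {z | D l z = q}) := by
  have hmono : ∀ k l, k ≤ l → ∀ z w, D l z = D l w → D k z = D k w := fun k l hkl => by
    induction l, hkl using Nat.le_induction with
    | base => exact fun z w h => h
    | succ l _ ih => exact fun z w h => ih z w (hD l z w h)
  have hself : ∀ (k : ℕ) (A : Set ℂ), (∀ z ∈ A, ∀ w ∈ A, D k z = D k w) → ∀ τ ≤ c A,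
      ∀ μ : Measure ℂ, μ Aᶜ = 0 → μ Set.univ = τ →
      ∀ q, μ {z | D k z = q} ≤ c (A ∩ {z | D k z = q}) := fun k A hA τ hτ μ h1 h2 q => by
    by_cases hq : ∃ z ∈ A, D k z = q
    · obtain ⟨z, hz, hzq⟩ := hq
      have hAq : A ⊆ {z | D k z = q} := fun w hw => (hA w hw z hz).trans hzq
      rw [Set.inter_eq_left.mpr hAq]
      exact (measure_mono (Set.subset_univ _)).trans (h2.le.trans hτ)
    · push Not at hq
      have hAq : {z | D k z = q} ⊆ Aᶜ := fun w hw hwA => hq w hwA hw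
      rw [measure_mono_null hAq h1]
      exact zero_le
  induction j with
  | zero =>
    intro k A _ hA τ hτ
    rcases A.eq_empty_or_nonempty with rfl | ⟨x, hx⟩
    · rw [h0] at hτ
      exact ⟨0, by simp, by simpa [eq_comm] using hτ, fun l _ _ q => by simp⟩
    · have h1 : (τ • Measure.dirac x) Aᶜ = 0 := by
        rw [Measure.smul_apply, Measure.dirac_apply, Set.indicator_of_notMem
            (Set.notMem_compl_iff.mpr hx),
          smul_zero]
      refine ⟨τ • Measure.dirac x, h1, by simp, fun l hl hl' q => ?_⟩
      obtain rfl : l = k := by omega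
      exact hself l A hA τ hτ _ h1 (by simp) q
  | succ j ih =>
    intro k A hfin hA τ hτ
    set s := (hfin (k + 1)).toFinset with hs
    have hAs : ∀ z ∈ A, D (k + 1) z ∈ s := fun z hz => by
      rw [hs, Set.Finite.mem_toFinset]
      exact ⟨z, hz, rfl⟩
    obtain ⟨t, ht, hts⟩ := exists_le_sum_eq (fun q => c (A ∩ {z | D (k + 1) z = q})) s τ
      (hτ.trans (hsub A (k + 1) s hAs))
    have hex := fun q => ih (k + 1) (A ∩ {z | D (k + 1) z = q})
      (fun l => (hfin l).subset (Set.image_mono Set.inter_subset_left))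
      (fun z hz w hw => hz.2.trans hw.2.symm) (t q) (ht q)
    choose μ hμ1 hμ2 hμ3 using hex
    have h1 : (∑ q ∈ s, μ q) Aᶜ = 0 := by
      rw [Measure.finsetSum_apply]
      exact Finset.sum_eq_zero fun q _ =>
        measure_mono_null (Set.compl_subset_compl.mpr Set.inter_subset_left) (hμ1 q)
    have h2 : (∑ q ∈ s, μ q) Set.univ = τ := by
      rw [Measure.finsetSum_apply, ← hts]
      exact Finset.sum_congr rfl fun q _ => hμ2 q
    refine ⟨∑ q ∈ s, μ q, h1, h2, fun l hl hl' p => ?_⟩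
    rcases hl.eq_or_lt with rfl | hl
    · exact hself k A hA τ hτ _ h1 h2 p
    by_cases hp : ∃ z ∈ A, D l z = p
    · obtain ⟨z, hz, hzp⟩ := hp
      rw [Measure.finsetSum_apply, Finset.sum_eq_single (D (k + 1) z)]
      · refine (hμ3 (D (k + 1) z) l hl (by omega) p).trans (le_of_eq ?_)
        congr 1
        ext w
        refine ⟨fun hw => ⟨hw.1.1, hw.2⟩, fun hw => ⟨⟨hw.1, ?_⟩, hw.2⟩⟩
        exact hmono (k + 1) l hl w z (hw.2.trans hzp.symm)
      · intro q _ hq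
        have hsub' : {z | D l z = p} ⊆ (A ∩ {z | D (k + 1) z = q})ᶜ := fun w hw hwA =>
          hq (hwA.2.symm.trans (hmono (k + 1) l hl w z ((show D l w = p from hw).trans hzp.symm)))
        exact measure_mono_null hsub' (hμ1 q)
      · exact fun h => absurd (hAs z hz) h
    · push Not at hp
      have hAp : {z | D l z = p} ⊆ Aᶜ := fun w hw hwA => hp w hwA hw
      rw [measure_mono_null hAp h1]
      exact zero_le

/-- Labels of the half-open dyadic squares of side `2⁻ᵏ`, with a single square for `k = 0`. -/
def dyadicLabel : ℕ → ℂ → ℤ × ℤ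
  | 0, _ => 0
  | k + 1, z => (⌊2 ^ (k + 1) * z.re⌋, ⌊2 ^ (k + 1) * z.im⌋)

lemma floor_two_pow_mul (k : ℕ) (x : ℝ) : ⌊2 ^ k * x⌋ = ⌊2 ^ (k + 1) * x⌋ / 2 := by
  rw [show (2 : ℝ) ^ k * x = 2 ^ (k + 1) * x / (2 : ℕ) by rw [pow_succ]; push_cast; ring,
    Int.floor_div_natCast]
  rfl

lemma dyadicLabel_eq_of_succ_eq (k : ℕ) (z w : ℂ)
    (h : dyadicLabel (k + 1) z = dyadicLabel (k + 1) w) : dyadicLabel k z = dyadicLabel k w := by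
  cases k with
  | zero => rfl
  | succ k =>
    simp only [dyadicLabel, Prod.mk.injEq] at h ⊢
    rw [floor_two_pow_mul, floor_two_pow_mul (k + 1) w.re, floor_two_pow_mul (k + 1) z.im,
      floor_two_pow_mul (k + 1) w.im, h.1, h.2]
    exact ⟨rfl, rfl⟩

lemma finite_dyadicLabel_image {A : Set ℂ} (hA : Bornology.IsBounded A) (k : ℕ) :
    (dyadicLabel k '' A).Finite := by
  cases k with
  | zero => exact (Set.finite_singleton 0).subset (by rintro _ ⟨z, -, rfl⟩; rfl)
  | succ k =>
    obtain ⟨R, hR⟩ := hA.subset_closedBall 0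
    have hb : ∀ x : ℝ, |x| ≤ R →
        ⌊2 ^ (k + 1) * x⌋ ∈ Set.Icc ⌊2 ^ (k + 1) * (-R)⌋ ⌊2 ^ (k + 1) * R⌋ := fun x hx =>
      ⟨Int.floor_mono (mul_le_mul_of_nonneg_left (abs_le.mp hx).1 (by positivity)),
        Int.floor_mono (mul_le_mul_of_nonneg_left (abs_le.mp hx).2 (by positivity))⟩
    refine ((Set.finite_Icc ⌊2 ^ (k + 1) * (-R)⌋ ⌊2 ^ (k + 1) * R⌋).prod
      (Set.finite_Icc ⌊2 ^ (k + 1) * (-R)⌋ ⌊2 ^ (k + 1) * R⌋)).subset ?_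
    rintro _ ⟨z, hz, rfl⟩
    have hz := mem_closedBall_zero_iff.mp (hR hz)
    exact ⟨hb _ ((Complex.abs_re_le_norm z).trans hz), hb _ ((Complex.abs_im_le_norm z).trans hz)⟩

lemma exists_dyadicLabel_subset_closedBall (k : ℕ) (q : ℤ × ℤ) :
    ∃ x : ℂ, {z | dyadicLabel (k + 1) z = q} ⊆ closedBall x ((2 : ℝ) ^ (k + 1))⁻¹ := by
  set S : ℝ := (2 : ℝ) ^ (k + 1) with hS
  have hS0 : 0 < S := by positivity
  refine ⟨⟨(q.1 + 1 / 2) / S, (q.2 + 1 / 2) / S⟩, ?_⟩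
  rintro z rfl
  have hb : ∀ x : ℝ, |x - (⌊S * x⌋ + 1 / 2) / S| ≤ S⁻¹ / 2 := fun x => by
    have h1 := Int.floor_le (S * x)
    have h2 := Int.lt_floor_add_one (S * x)
    rw [show x - (⌊S * x⌋ + 1 / 2) / S = (S * x - ⌊S * x⌋ - 1 / 2) * S⁻¹ by field_simp; ring,
      abs_mul, abs_of_pos (inv_pos.mpr hS0)]
    have : |S * x - ⌊S * x⌋ - 1 / 2| ≤ 1 / 2 := abs_le.mpr ⟨by linarith, by linarith⟩
    have h3 : 0 < S⁻¹ := by positivity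
    nlinarith
  rw [mem_closedBall, dist_eq_norm]
  refine (Complex.norm_le_abs_re_add_abs_im _).trans ?_
  have h1 := hb z.re
  have h2 := hb z.im
  simp only [Complex.sub_re, Complex.sub_im, dyadicLabel]
  rw [← hS]
  linarith

lemma MhContent_empty {h : ℝ → ℝ} (h0 : h 0 ≤ 0) : MhContent h ∅ = 0 :=
  le_antisymm ((MhContent_le (fun _ => (0, 0)) (fun _ => le_rfl) (Set.empty_subset _)).trans
    (by simp [ENNReal.ofReal_of_nonpos h0])) zero_le

lemma MhContent_le_of_subset_closedBall {h : ℝ → ℝ} (h0 : h 0 ≤ 0) {E : Set ℂ} {x : ℂ} {r : ℝ}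
    (hr : 0 ≤ r) (hE : E ⊆ closedBall x r) : MhContent h E ≤ ENNReal.ofReal (h r) := by
  refine (MhContent_le (fun n => (x, if n = 0 then r else 0)) (fun n => ?_) fun z hz =>
    Set.mem_iUnion.mpr ⟨0, by simpa using hE hz⟩).trans ?_
  · split_ifs
    · exact hr
    · exact le_rfl
  · rw [tsum_eq_single 0 fun n hn => by simp [hn, ENNReal.ofReal_of_nonpos h0]]
    simp

lemma MhContent_le_sum {h : ℝ → ℝ} (h0 : h 0 ≤ 0) {ι : Type*} [DecidableEq ι] (D : ℂ → ι)
    (s : Finset ι) : ∀ A : Set ℂ, (∀ z ∈ A, D z ∈ s) →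
      MhContent h A ≤ ∑ q ∈ s, MhContent h (A ∩ {z | D z = q}) := by
  induction s using Finset.induction_on with
  | empty =>
    intro A hA
    have : A = ∅ := Set.eq_empty_of_forall_notMem fun z hz => by simpa using hA z hz
    rw [this, MhContent_empty h0]
    exact zero_le
  | insert a s ha ih =>
    intro A hA
    rw [Finset.sum_insert ha]
    have h1 : A ⊆ (A ∩ {z | D z = a}) ∪ (A ∩ {z | D z ≠ a}) := fun z hz => by
      by_cases hza : D z = a
      · exact Or.inl ⟨hz, hza⟩
      · exact Or.inr ⟨hz, hza⟩
    refine (MhContent_mono h1).trans ((MhContent_union_le _ _ _).trans (add_le_add le_rfl ?_))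
    refine (ih _ fun z hz => (Finset.mem_insert.mp (hA z hz.1)).resolve_left hz.2).trans ?_
    exact Finset.sum_le_sum fun q _ => MhContent_mono
      (Set.inter_subset_inter_left _ Set.inter_subset_left)

lemma ball_subset_iUnion_dyadicLabel (x : ℂ) {r : ℝ} {k : ℕ} (hr : r ≤ ((2 : ℝ) ^ k)⁻¹) :
    ∃ s : Finset (ℤ × ℤ), s.card = 25 ∧ ball x r ⊆ ⋃ q ∈ s, {z | dyadicLabel (k + 1) z = q} := by
  set S : ℝ := (2 : ℝ) ^ (k + 1) with hS
  have hS0 : 0 < S := by positivity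
  have hrS : S * r ≤ 2 := by
    have : S = 2 * 2 ^ k := by rw [hS, pow_succ, mul_comm]
    have h2 : (0 : ℝ) < 2 ^ k := by positivity
    rw [this]
    calc _ ≤ 2 * (2 : ℝ) ^ k * ((2 : ℝ) ^ k)⁻¹ := by gcongr
      _ = 2 := by rw [mul_assoc, mul_inv_cancel₀ h2.ne', mul_one]
  refine ⟨Finset.Icc (⌊S * x.re⌋ - 2) (⌊S * x.re⌋ + 2) ×ˢ
    Finset.Icc (⌊S * x.im⌋ - 2) (⌊S * x.im⌋ + 2), ?_, fun z hz => ?_⟩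
  · rw [Finset.card_product, Int.card_Icc, Int.card_Icc]
    rw [show ⌊S * x.re⌋ + 2 + 1 - (⌊S * x.re⌋ - 2) = 5 by ring,
      show ⌊S * x.im⌋ + 2 + 1 - (⌊S * x.im⌋ - 2) = 5 by ring]
    rfl
  · rw [mem_ball, dist_eq_norm] at hz
    have hb : ∀ u v : ℝ, |u - v| < r → ⌊S * u⌋ ∈ Finset.Icc (⌊S * v⌋ - 2) (⌊S * v⌋ + 2) :=
      fun u v huv => by
        obtain ⟨h1, h2⟩ := abs_lt.mp huv
        rw [Finset.mem_Icc, ← Int.floor_sub_ofNat, ← Int.floor_add_ofNat]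
        exact ⟨Int.floor_mono (by nlinarith), Int.floor_mono (by nlinarith)⟩
    refine Set.mem_iUnion₂.mpr ⟨dyadicLabel (k + 1) z, ?_, rfl⟩
    rw [dyadicLabel, Finset.mem_product, ← hS]
    exact ⟨hb _ _ ((Complex.abs_re_le_norm (z - x)).trans_lt hz),
      hb _ _ ((Complex.abs_im_le_norm (z - x)).trans_lt hz)⟩

/-- Frostman's lemma for a general gauge. -/
theorem exists_frostman_measure {h : ℝ → ℝ} (hmono : MonotoneOn h (Set.Ici 0)) (h0 : h 0 ≤ 0)
    {E : Set ℂ} (hE : IsCompact E) : ∃ μ : Measure ℂ, μ Eᶜ = 0 ∧ μ Set.univ = MhContent h E ∧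
      ∀ (x : ℂ) (r : ℝ), 0 < r → r ≤ 1 → μ (ball x r) ≤ 25 * ENNReal.ofReal (h r) := by
  rcases eq_or_ne (MhContent h E) 0 with hc0 | hc0
  · exact ⟨0, by simp, by simpa using hc0.symm, by simp⟩
  have hctop : MhContent h E ≠ ⊤ := by
    obtain ⟨R, hR0, hR⟩ := hE.isBounded.subset_closedBall_lt 0 0
    exact ne_top_of_le_ne_top ENNReal.ofReal_ne_top
      (MhContent_le_of_subset_closedBall h0 hR0.le hR)
  have hex := fun j => exists_measure_le_of_partition (D := dyadicLabel) (c := MhContent h)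
    dyadicLabel_eq_of_succ_eq (fun A k s hA => MhContent_le_sum h0 (dyadicLabel k) s A hA)
    (MhContent_empty h0) j 0 E (finite_dyadicLabel_image hE.isBounded) (fun _ _ _ _ => rfl)
    (MhContent h E) le_rfl
  choose ν hν1 hν2 hν3 using hex
  set c := MhContent h E with hc
  have hball : ∀ (x : ℂ) (r : ℝ), 0 < r → r ≤ 1 → ∀ᶠ j in atTop,
      ν j (ball x r) ≤ 25 * ENNReal.ofReal (h r) := fun x r hr hr1 => by
    obtain ⟨k, hk1, hk2⟩ := exists_nat_pow_near_of_lt_one hr hr1 (y := (2⁻¹ : ℝ)) (by norm_num)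
      (by norm_num)
    rw [inv_pow] at hk1 hk2
    obtain ⟨s, hs, hsub⟩ := ball_subset_iUnion_dyadicLabel x hk2
    filter_upwards [eventually_ge_atTop (k + 1)] with j hj
    calc ν j (ball x r) ≤ ∑ q ∈ s, ν j {z | dyadicLabel (k + 1) z = q} :=
          (measure_mono hsub).trans (measure_biUnion_finset_le _ _)
      _ ≤ ∑ q ∈ s, ENNReal.ofReal (h r) := by
          refine Finset.sum_le_sum fun q _ => (hν3 j (k + 1) (by omega) (by omega) q).trans ?_
          obtain ⟨y, hy⟩ := exists_dyadicLabel_subset_closedBall k q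
          refine (MhContent_le_of_subset_closedBall h0 (by positivity)
            (Set.inter_subset_right.trans hy)).trans (ENNReal.ofReal_le_ofReal ?_)
          exact hmono (Set.mem_Ici.mpr (by positivity)) (Set.mem_Ici.mpr hr.le) hk1.le
      _ = _ := by rw [Finset.sum_const, hs, nsmul_eq_mul]; norm_cast
  have hprob : ∀ j, IsProbabilityMeasure (c⁻¹ • ν j) := fun j =>
    ⟨by rw [Measure.smul_apply, hν2, smul_eq_mul, ENNReal.inv_mul_cancel hc0 hctop]⟩
  set P : ℕ → ProbabilityMeasure ℂ := fun j => ⟨c⁻¹ • ν j, hprob j⟩ with hP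
  have hcomp := isCompact_setOfPred_probabilityMeasure_mass_eq_compl_isCompact_le (E := ℂ)
    (u := fun _ => 0) (K := fun _ => E) tendsto_const_nhds (fun _ => hE) (Or.inl inferInstance)
  obtain ⟨Q, hQ, hlim⟩ := hcomp.ultrafilter_le_nhds ((hyperfilter ℕ).map P) (by
    rw [le_principal_iff]
    change ∀ᶠ j in (hyperfilter ℕ : Filter ℕ), ∀ _ : ℕ, P j Eᶜ ≤ 0
    refine Eventually.of_forall fun j _ => ?_
    rw [← ENNReal.coe_le_coe, ProbabilityMeasure.ennreal_coeFn_eq_coeFn_toMeasure]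
    simp [hP, hν1])
  have hQ0 : (Q : Measure ℂ) Eᶜ = 0 := by
    have := hQ 0
    rw [← ENNReal.coe_le_coe, ProbabilityMeasure.ennreal_coeFn_eq_coeFn_toMeasure] at this
    simpa using this
  refine ⟨c • (Q : Measure ℂ), by simp [hQ0], by simp, fun x r hr hr1 => ?_⟩
  have h1 := ProbabilityMeasure.le_liminf_measure_open_of_tendsto
    (show Tendsto P (hyperfilter ℕ) (𝓝 Q) from hlim) (isOpen_ball (x := x) (ε := r))
  have h2 : liminf (fun j => (P j : Measure ℂ) (ball x r)) (hyperfilter ℕ) ≤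
      c⁻¹ * (25 * ENNReal.ofReal (h r)) := by
    refine liminf_le_of_frequently_le' (Eventually.frequently ?_)
    filter_upwards [(Nat.hyperfilter_le_atTop) (hball x r hr hr1)] with j hj
    show (c⁻¹ • ν j) (ball x r) ≤ _
    rw [Measure.smul_apply, smul_eq_mul]
    gcongr
  rw [Measure.smul_apply, smul_eq_mul]
  calc _ ≤ c * (c⁻¹ * (25 * ENNReal.ofReal (h r))) := by gcongr; exact h1.trans h2
    _ = _ := by rw [← mul_assoc, ENNReal.mul_inv_cancel hc0 hctop, one_mul]

/-- The constant `∫₀^∞ (eˢ - 1)^(-γ) ds`. -/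
def expConst (γ : ℝ) : ℝ≥0∞ :=
  ∫⁻ s in Set.Ioi (0 : ℝ), ENNReal.ofReal ((Real.exp s - 1) ^ (-γ))

lemma expConst_ne_top {γ : ℝ} (h0 : 0 < γ) (h1 : γ < 1) : expConst γ ≠ ⊤ := by
  have hint : IntegrableOn (fun x : ℝ => x ^ (-γ) * Real.exp (-(γ / 2) * x)) (Set.Ioi 0) := by
    have := integrableOn_rpow_mul_exp_neg_mul_rpow (s := -γ) (p := 1) (b := γ / 2) (by linarith)
      one_pos (by positivity)
    simpa using this
  refine ne_top_of_le_ne_top hint.lintegral_lt_top.ne ?_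
  refine setLIntegral_mono' measurableSet_Ioi fun s hs => ENNReal.ofReal_le_ofReal ?_
  have hs : 0 < s := hs
  have h2 : s * Real.exp (s / 2) ≤ Real.exp s - 1 := by
    have h3 : s / 2 ≤ Real.sinh (s / 2) := Real.self_le_sinh_iff.mpr (by linarith)
    rw [Real.sinh_eq] at h3
    have h4 : 0 < Real.exp (s / 2) := Real.exp_pos _
    have h5 : Real.exp (s / 2) * Real.exp (s / 2) = Real.exp s := by
      rw [← Real.exp_add]; congr 1; ring
    have h6 : Real.exp (s / 2) * Real.exp (-(s / 2)) = 1 := by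
      rw [← Real.exp_add]; simp
    nlinarith
  calc (Real.exp s - 1) ^ (-γ) ≤ (s * Real.exp (s / 2)) ^ (-γ) :=
        Real.rpow_le_rpow_of_nonpos (by positivity) h2 (by linarith)
    _ = _ := by
        rw [Real.mul_rpow hs.le (Real.exp_pos _).le, ← Real.exp_mul]
        congr 2
        ring

lemma lintegral_log_one_add_div_le {μ : Measure ℂ} {z : ℂ} {d A B α β : ℝ} (hd : 0 < d)
    (hA : 0 ≤ A) (hB : 0 ≤ B)
    (hμ : ∀ r, 0 < r → μ (ball z r) ≤ ENNReal.ofReal (A * r ^ α + B * r ^ β)) :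
    ∫⁻ w, ENNReal.ofReal (Real.log (1 + d / ‖z - w‖)) ∂μ ≤
      ENNReal.ofReal (A * d ^ α) * expConst α + ENNReal.ofReal (B * d ^ β) * expConst β := by
  have hnn : ∀ w, 0 ≤ Real.log (1 + d / ‖z - w‖) := fun w =>
    Real.log_nonneg (le_add_of_nonneg_right (by positivity))
  rw [lintegral_eq_lintegral_meas_lt μ (ae_of_all _ hnn) (by fun_prop)]
  have hm : ∀ γ : ℝ, Measurable fun s : ℝ => ENNReal.ofReal ((Real.exp s - 1) ^ (-γ)) := fun γ => by
    fun_prop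
  rw [expConst, expConst, ← lintegral_const_mul _ (hm α), ← lintegral_const_mul _ (hm β),
    ← lintegral_add_left ((hm α).const_mul _)]
  refine setLIntegral_mono' measurableSet_Ioi fun t ht => ?_
  have ht : 0 < t := ht
  have he : 0 < Real.exp t - 1 := by linarith [Real.add_one_lt_exp ht.ne']
  have hsub : {w | t < Real.log (1 + d / ‖z - w‖)} ⊆ ball z (d / (Real.exp t - 1)) := fun w hw => by
    have hw : t < Real.log (1 + d / ‖z - w‖) := hw
    rw [Real.lt_log_iff_exp_lt (by positivity)] at hw
    have h1 : Real.exp t - 1 < d / ‖z - w‖ := by linarith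
    have h2 : 0 < ‖z - w‖ := by
      by_contra h
      rw [le_antisymm (not_lt.mp h) (norm_nonneg _), _root_.div_zero] at h1
      linarith
    rw [mem_ball', dist_eq_norm, lt_div_iff₀ he]
    rw [lt_div_iff₀ h2] at h1
    linarith
  refine (measure_mono hsub).trans ((hμ _ (by positivity)).trans (le_of_eq ?_))
  have hr : ∀ γ : ℝ, (d / (Real.exp t - 1)) ^ γ = d ^ γ * (Real.exp t - 1) ^ (-γ) := fun γ => by
    rw [Real.div_rpow hd.le he.le, Real.rpow_neg he.le, div_eq_mul_inv]
  rw [hr, hr, ← ENNReal.ofReal_mul (by positivity), ← ENNReal.ofReal_mul (by positivity),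
    ← ENNReal.ofReal_add (by positivity) (by positivity), mul_assoc, mul_assoc]

lemma abs_log_sub_log_le {a b d : ℝ} (ha : 0 < a) (hb : 0 < b) (hab : |a - b| ≤ d) :
    |Real.log a - Real.log b| ≤ Real.log (1 + d / a) + Real.log (1 + d / b) := by
  have key : ∀ {a b : ℝ}, 0 < a → 0 < b → b - a ≤ d →
      Real.log b - Real.log a ≤ Real.log (1 + d / a) := fun {a b} ha hb h => by
    rw [← Real.log_div hb.ne' ha.ne']
    refine Real.log_le_log (by positivity) ?_
    rw [div_le_iff₀ ha, add_mul, div_mul_cancel₀ _ ha.ne']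
    linarith
  have hd : 0 ≤ d := (abs_nonneg _).trans hab
  have hnn : ∀ {a : ℝ}, 0 < a → 0 ≤ Real.log (1 + d / a) := fun ha =>
    Real.log_nonneg (le_add_of_nonneg_right (by positivity))
  obtain ⟨h1, h2⟩ := abs_le.mp hab
  rw [abs_le]
  constructor
  · linarith [key ha hb (by linarith), hnn hb]
  · linarith [key hb ha (by linarith), hnn ha]

lemma abs_log_le {a : ℝ} (ha : 0 < a) :
    |Real.log a| ≤ Real.log (1 + 1 / a) + Real.log (1 + a) := by
  have h1 : Real.log a ≤ Real.log (1 + a) := Real.log_le_log ha (by linarith)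
  have h2 : -Real.log a ≤ Real.log (1 + 1 / a) := by
    rw [← Real.log_inv]
    exact Real.log_le_log (by positivity) (by rw [one_div]; linarith)
  have h3 : 0 ≤ Real.log (1 + a) := Real.log_nonneg (by linarith)
  have h4 : 0 ≤ Real.log (1 + 1 / a) := Real.log_nonneg (le_add_of_nonneg_right (by positivity))
  rw [abs_le]
  constructor <;> linarith

lemma sum_pow_le_of_forall_le {q Q : ℝ} (hq0 : 0 ≤ q) (hq1 : q < 1) (hQ : 0 ≤ Q) (s : Finset ℕ)
    (hs : ∀ n ∈ s, q ^ n ≤ Q) : ∑ n ∈ s, q ^ n ≤ Q / (1 - q) := by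
  rcases s.eq_empty_or_nonempty with rfl | hne
  · simpa using div_nonneg hQ (by linarith)
  have hsub : s ⊆ Finset.Ico (s.min' hne) (s.max' hne + 1) := fun n hn =>
    Finset.mem_Ico.mpr ⟨s.min'_le n hn, Nat.lt_succ_of_le (s.le_max' n hn)⟩
  calc ∑ n ∈ s, q ^ n ≤ ∑ n ∈ Finset.Ico (s.min' hne) (s.max' hne + 1), q ^ n :=
        Finset.sum_le_sum_of_subset_of_nonneg hsub fun n _ _ => pow_nonneg hq0 n
    _ ≤ q ^ (s.min' hne) / (1 - q) := geom_sum_Ico_le_of_lt_one hq0 hq1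
    _ ≤ Q / (1 - q) := div_le_div_of_nonneg_right (hs _ (s.min'_mem hne)) (by linarith)

lemma isCompact_Ann (b : ℂ) (n : ℕ) : IsCompact (Ann b n) := by
  refine (isCompact_closedBall b ((2 : ℝ) ^ (-(n : ℝ)))).of_isClosed_subset ?_ fun z hz => ?_
  · have h1 : IsClosed {z : ℂ | (2 : ℝ) ^ (-(n : ℝ) - 1) ≤ ‖z - b‖} :=
      isClosed_le continuous_const (by fun_prop)
    have h2 : IsClosed {z : ℂ | ‖z - b‖ ≤ (2 : ℝ) ^ (-(n : ℝ))} :=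
      isClosed_le (by fun_prop) continuous_const
    exact h1.inter h2
  · rw [mem_closedBall, dist_eq_norm]
    exact hz.2

lemma exists_measure_lowerContent_le {α : ℝ} (hα : 0 < α) {E : Set ℂ} (hE : IsCompact E) {b : ℂ}
    {ρ : ℝ} (hρ0 : 0 < ρ) (hρ1 : ρ ≤ 1) (hEb : E ⊆ closedBall b ρ) :
    ∃ μ : Measure ℂ, μ Eᶜ = 0 ∧ lowerContent α E ≤ 2 * μ Set.univ ∧
      μ Set.univ ≤ ENNReal.ofReal (ρ ^ α) ∧
      (∀ x r, 0 < r → μ (ball x r) ≤ ENNReal.ofReal (25 * r ^ α)) ∧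
      ∀ ε, 0 < ε → ∃ δ, 0 < δ ∧ ∀ x r, 0 < r → r < δ → μ (ball x r) ≤
        ENNReal.ofReal (ε * r ^ α) := by
  have hgauge0 : ∀ h : ℝ → ℝ, MonotoneOn h (Set.Ici 0) → (∀ r : ℝ, 0 < r → 0 ≤ h r ∧ h r ≤ r ^ α) →
      h 0 ≤ 0 := fun h hm hr => by
    have ht : Tendsto (fun r : ℝ => r ^ α) (𝓝[>] 0) (𝓝 0) := by
      have := (Real.continuousAt_rpow_const 0 α (Or.inr hα.le)).tendsto
      rw [Real.zero_rpow hα.ne'] at this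
      exact this.mono_left nhdsWithin_le_nhds
    refine ge_of_tendsto ht ?_
    filter_upwards [self_mem_nhdsWithin] with r hr0
    have hr0 : 0 < r := hr0
    exact (hm Set.self_mem_Ici hr0.le hr0.le).trans (hr r hr0).2
  obtain ⟨h, ⟨hmono, hbd, hlim⟩, hlc⟩ : ∃ h : ℝ → ℝ, (MonotoneOn h (Set.Ici 0) ∧
      (∀ r : ℝ, 0 < r → 0 ≤ h r ∧ h r ≤ r ^ α) ∧
      Tendsto (fun r => h r / r ^ α) (nhdsWithin 0 (Set.Ioi 0)) (nhds 0)) ∧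
      lowerContent α E ≤ 2 * MhContent h E := by
    rcases eq_or_ne (lowerContent α E) 0 with h0 | h0
    · refine ⟨fun _ => 0, ⟨fun _ _ _ _ _ => le_rfl, fun r hr => ⟨le_rfl, by positivity⟩, ?_⟩, ?_⟩
      · simp
      · simp [h0]
    · have hfin : lowerContent α E ≠ ⊤ := by
        refine ne_top_of_le_ne_top (ENNReal.ofReal_ne_top (r := ρ ^ α)) ?_
        refine iSup_le fun h => iSup_le fun hh => ?_
        exact (MhContent_le_of_subset_closedBall (hgauge0 h hh.1 hh.2.1) hρ0.le hEb).trans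
          (ENNReal.ofReal_le_ofReal (hh.2.1 ρ hρ0).2)
      have hlt : lowerContent α E / 2 < lowerContent α E := ENNReal.half_lt_self h0 hfin
      conv_rhs at hlt => rw [lowerContent]
      obtain ⟨h, hlt⟩ := lt_iSup_iff.mp hlt
      obtain ⟨hh, hlt⟩ := lt_iSup_iff.mp hlt
      refine ⟨h, hh, ?_⟩
      rw [mul_comm]
      exact (ENNReal.div_le_iff two_ne_zero ENNReal.ofNat_ne_top).mp hlt.le
  have h0 := hgauge0 h hmono hbd
  obtain ⟨μ, hμE, hμu, hμb⟩ := exists_frostman_measure hmono h0 hE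
  have hu : μ Set.univ ≤ ENNReal.ofReal (ρ ^ α) := by
    rw [hμu]
    exact (MhContent_le_of_subset_closedBall h0 hρ0.le hEb).trans
      (ENNReal.ofReal_le_ofReal (hbd ρ hρ0).2)
  have h25 : ∀ x : ℝ, 25 * ENNReal.ofReal x = ENNReal.ofReal (25 * x) := fun x => by
    rw [ENNReal.ofReal_mul (by norm_num)]
    simp
  refine ⟨μ, hμE, hμu ▸ hlc, hu, fun x r hr => ?_, fun ε hε => ?_⟩
  · rcases le_total r 1 with h1 | h1
    · refine (hμb x r hr h1).trans ?_
      rw [h25]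
      exact ENNReal.ofReal_le_ofReal (mul_le_mul_of_nonneg_left (hbd r hr).2 (by norm_num))
    · refine (measure_mono (Set.subset_univ _)).trans (hu.trans (ENNReal.ofReal_le_ofReal ?_))
      have e1 := Real.rpow_le_one hρ0.le hρ1 hα.le
      have e2 := Real.one_le_rpow h1 hα.le
      linarith
  · have hev := (tendsto_order.mp hlim).2 (ε / 25) (by positivity)
    obtain ⟨δ, hδ, hδs⟩ := mem_nhdsGT_iff_exists_Ioo_subset.mp hev
    have hδ : 0 < δ := hδ
    refine ⟨min δ 1, by positivity, fun x r hr hrδ => ?_⟩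
    refine (hμb x r hr (hrδ.le.trans (min_le_right _ _))).trans ?_
    rw [h25]
    refine ENNReal.ofReal_le_ofReal ?_
    have h3 : h r / r ^ α < ε / 25 := hδs ⟨hr, hrδ.trans_le (min_le_left _ _)⟩
    rw [div_lt_iff₀ (by positivity)] at h3
    linarith

/-- The growth constant for sums of measures carried by dyadic annuli. -/
def growthConst (α : ℝ) : ℝ := 250 / (1 - (2⁻¹ : ℝ) ^ α)

lemma growthConst_pos {α : ℝ} (hα : 0 < α) : 0 < growthConst α :=
  div_pos (by norm_num) (sub_pos.mpr (Real.rpow_lt_one (by norm_num) (by norm_num) hα))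

lemma sum_measure_ball_le {α : ℝ} (hα0 : 0 < α) (hα1 : α < 1) {b : ℂ} {μ : ℕ → Measure ℂ}
    (hsupp : ∀ n, μ n (Ann b n)ᶜ = 0)
    (htot : ∀ n, μ n Set.univ ≤ ENNReal.ofReal (((2 : ℝ) ^ n)⁻¹ ^ α))
    (hball : ∀ n x r, 0 < r → μ n (ball x r) ≤ ENNReal.ofReal (25 * r ^ α))
    (s : Finset ℕ) (x : ℂ) {r : ℝ} (hr : 0 < r) :
    ∑ n ∈ s, μ n (ball x r) ≤ ENNReal.ofReal (growthConst α * r ^ α) := by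
  classical
  set q : ℝ := (2⁻¹ : ℝ) ^ α with hq
  have hq0 : 0 ≤ q := by positivity
  have hq1 : q < 1 := Real.rpow_lt_one (by norm_num) (by norm_num) hα0
  have hqn : ∀ n : ℕ, q ^ n = ((2 : ℝ) ^ n)⁻¹ ^ α := fun n => by
    rw [hq, ← Real.rpow_natCast, ← Real.rpow_mul (by norm_num), mul_comm,
        Real.rpow_mul (by norm_num),
      Real.rpow_natCast, inv_pow]
  have hc : ∀ c : ℝ, 1 ≤ c → c ^ α ≤ c := fun c h => by
    simpa using Real.rpow_le_rpow_of_exponent_le h hα1.le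
  set t := s.filter fun n => (Ann b n ∩ ball x r).Nonempty with ht
  have hst : ∑ n ∈ s, μ n (ball x r) = ∑ n ∈ t, μ n (ball x r) := by
    refine (Finset.sum_filter_of_ne fun n _ hn => ?_).symm
    by_contra hem
    rw [Set.not_nonempty_iff_eq_empty, ← Set.disjoint_iff_inter_eq_empty] at hem
    exact hn (measure_mono_null hem.symm.subset_compl_right (hsupp n))
  have hmem : ∀ n ∈ t, ∃ w : ℂ, ((2 : ℝ) ^ n)⁻¹ / 2 ≤ ‖w - b‖ ∧ ‖w - b‖ ≤ ((2 : ℝ) ^ n)⁻¹ ∧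
      ‖w - x‖ < r := fun n hn => by
    obtain ⟨w, hw1, hw2⟩ := (Finset.mem_filter.mp hn).2
    rw [mem_Ann_iff] at hw1
    rw [mem_ball, dist_eq_norm] at hw2
    exact ⟨w, hw1.1, hw1.2, hw2⟩
  have key : ∀ K T : ℝ, 0 ≤ K → 0 ≤ T → K * T ^ α ≤ 250 * r ^ α →
      (∀ n ∈ t, ((2 : ℝ) ^ n)⁻¹ ≤ T ∧ μ n (ball x r) ≤ ENNReal.ofReal (K * q ^ n)) →
      ∑ n ∈ t, μ n (ball x r) ≤ ENNReal.ofReal (growthConst α * r ^ α) := by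
    intro K T hK hT hKT hn
    calc ∑ n ∈ t, μ n (ball x r) ≤ ∑ n ∈ t, ENNReal.ofReal (K * q ^ n) :=
          Finset.sum_le_sum fun n h => (hn n h).2
      _ = ENNReal.ofReal (K * ∑ n ∈ t, q ^ n) := by
          rw [Finset.mul_sum, ENNReal.ofReal_sum_of_nonneg fun n _ => by positivity]
      _ ≤ _ := ENNReal.ofReal_le_ofReal ?_
    have h1 : ∑ n ∈ t, q ^ n ≤ T ^ α / (1 - q) :=
      sum_pow_le_of_forall_le hq0 hq1 (by positivity) t fun n h => by
        rw [hqn]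
        exact Real.rpow_le_rpow (by positivity) (hn n h).1 hα0.le
    calc K * ∑ n ∈ t, q ^ n ≤ K * (T ^ α / (1 - q)) := mul_le_mul_of_nonneg_left h1 hK
      _ = K * T ^ α / (1 - q) := by ring
      _ ≤ 250 * r ^ α / (1 - q) := div_le_div_of_nonneg_right hKT (by linarith)
      _ = growthConst α * r ^ α := by rw [growthConst]; ring
  rw [hst]
  have hrα : 0 < r ^ α := by positivity
  rcases le_or_gt (‖x - b‖) (4 * r) with hd | hd
  · refine key 1 (10 * r) zero_le_one (by positivity) ?_ fun n hn => ⟨?_, ?_⟩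
    · rw [Real.mul_rpow (by norm_num) hr.le]
      have := hc 10 (by norm_num)
      nlinarith
    · obtain ⟨w, h1, h2, h3⟩ := hmem n hn
      have := norm_add_le (w - x) (x - b)
      rw [sub_add_sub_cancel] at this
      linarith
    · rw [one_mul, hqn]
      exact (measure_mono (Set.subset_univ _)).trans (htot n)
  · set d := ‖x - b‖ with hdd
    have hd0 : 0 < d := by linarith
    have hn2 : ∀ n ∈ t, 3 / 4 * d ≤ ((2 : ℝ) ^ n)⁻¹ ∧ ((2 : ℝ) ^ n)⁻¹ ≤ 10 / 3 * (3 / 4 * d) := by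
      intro n hn
      obtain ⟨w, h1, h2, h3⟩ := hmem n hn
      have e1 := norm_add_le (w - x) (x - b)
      rw [sub_add_sub_cancel] at e1
      have e2 := norm_sub_norm_le (x - b) (x - w)
      rw [show x - b - (x - w) = w - b by ring, norm_sub_rev x w] at e2
      constructor <;> linarith
    refine key (25 * r ^ α / (3 / 4 * d) ^ α) (10 / 3 * (3 / 4 * d)) (by positivity) (by positivity)
      ?_ fun n hn => ⟨(hn2 n hn).2, ?_⟩
    · rw [Real.mul_rpow (x := 10 / 3) (by norm_num) (by positivity)]
      have := hc (10 / 3) (by norm_num)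
      have hp : 0 < (3 / 4 * d) ^ α := by positivity
      have e : 25 * r ^ α / (3 / 4 * d) ^ α * ((10 / 3) ^ α * (3 / 4 * d) ^ α) =
        25 * r ^ α * (10 / 3) ^ α := by field_simp
      rw [e]
      nlinarith
    · refine (hball n x r hr).trans (ENNReal.ofReal_le_ofReal ?_)
      rw [div_mul_eq_mul_div, le_div_iff₀ (by positivity), hqn]
      exact mul_le_mul_of_nonneg_left
        (Real.rpow_le_rpow (by positivity) (hn2 n hn).1 hα0.le) (by positivity)

lemma exists_measure_iUnion_Ann_diff {α : ℝ} (hα0 : 0 < α) (hα1 : α < 1) {U : Set ℂ}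
    (hU : IsOpen U) (b : ℂ) (M : ℕ) : ∃ μ : Measure ℂ,
      μ (⋃ n ∈ Finset.range M, Ann b (n + 1) \ U)ᶜ = 0 ∧
      μ Set.univ ≤ ENNReal.ofReal (growthConst α) ∧
      (∀ x r, 0 < r → μ (ball x r) ≤ ENNReal.ofReal (growthConst α * r ^ α)) ∧
      (∀ ε, 0 < ε → ∃ δ, 0 < δ ∧ ∀ x r, 0 < r → r < δ → μ (ball x r) ≤ ENNReal.ofReal (ε * r ^ α)) ∧
      ∑ n ∈ Finset.range M, (2 : ℝ≥0∞) ^ (n + 1) * lowerContent α (Ann b (n + 1) \ U) ≤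
        2 * ∫⁻ w, ENNReal.ofReal ‖w - b‖⁻¹ ∂μ := by
  have hAb : ∀ n, Ann b n ⊆ closedBall b ((2 : ℝ) ^ n)⁻¹ := fun n z hz => by
    rw [mem_closedBall, dist_eq_norm]
    exact (mem_Ann_iff.mp hz).2
  have hle1 : ∀ n : ℕ, ((2 : ℝ) ^ n)⁻¹ ≤ 1 := fun n => inv_le_one_of_one_le₀ (one_le_pow₀
      one_le_two)
  choose μ hμE hμl hμu hμb hμo using fun n => exists_measure_lowerContent_le hα0
    ((isCompact_Ann b n).diff hU) (b := b) (ρ := ((2 : ℝ) ^ n)⁻¹) (by positivity) (hle1 n)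
    (Set.sdiff_subset.trans (hAb n))
  set s := (Finset.range M).map ⟨Nat.succ, Nat.succ_injective⟩ with hs
  have hν : ∀ A : Set ℂ, (∑ n ∈ s, μ n) A = ∑ n ∈ s, μ n A := fun A => by
    rw [Measure.finsetSum_apply]
  have hgrow : ∀ x r, 0 < r → (∑ n ∈ s, μ n) (ball x r) ≤ ENNReal.ofReal (growthConst α * r ^ α) :=
    fun x r hr => by
      rw [hν]
      exact sum_measure_ball_le hα0 hα1 (fun n => measure_mono_null
        (Set.compl_subset_compl.mpr Set.sdiff_subset) (hμE n)) hμu hμb s x hr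
  have hnull : (∑ n ∈ s, μ n) (⋃ n ∈ Finset.range M, Ann b (n + 1) \ U)ᶜ = 0 := by
    rw [hν, hs, Finset.sum_map]
    refine Finset.sum_eq_zero fun n hn =>
      measure_mono_null (Set.compl_subset_compl.mpr ?_) (hμE (n + 1))
    exact Set.subset_biUnion_of_mem (u := fun n => Ann b (n + 1) \ U) hn
  refine ⟨∑ n ∈ s, μ n, hnull, ?_, hgrow, ?_, ?_⟩
  · have h1 := hgrow b 1 one_pos
    rw [Real.one_rpow, mul_one] at h1
    rw [← measure_add_measure_compl (s := ball b 1) measurableSet_ball]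
    rw [measure_mono_null (Set.compl_subset_compl.mpr ?_) hnull, add_zero]
    · exact h1
    · refine Set.iUnion₂_subset fun n _ => Set.sdiff_subset.trans ((hAb _).trans ?_)
      exact closedBall_subset_ball (inv_lt_one_of_one_lt₀ (one_lt_pow₀ _root_.one_lt_two
          n.succ_ne_zero))
  · simp only [hν]
    clear hν hgrow hnull
    clear_value s
    clear hs
    induction s using Finset.induction_on with
    | empty => exact fun ε _ => ⟨1, one_pos, fun x r _ _ => by simp⟩
    | insert n s hn ih =>
      intro ε hε
      obtain ⟨δ₁, h1, h1'⟩ := hμo n (ε / 2) (by positivity)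
      obtain ⟨δ₂, h2, h2'⟩ := ih (ε / 2) (by positivity)
      refine ⟨min δ₁ δ₂, lt_min h1 h2, fun x r hr hrδ => ?_⟩
      rw [Finset.sum_insert hn]
      refine (add_le_add (h1' x r hr (hrδ.trans_le (min_le_left _ _)))
        (h2' x r hr (hrδ.trans_le (min_le_right _ _)))).trans (le_of_eq ?_)
      rw [← ENNReal.ofReal_add (by positivity) (by positivity)]
      congr 1
      ring
  · rw [lintegral_finsetSum_measure, hs, Finset.sum_map, Finset.mul_sum]
    refine Finset.sum_le_sum fun n _ => ?_
    have h1 : (2 : ℝ≥0∞) ^ (n + 1) * μ (n + 1) Set.univ ≤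
        ∫⁻ w, ENNReal.ofReal ‖w - b‖⁻¹ ∂μ (n + 1) := by
      rw [← lintegral_const]
      refine lintegral_mono_ae ?_
      have : ∀ᵐ w ∂μ (n + 1), w ∈ Ann b (n + 1) \ U := mem_ae_iff.mpr (hμE (n + 1))
      filter_upwards [this] with w hw
      have h2 := mem_Ann_iff.mp hw.1
      have h3 : (2 : ℝ) ^ (n + 1) ≤ ‖w - b‖⁻¹ := by
        rw [le_inv_comm₀ (by positivity) (lt_of_lt_of_le (by positivity) h2.1)]
        exact h2.2
      refine le_trans (le_of_eq ?_) (ENNReal.ofReal_le_ofReal h3)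
      rw [ENNReal.ofReal_pow (by norm_num)]
      simp
    calc (2 : ℝ≥0∞) ^ (n + 1) * lowerContent α (Ann b (n + 1) \ U)
        ≤ (2 : ℝ≥0∞) ^ (n + 1) * (2 * μ (n + 1) Set.univ) := by gcongr; exact hμl (n + 1)
      _ = 2 * ((2 : ℝ≥0∞) ^ (n + 1) * μ (n + 1) Set.univ) := by ring
      _ ≤ _ := by gcongr; exact h1

/-- The logarithmic potential of the complex measure `θ μ`. -/
def logPotential (μ : Measure ℂ) (θ : ℂ → ℂ) (z : ℂ) : ℂ :=
  ∫ w, θ w * (Real.log ‖z - w‖ : ℂ) ∂μ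

lemma ae_ne_of_measure_ball_le {μ : Measure ℂ} {α C : ℝ} (hα : 0 < α)
    (hμ : ∀ x r, 0 < r → μ (ball x r) ≤ ENNReal.ofReal (C * r ^ α)) (z : ℂ) : ∀ᵐ w ∂μ, w ≠ z := by
  have h0 : μ {z} = 0 := by
    have ht : Tendsto (fun r : ℝ => ENNReal.ofReal (C * r ^ α)) (𝓝[>] 0) (𝓝 0) := by
      have := (Real.continuousAt_rpow_const 0 α (Or.inr hα.le)).tendsto.const_mul C
      rw [Real.zero_rpow hα.ne', mul_zero] at this
      simpa using ENNReal.tendsto_ofReal (this.mono_left nhdsWithin_le_nhds)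
    refine le_antisymm (ge_of_tendsto ht ?_) zero_le
    filter_upwards [self_mem_nhdsWithin] with r hr
    exact (measure_mono (Set.singleton_subset_iff.mpr (mem_ball_self hr))).trans (hμ z r hr)
  rw [ae_iff]
  simpa using h0

lemma lintegral_abs_log_le {μ : Measure ℂ} {α C R : ℝ} {b z : ℂ} (hα : 0 < α) (hα1 : α < 1)
    (hC : 0 ≤ C) (hR : ‖z - b‖ ≤ R) (hb : μ (closedBall b 1)ᶜ = 0)
    (hu : μ Set.univ ≤ ENNReal.ofReal C)
    (hμ : ∀ x r, 0 < r → μ (ball x r) ≤ ENNReal.ofReal (C * r ^ α)) :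
    ∫⁻ w, ENNReal.ofReal |Real.log ‖z - w‖| ∂μ ≤
      ENNReal.ofReal (C * (expConst α).toReal + Real.log (2 + R) * C) := by
  have hR0 : 0 ≤ R := (norm_nonneg _).trans hR
  have hlog : 0 ≤ Real.log (2 + R) := Real.log_nonneg (by linarith)
  have h1 := lintegral_log_one_add_div_le (μ := μ) (z := z) (d := 1) (A := C) (B := 0) (α := α)
    (β := α) one_pos hC le_rfl (fun r hr => by simpa using hμ z r hr)
  rw [Real.one_rpow, mul_one, zero_mul, ENNReal.ofReal_zero, zero_mul, add_zero,
    ← ENNReal.ofReal_toReal (expConst_ne_top hα hα1), ← ENNReal.ofReal_mul hC] at h1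
  have h2 : ∀ᵐ w ∂μ, ENNReal.ofReal |Real.log ‖z - w‖| ≤
      ENNReal.ofReal (Real.log (1 + 1 / ‖z - w‖)) + ENNReal.ofReal (Real.log (2 + R)) := by
    filter_upwards [ae_ne_of_measure_ball_le hα hμ z, mem_ae_iff.mpr hb] with w hw hwb
    have hp : 0 < ‖z - w‖ := norm_pos_iff.mpr (sub_ne_zero.mpr hw.symm)
    rw [mem_closedBall', dist_eq_norm] at hwb
    have := norm_add_le (z - b) (b - w)
    rw [sub_add_sub_cancel] at this
    refine (ENNReal.ofReal_le_ofReal ((abs_log_le hp).trans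
      (add_le_add_right (Real.log_le_log (by positivity) (by linarith : 1 + ‖z - w‖ ≤
          2 + R)) _))).trans
      ENNReal.ofReal_add_le
  refine (lintegral_mono_ae h2).trans ?_
  rw [lintegral_add_right _ measurable_const, lintegral_const,
    ENNReal.ofReal_add (mul_nonneg hC ENNReal.toReal_nonneg) (by positivity),
        ENNReal.ofReal_mul hlog]
  exact add_le_add h1 (by gcongr)

lemma enorm_mul_log_le {θ : ℂ → ℂ} (hθ : ∀ w, ‖θ w‖ ≤ 1) (w : ℂ) (x : ℝ) :
    ‖θ w * (x : ℂ)‖ₑ ≤ ENNReal.ofReal |x| := by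
  rw [← ofReal_norm, norm_mul, Complex.norm_real, Real.norm_eq_abs]
  exact ENNReal.ofReal_le_ofReal (mul_le_of_le_one_left (abs_nonneg _) (hθ w))

lemma integrable_mul_log {μ : Measure ℂ} {θ : ℂ → ℂ} {α C : ℝ} {b : ℂ} (hα : 0 < α) (hα1 : α < 1)
    (hC : 0 ≤ C) (hb : μ (closedBall b 1)ᶜ = 0) (hu : μ Set.univ ≤ ENNReal.ofReal C)
    (hμ : ∀ x r, 0 < r → μ (ball x r) ≤ ENNReal.ofReal (C * r ^ α)) (hθm : Measurable θ)
    (hθ : ∀ w, ‖θ w‖ ≤ 1) (z : ℂ) : Integrable (fun w => θ w * (Real.log ‖z - w‖ : ℂ)) μ := by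
  refine ⟨by fun_prop, ?_⟩
  rw [hasFiniteIntegral_iff_enorm]
  exact ((lintegral_mono fun w => enorm_mul_log_le hθ w _).trans
    (lintegral_abs_log_le hα hα1 hC le_rfl hb hu hμ)).trans_lt ENNReal.ofReal_lt_top

lemma norm_logPotential_le {μ : Measure ℂ} {θ : ℂ → ℂ} {α C R : ℝ} {b z : ℂ} (hα : 0 < α)
    (hα1 : α < 1) (hC : 0 ≤ C) (hR : ‖z - b‖ ≤ R) (hb : μ (closedBall b 1)ᶜ = 0)
    (hu : μ Set.univ ≤ ENNReal.ofReal C)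
    (hμ : ∀ x r, 0 < r → μ (ball x r) ≤ ENNReal.ofReal (C * r ^ α)) (hθ : ∀ w, ‖θ w‖ ≤ 1) :
    ‖logPotential μ θ z‖ ≤ C * (expConst α).toReal + Real.log (2 + R) * C := by
  have hlog : 0 ≤ Real.log (2 + R) := Real.log_nonneg (by linarith [norm_nonneg (z - b)])
  rw [← ENNReal.ofReal_le_ofReal_iff (add_nonneg (mul_nonneg hC ENNReal.toReal_nonneg)
    (by positivity)), ofReal_norm]
  exact (enorm_integral_le_lintegral_enorm _).trans
    ((lintegral_mono fun w => enorm_mul_log_le hθ w _).trans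
      (lintegral_abs_log_le hα hα1 hC hR hb hu hμ))

lemma norm_logPotential_sub_le {μ : Measure ℂ} {θ : ℂ → ℂ} {α β A B C : ℝ} {b z z' : ℂ}
    (hα : 0 < α) (hα1 : α < 1) (hβ : 0 < β) (hβ1 : β < 1) (hA : 0 ≤ A) (hB : 0 ≤ B)
    (hC : 0 ≤ C) (hb : μ (closedBall b 1)ᶜ = 0) (hu : μ Set.univ ≤ ENNReal.ofReal C)
    (hμ : ∀ x r, 0 < r → μ (ball x r) ≤ ENNReal.ofReal (C * r ^ α)) (hθm : Measurable θ)
    (hθ : ∀ w, ‖θ w‖ ≤ 1)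
    (hμ' : ∀ x r, 0 < r → μ (ball x r) ≤ ENNReal.ofReal (A * r ^ α + B * r ^ β)) (hz : z ≠ z') :
    ‖logPotential μ θ z - logPotential μ θ z'‖ ≤
      2 * (A * (expConst α).toReal * ‖z - z'‖ ^ α + B * (expConst β).toReal * ‖z - z'‖ ^ β) := by
  set d := ‖z - z'‖ with hd
  have hd0 : 0 < d := norm_pos_iff.mpr (sub_ne_zero.mpr hz)
  have hΦ : ∀ y, ∫⁻ w, ENNReal.ofReal (Real.log (1 + d / ‖y - w‖)) ∂μ ≤
      ENNReal.ofReal (A * (expConst α).toReal * d ^ α + B * (expConst β).toReal * d ^ β) := by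
    intro y
    refine (lintegral_log_one_add_div_le hd0 hA hB (hμ' y)).trans (le_of_eq ?_)
    rw [← ENNReal.ofReal_toReal (expConst_ne_top hα hα1),
        ← ENNReal.ofReal_toReal (expConst_ne_top hβ hβ1),
      ← ENNReal.ofReal_mul (by positivity), ← ENNReal.ofReal_mul (by positivity),
      ← ENNReal.ofReal_add (by positivity) (by positivity), ENNReal.toReal_ofReal (by positivity),
      ENNReal.toReal_ofReal (by positivity)]
    congr 1
    ring
  rw [← ENNReal.ofReal_le_ofReal_iff (by positivity), ofReal_norm, logPotential, logPotential,
    ← integral_sub (integrable_mul_log hα hα1 hC hb hu hμ hθm hθ z)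
      (integrable_mul_log hα hα1 hC hb hu hμ hθm hθ z')]
  refine (enorm_integral_le_lintegral_enorm _).trans ?_
  have hae : ∀ᵐ w ∂μ, ‖θ w * (Real.log ‖z - w‖ : ℂ) - θ w * (Real.log ‖z' - w‖ : ℂ)‖ₑ ≤
      ENNReal.ofReal (Real.log (1 + d / ‖z - w‖)) +
        ENNReal.ofReal (Real.log (1 + d / ‖z' - w‖)) := by
    filter_upwards [ae_ne_of_measure_ball_le hα hμ z, ae_ne_of_measure_ball_le hα hμ z']
      with w h1 h2
    rw [← mul_sub, ← Complex.ofReal_sub]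
    refine (enorm_mul_log_le hθ w _).trans ((ENNReal.ofReal_le_ofReal
      (abs_log_sub_log_le (d := d) (norm_pos_iff.mpr (sub_ne_zero.mpr h1.symm))
      (norm_pos_iff.mpr (sub_ne_zero.mpr h2.symm)) ?_)).trans ENNReal.ofReal_add_le)
    have := abs_norm_sub_norm_le (z - w) (z' - w)
    rwa [sub_sub_sub_cancel_right] at this
  refine (lintegral_mono_ae hae).trans ?_
  rw [lintegral_add_left (by fun_prop), ENNReal.ofReal_mul (by norm_num)]
  refine (add_le_add (hΦ z) (hΦ z')).trans (le_of_eq ?_)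
  rw [← two_mul]
  simp

lemma exists_measure_ball_le_add {μ : Measure ℂ} {α β C ε : ℝ} (hαβ : α ≤ β) (hC : 0 ≤ C)
    (hμ : ∀ x r, 0 < r → μ (ball x r) ≤ ENNReal.ofReal (C * r ^ α))
    (hlo : ∃ δ, 0 < δ ∧ ∀ x r, 0 < r → r < δ → μ (ball x r) ≤ ENNReal.ofReal (ε * r ^ α))
    (hε : 0 < ε) :
    ∃ B, 0 ≤ B ∧ ∀ x r, 0 < r → μ (ball x r) ≤ ENNReal.ofReal (ε * r ^ α + B * r ^ β) := by
  obtain ⟨δ, hδ, hδμ⟩ := hlo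
  refine ⟨C * δ ^ (α - β), by positivity, fun x r hr => ?_⟩
  rcases lt_or_ge r δ with h | h
  · refine (hδμ x r hr h).trans (ENNReal.ofReal_le_ofReal ?_)
    have : 0 ≤ C * δ ^ (α - β) * r ^ β := by positivity
    linarith
  · refine (hμ x r hr).trans (ENNReal.ofReal_le_ofReal ?_)
    have h1 : r ^ (α - β) ≤ δ ^ (α - β) := Real.rpow_le_rpow_of_nonpos hδ h (by linarith)
    have h2 : r ^ α = r ^ (α - β) * r ^ β := by rw [← Real.rpow_add hr]; congr 1; ring
    have h3 : 0 ≤ ε * r ^ α := by positivity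
    have h4 : C * (r ^ (α - β) * r ^ β) ≤ C * (δ ^ (α - β) * r ^ β) := by gcongr
    rw [h2] at h3 ⊢
    linarith

lemma littleHolderOn_of_forall_eps {α : ℝ} {E : Set ℂ} {f : ℂ → ℂ} (hf : HolderOfOrderOn α E f)
    (h : ∀ ε, 0 < ε → ∃ δ, 0 < δ ∧ ∀ x ∈ E, ∀ y ∈ E, x ≠ y → ‖x - y‖ ≤ δ →
      ‖f x - f y‖ ≤ ε * ‖x - y‖ ^ α) : LittleHolderOn α E f := by
  refine ⟨hf, ?_⟩
  rw [Metric.tendsto_nhds]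
  intro ε hε
  obtain ⟨δ, hδ, hδf⟩ := h (ε / 2) (by positivity)
  filter_upwards [Ioc_mem_nhdsGT hδ] with t ht
  rw [dist_zero_right, Real.norm_eq_abs, abs_of_nonneg]
  · refine lt_of_le_of_lt (Real.sSup_le ?_ (by positivity)) (half_lt_self hε)
    rintro q ⟨x, hx, y, hy, hxy, hd, rfl⟩
    rw [div_le_iff₀ (Real.rpow_pos_of_pos (norm_pos_iff.mpr (sub_ne_zero.mpr hxy)) α)]
    exact hδf x hx y hy hxy (hd.trans ht.2)
  · refine Real.sSup_nonneg ?_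
    rintro q ⟨x, hx, y, hy, hxy, hd, rfl⟩
    positivity

lemma HNorm_le {α S T R : ℝ} {U : Set ℂ} {f : ℂ → ℂ} {b : ℂ} (hS : 0 ≤ S) (hT : 0 ≤ T)
    (hU : closure U ⊆ closedBall b R) (h1 : ∀ z ∈ closedBall b R, ‖f z‖ ≤ S)
    (h2 : ∀ x y : ℂ, x ≠ y → ‖f x - f y‖ ≤ T * ‖x - y‖ ^ α) : HNorm α U f ≤ S + T := by
  refine add_le_add (Real.sSup_le ?_ hS) (Real.sSup_le ?_ hT)
  · rintro _ ⟨z, hz, rfl⟩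
    exact h1 z (hU hz)
  · rintro q ⟨x, hx, y, hy, hxy, rfl⟩
    rw [div_le_iff₀ (Real.rpow_pos_of_pos (norm_pos_iff.mpr (sub_ne_zero.mpr hxy)) α)]
    exact h2 x y hxy

lemma norm_logPotential_sub_le_rpow {μ : Measure ℂ} {θ : ℂ → ℂ} {α C : ℝ} {b z z' : ℂ}
    (hα : 0 < α) (hα1 : α < 1) (hC : 0 ≤ C) (hb : μ (closedBall b 1)ᶜ = 0)
    (hu : μ Set.univ ≤ ENNReal.ofReal C)
    (hμ : ∀ x r, 0 < r → μ (ball x r) ≤ ENNReal.ofReal (C * r ^ α)) (hθm : Measurable θ)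
    (hθ : ∀ w, ‖θ w‖ ≤ 1) (hz : z ≠ z') :
    ‖logPotential μ θ z - logPotential μ θ z'‖ ≤
      2 * (C * (expConst α).toReal) * ‖z - z'‖ ^ α := by
  have := norm_logPotential_sub_le hα hα1 hα hα1 hC le_rfl hC hb hu hμ hθm hθ
    (fun x r hr => by simpa using hμ x r hr) hz
  simpa [mul_assoc] using this

lemma littleHolderOn_logPotential {μ : Measure ℂ} {θ : ℂ → ℂ} {α C : ℝ} {b : ℂ}
    (hα : 0 < α) (hα1 : α < 1) (hC : 0 ≤ C) (hb : μ (closedBall b 1)ᶜ = 0)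
    (hu : μ Set.univ ≤ ENNReal.ofReal C)
    (hμ : ∀ x r, 0 < r → μ (ball x r) ≤ ENNReal.ofReal (C * r ^ α)) (hθm : Measurable θ)
    (hθ : ∀ w, ‖θ w‖ ≤ 1)
    (hlo : ∀ ε, 0 < ε → ∃ δ, 0 < δ ∧ ∀ x r, 0 < r → r < δ → μ (ball x r) ≤
        ENNReal.ofReal (ε * r ^ α))
    (E : Set ℂ) : LittleHolderOn α E (logPotential μ θ) := by
  have hK : ∀ γ, 0 ≤ (expConst γ).toReal := fun _ => ENNReal.toReal_nonneg
  refine littleHolderOn_of_forall_eps ⟨2 * (C * (expConst α).toReal), fun x _ y _ => ?_⟩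
    fun ε hε => ?_
  · rcases eq_or_ne x y with rfl | h
    · simp [Real.zero_rpow hα.ne']
    · exact norm_logPotential_sub_le_rpow hα hα1 hC hb hu hμ hθm hθ h
  set β := (1 + α) / 2 with hβ
  have hαβ : α < β := by linarith
  set ε' := ε / (4 * ((expConst α).toReal + 1)) with hε'
  have hε'0 : 0 < ε' := div_pos hε (by linarith [hK α])
  obtain ⟨B, hB, hBμ⟩ := exists_measure_ball_le_add hαβ.le hC hμ (hlo ε' hε'0) hε'0
  set η := ε / (4 * (B * (expConst β).toReal + 1)) with hη
  have hBK : 0 ≤ B * (expConst β).toReal := mul_nonneg hB (hK β)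
  have hη0 : 0 < η := div_pos hε (by linarith)
  refine ⟨η ^ (1 / (β - α)), by positivity, fun x _ y _ hxy hd => ?_⟩
  have hp : 0 < ‖x - y‖ := norm_pos_iff.mpr (sub_ne_zero.mpr hxy)
  refine (norm_logPotential_sub_le hα hα1 (hα.trans hαβ) (by linarith) hε'0.le hB hC hb hu hμ hθm hθ
    hBμ hxy).trans ?_
  have h1 : ‖x - y‖ ^ (β - α) ≤ η := by
    refine (Real.rpow_le_rpow hp.le hd (by linarith)).trans (le_of_eq ?_)
    rw [← Real.rpow_mul hη0.le, one_div_mul_cancel (by linarith), Real.rpow_one]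
  have h2 : ‖x - y‖ ^ β = ‖x - y‖ ^ (β - α) * ‖x - y‖ ^ α := by
    rw [← Real.rpow_add hp]; congr 1; ring
  have h3 : ε' * (expConst α).toReal ≤ ε / 4 := by
    rw [hε', div_mul_eq_mul_div, div_le_div_iff₀ (by linarith [hK α]) (by norm_num)]
    nlinarith
  have h4 : B * (expConst β).toReal * ‖x - y‖ ^ (β - α) ≤ ε / 4 := by
    refine (mul_le_mul_of_nonneg_left h1 hBK).trans ?_
    rw [hη, mul_div_assoc', div_le_div_iff₀ (by linarith) (by norm_num)]
    nlinarith
  have hq : 0 < ‖x - y‖ ^ α := by positivity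
  rw [h2]
  nlinarith [mul_le_mul_of_nonneg_right h3 hq.le, mul_le_mul_of_nonneg_right h4 hq.le]

lemma harmonicOnC_of_eq_add_conj {f G H : ℂ → ℂ} {V : Set ℂ} {c : ℂ} (hV : IsOpen V)
    (hG : DifferentiableOn ℂ G V) (hH : DifferentiableOn ℂ H V)
    (hf : ∀ z ∈ V, f z = c + (G z + conj (H z)) / 2) :
    HarmonicOnC f V ∧
      ∀ z ∈ V, ∀ v, fderiv ℝ f z v = (deriv G z * v + conj (deriv H z * v)) / 2 := by
  have key : ∀ {f G H : ℂ → ℂ} {c : ℂ}, DifferentiableOn ℂ G V → DifferentiableOn ℂ H V →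
      (∀ z ∈ V, f z = c + (G z + conj (H z)) / 2) →
      ∀ z ∈ V, ∀ v, fderiv ℝ f z v = (deriv G z * v + conj (deriv H z * v)) / 2 := by
    intro f G H c hG hH hf z hz v
    have hVz := hV.mem_nhds hz
    have h1 := ((hG.differentiableAt hVz).hasDerivAt.hasFDerivAt).restrictScalars ℝ
    have h2 := ((hH.differentiableAt hVz).hasDerivAt.hasFDerivAt).restrictScalars ℝ
    have h3 := (Complex.conjCLE.hasFDerivAt (x := H z)).comp z h2
    have h4 := ((h1.add h3).mul_const (2⁻¹ : ℂ)).const_add c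
    have h5 : f =ᶠ[𝓝 z] fun z => c + (G z + conj (H z)) * 2⁻¹ := by
      filter_upwards [hVz] with w hw
      rw [hf w hw, div_eq_mul_inv]
    rw [(h4.congr_of_eventuallyEq h5).fderiv]
    simp
    ring
  have hfd := key hG hH hf
  refine ⟨⟨?_, fun z hz => ?_⟩, hfd⟩
  · have h1 : ContDiffOn ℝ 2 G V := (hG.contDiffOn hV).restrict_scalars ℝ
    have h2 : ContDiffOn ℝ 2 H V := (hH.contDiffOn hV).restrict_scalars ℝ
    have h3 : ContDiffOn ℝ 2 (fun z => conj (H z)) V := Complex.conjCLE.contDiff.comp_contDiffOn h2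
    exact (contDiffOn_const.add ((h1.add h3).div_const 2)).congr hf
  · have h2 : ∀ v, fderiv ℝ (fun w => fderiv ℝ f w v) z v =
        (deriv (deriv G) z * v * v + conj (deriv (deriv H) z * v * v)) / 2 := fun v => by
      have hd : ∀ {F : ℂ → ℂ}, DifferentiableOn ℂ F V → deriv (fun w => deriv F w * v) z =
          deriv (deriv F) z * v := fun {F} hF =>
        deriv_mul_const ((hF.deriv hV).differentiableAt (hV.mem_nhds hz)) v
      rw [key (c := 0) ((hG.deriv hV).mul_const v) ((hH.deriv hV).mul_const v)
        (fun w hw => by rw [hfd w hw, zero_add]) z hz v, hd hG, hd hH]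
    rw [h2, h2]
    simp only [map_mul, Complex.conj_I, map_one]
    linear_combination ((deriv (deriv G) z + conj (deriv (deriv H) z)) / 2) * Complex.I_mul_I

lemma hasDerivAt_integral_mul_log {μ : Measure ℂ} [IsFiniteMeasure μ] {θ : ℂ → ℂ} {K : Set ℂ}
    {z₀ : ℂ} {ρ : ℝ} (hρ : 0 < ρ) (hK : μ Kᶜ = 0) (hd : ∀ w ∈ K, 2 * ρ ≤ ‖z₀ - w‖)
    (hθm : Measurable θ) (hθ : ∀ w, ‖θ w‖ ≤ 1) {z : ℂ} (hz : z ∈ ball z₀ ρ) :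
    Integrable (fun w => θ w * Complex.log (1 + (z - z₀) / (z₀ - w))) μ ∧
    HasDerivAt (fun z => ∫ w, θ w * Complex.log (1 + (z - z₀) / (z₀ - w)) ∂μ)
      (∫ w, θ w / (z - w) ∂μ) z := by
  have hKae : ∀ᵐ w ∂μ, w ∈ K := mem_ae_iff.mpr hK
  have hζ : ∀ z ∈ ball z₀ ρ, ∀ w ∈ K, ‖(z - z₀) / (z₀ - w)‖ ≤ 1 / 2 := fun z hz w hw => by
    have h1 := hd w hw
    rw [mem_ball, dist_eq_norm] at hz
    rw [norm_div, div_le_iff₀ (by linarith)]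
    linarith
  have hint : ∀ z ∈ ball z₀ ρ,
      Integrable (fun w => θ w * Complex.log (1 + (z - z₀) / (z₀ - w))) μ := by
    intro z hz
    refine (integrable_const (1 : ℝ)).mono' (by fun_prop) ?_
    filter_upwards [hKae] with w hw
    have h1 := hζ z hz w hw
    have h2 := Complex.norm_log_one_add_half_le_self h1
    rw [norm_mul]
    nlinarith [hθ w, norm_nonneg (θ w), norm_nonneg (Complex.log (1 + (z - z₀) / (z₀ - w)))]
  refine ⟨hint z hz, ?_⟩
  refine (hasDerivAt_integral_of_dominated_loc_of_deriv_le (bound := fun _ => ρ⁻¹)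
    (F' := fun z w => θ w / (z - w)) (isOpen_ball.mem_nhds hz)
    (Eventually.of_forall fun z => by fun_prop) (hint z hz)
    (hθm.div (measurable_const.sub measurable_id)).aestronglyMeasurable ?_ (integrable_const _)
        ?_).2
  · filter_upwards [hKae] with w hw y hy
    have h1 := hd w hw
    rw [mem_ball', dist_eq_norm] at hy
    have h2 := norm_add_le (z₀ - y) (y - w)
    rw [sub_add_sub_cancel] at h2
    have h3 : ρ ≤ ‖y - w‖ := by linarith
    rw [norm_div, div_eq_mul_inv]
    calc ‖θ w‖ * ‖y - w‖⁻¹ ≤ 1 * ρ⁻¹ :=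
          mul_le_mul (hθ w) (inv_anti₀ hρ h3) (by positivity) zero_le_one
      _ = ρ⁻¹ := one_mul _
  · filter_upwards [hKae] with w hw y hy
    have h0 : z₀ - w ≠ 0 := norm_pos_iff.mp (by linarith [hd w hw])
    have hs : 1 + (y - z₀) / (z₀ - w) ∈ Complex.slitPlane :=
      Complex.mem_slitPlane_of_norm_lt_one ((hζ y hy w hw).trans_lt (by norm_num))
    have h1 := ((((hasDerivAt_id y).sub_const z₀).div_const (z₀ - w)).const_add 1).clog hs
    refine (h1.const_mul (θ w)).congr_deriv ?_
    have h2 : (z₀ - w) * (1 + (y - z₀) / (z₀ - w)) = y - w := by field_simp; ring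
    rw [← h2, div_div, mul_one_div, id]

lemma logPotential_eq {μ : Measure ℂ} [IsFiniteMeasure μ] {θ : ℂ → ℂ} {K : Set ℂ}
    {z₀ : ℂ} {ρ : ℝ} (hρ : 0 < ρ) (hK : μ Kᶜ = 0) (hd : ∀ w ∈ K, 2 * ρ ≤ ‖z₀ - w‖)
    (hθm : Measurable θ) (hθ : ∀ w, ‖θ w‖ ≤ 1)
    (hint : Integrable (fun w => θ w * (Real.log ‖z₀ - w‖ : ℂ)) μ) {z : ℂ} (hz : z ∈ ball z₀ ρ) :
    logPotential μ θ z = logPotential μ θ z₀ +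
      ((∫ w, θ w * Complex.log (1 + (z - z₀) / (z₀ - w)) ∂μ) +
        conj (∫ w, conj (θ w) * Complex.log (1 + (z - z₀) / (z₀ - w)) ∂μ)) / 2 := by
  have hcm : Measurable fun w => conj (θ w) := Complex.continuous_conj.measurable.comp hθm
  have hcn : ∀ w, ‖conj (θ w)‖ ≤ 1 := fun w => by rw [RCLike.norm_conj]; exact hθ w
  have h1 := (hasDerivAt_integral_mul_log hρ hK hd hθm hθ hz).1
  have h2 := (hasDerivAt_integral_mul_log hρ hK hd hcm hcn hz).1
  have h3 : Integrable (fun w => conj (conj (θ w) * Complex.log (1 + (z - z₀) / (z₀ - w)))) μ :=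
    Complex.conjCLE.toContinuousLinearMap.integrable_comp h2
  have h4 : Integrable (fun w => (θ w * Complex.log (1 + (z - z₀) / (z₀ - w)) +
      conj (conj (θ w) * Complex.log (1 + (z - z₀) / (z₀ - w)))) / 2) μ := (h1.add h3).div_const 2
  rw [← integral_conj, ← integral_add h1 h3, ← integral_div, logPotential, logPotential,
    ← integral_add hint h4]
  refine integral_congr_ae ?_
  filter_upwards [mem_ae_iff.mpr hK] with w hw
  have h0 : z₀ - w ≠ 0 := norm_pos_iff.mp (by linarith [hd w hw])
  have hζ : ‖(z - z₀) / (z₀ - w)‖ < 1 := by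
    have := hd w hw
    rw [mem_ball, dist_eq_norm] at hz
    rw [norm_div, div_lt_one (by linarith)]
    linarith
  have hne : 1 + (z - z₀) / (z₀ - w) ≠ 0 :=
    Complex.slitPlane_ne_zero (Complex.mem_slitPlane_of_norm_lt_one hζ)
  have e1 : z - w = (z₀ - w) * (1 + (z - z₀) / (z₀ - w)) := by field_simp; ring
  have e2 : Real.log ‖z - w‖ = Real.log ‖z₀ - w‖ + (Complex.log (1 + (z - z₀) / (z₀ - w))).re := by
    rw [Complex.log_re, ← Real.log_mul (norm_ne_zero_iff.mpr h0) (norm_ne_zero_iff.mpr hne),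
      ← norm_mul, ← e1]
  rw [e2, Complex.ofReal_add, Complex.re_eq_add_conj]
  simp only [map_mul, Complex.conj_conj]
  ring

lemma harmonicOnC_logPotential {μ : Measure ℂ} [IsFiniteMeasure μ] {θ : ℂ → ℂ} {K : Set ℂ}
    {z₀ : ℂ} {ρ : ℝ} (hρ : 0 < ρ) (hK : μ Kᶜ = 0) (hd : ∀ w ∈ K, 2 * ρ ≤ ‖z₀ - w‖)
    (hθm : Measurable θ) (hθ : ∀ w, ‖θ w‖ ≤ 1)
    (hint : Integrable (fun w => θ w * (Real.log ‖z₀ - w‖ : ℂ)) μ) :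
    HarmonicOnC (logPotential μ θ) (ball z₀ ρ) ∧
      fderiv ℝ (logPotential μ θ) z₀ 1 - Complex.I * fderiv ℝ (logPotential μ θ) z₀ Complex.I =
        ∫ w, θ w / (z₀ - w) ∂μ := by
  have hcm : Measurable fun w => conj (θ w) := Complex.continuous_conj.measurable.comp hθm
  have hcn : ∀ w, ‖conj (θ w)‖ ≤ 1 := fun w => by rw [RCLike.norm_conj]; exact hθ w
  have hG := fun (z : ℂ) hz => (hasDerivAt_integral_mul_log hρ hK hd hθm hθ (z := z) hz).2
  have hH := fun (z : ℂ) hz => (hasDerivAt_integral_mul_log hρ hK hd hcm hcn (z := z) hz).2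
  obtain ⟨h1, h2⟩ := harmonicOnC_of_eq_add_conj isOpen_ball
    (fun z hz => (hG z hz).differentiableAt.differentiableWithinAt)
    (fun z hz => (hH z hz).differentiableAt.differentiableWithinAt)
    (fun z hz => logPotential_eq hρ hK hd hθm hθ hint hz)
  refine ⟨h1, ?_⟩
  have hz := mem_ball_self (x := z₀) hρ
  rw [h2 z₀ hz, h2 z₀ hz, (hG z₀ hz).deriv]
  simp only [map_mul, Complex.conj_I, map_one]
  set P := ∫ w, θ w / (z₀ - w) ∂μ
  set Q := conj (deriv (fun z => ∫ w, conj (θ w) * Complex.log (1 + (z - z₀) / (z₀ - w)) ∂μ) z₀)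
  linear_combination (Q / 2 - P / 2) * Complex.I_mul_I

lemma harmonicOnC_of_locally {f : ℂ → ℂ} {V : Set ℂ}
    (h : ∀ z ∈ V, ∃ ρ, 0 < ρ ∧ HarmonicOnC f (ball z ρ)) : HarmonicOnC f V := by
  refine ⟨fun z hz => ?_, fun z hz => ?_⟩
  · obtain ⟨ρ, hρ, hf⟩ := h z hz
    exact (hf.1.contDiffAt (ball_mem_nhds z hρ)).contDiffWithinAt
  · obtain ⟨ρ, hρ, hf⟩ := h z hz
    exact hf.2 z (mem_ball_self hρ)

/-- The unit vector pointing from `w` to `b`. -/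
def unitDir (b w : ℂ) : ℂ := (b - w) / (‖b - w‖ : ℂ)

lemma measurable_unitDir (b : ℂ) : Measurable (unitDir b) := by
  unfold unitDir
  have h1 : Measurable fun w : ℂ => b - w := by fun_prop
  have h2 : Measurable fun w : ℂ => (‖b - w‖ : ℂ) := by fun_prop
  exact h1.div h2

lemma norm_unitDir_le (b w : ℂ) : ‖unitDir b w‖ ≤ 1 := by
  rw [unitDir, norm_div, Complex.norm_real, norm_norm]
  exact div_self_le_one _

lemma unitDir_div_sub (b w : ℂ) : unitDir b w / (b - w) = ((‖w - b‖⁻¹ : ℝ) : ℂ) := by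
  rcases eq_or_ne (b - w) 0 with h | h
  · rw [norm_sub_rev w b, h]
    simp
  · rw [unitDir, div_right_comm, div_self h, norm_sub_rev w b, Complex.ofReal_inv, one_div]

lemma norm_sub_I_mul_le (f : ℂ → ℂ) (b : ℂ) :
    ‖fderiv ℝ f b 1 - Complex.I * fderiv ℝ f b Complex.I‖ ≤ 2 * ‖gradPair f b‖ := by
  have h1 : ‖fderiv ℝ f b 1‖ ≤ ‖gradPair f b‖ := norm_fst_le (gradPair f b)
  have h2 : ‖fderiv ℝ f b Complex.I‖ ≤ ‖gradPair f b‖ := norm_snd_le (gradPair f b)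
  refine (norm_sub_le _ _).trans ?_
  rw [norm_mul, Complex.norm_I, one_mul]
  linarith

theorem tsum_lt_top_of_exists_gradPair_le {α : ℝ} (hα0 : 0 < α) (hα1 : α < 1) {U : Set ℂ}
    (hU : IsOpen U) (hUb : Bornology.IsBounded U) {b : ℂ} {κ : ℝ} (hκ : 0 < κ)
    (h : ∀ f h : ℂ → ℂ, ∀ r : ℝ, 0 < r → MemHalpha α U f → HarmonicOnC h (U ∪ ball b r) →
      (∀ z ∈ closure U, h z = f z) → ‖gradPair h b‖ ≤ κ * HNorm α U f) :
    ∑' n : ℕ, (2 : ℝ≥0∞) ^ (n + 1) * lowerContent α (Ann b (n + 1) \ U) < ⊤ := by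
  obtain ⟨R, hR⟩ := hUb.subset_closedBall b
  set C := growthConst α with hCdef
  have hC : 0 < C := growthConst_pos hα0
  have hK0 : 0 ≤ (expConst α).toReal := ENNReal.toReal_nonneg
  set N := C * (expConst α).toReal + Real.log (2 + max R 0) * C + 2 * (C * (expConst α).toReal)
      with hN
  have hlog : 0 ≤ Real.log (2 + max R 0) := Real.log_nonneg (by linarith [le_max_right R 0])
  refine lt_of_le_of_lt (ENNReal.tsum_le_of_sum_range_le (c := 2 * ENNReal.ofReal (2 * (κ * N)))
    fun M => ?_) (ENNReal.mul_lt_top (by simp) ENNReal.ofReal_lt_top)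
  obtain ⟨μ, hμK, hμu, hμ, hμo, hμS⟩ := exists_measure_iUnion_Ann_diff hα0 hα1 hU b M
  refine hμS.trans (mul_le_mul_right ?_ _)
  set K := ⋃ n ∈ Finset.range M, Ann b (n + 1) \ U with hK
  have : IsFiniteMeasure μ := ⟨hμu.trans_lt ENNReal.ofReal_lt_top⟩
  have hKc : IsClosed K :=
    ((Finset.range M).isCompact_biUnion fun n _ => (isCompact_Ann b (n + 1)).diff hU).isClosed
  have hKb : ∀ w ∈ K, ((2 : ℝ) ^ M)⁻¹ / 2 ≤ ‖w - b‖ ∧ ‖w - b‖ ≤ 1 := fun w hw => by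
    obtain ⟨n, hn, hw⟩ := Set.mem_iUnion₂.mp hw
    obtain ⟨h1, h2⟩ := mem_Ann_iff.mp hw.1
    refine ⟨le_trans ?_ h1, h2.trans (inv_le_one_of_one_le₀ (one_le_pow₀ (by norm_num)))⟩
    gcongr
    · norm_num
    · exact Finset.mem_range.mp hn
  have hb1 : μ (closedBall b 1)ᶜ = 0 :=
    measure_mono_null (Set.compl_subset_compl.mpr fun w hw => by
      rw [mem_closedBall, dist_eq_norm]
      exact (hKb w hw).2) hμK
  have hθm := measurable_unitDir b
  have hθ := norm_unitDir_le b
  have hint := integrable_mul_log hα0 hα1 hC.le hb1 hμu hμ hθm hθ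
  have hdist : ∀ z ∉ K, ∃ ρ, 0 < ρ ∧ ∀ w ∈ K, 2 * ρ ≤ ‖z - w‖ := fun z hz => by
    obtain ⟨ε, hε, hεK⟩ := Metric.isOpen_iff.mp hKc.isOpen_compl z hz
    refine ⟨ε / 2, by positivity, fun w hw => ?_⟩
    by_contra hlt
    refine hεK ?_ hw
    rw [mem_ball', dist_eq_norm]
    linarith
  set u := logPotential μ (unitDir b) with hu
  have hharm : ∀ V ⊆ Kᶜ, HarmonicOnC u V := fun V hV =>
    harmonicOnC_of_locally fun z hz => by
      obtain ⟨ρ, hρ, hd⟩ := hdist z (hV hz)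
      exact ⟨ρ, hρ, (harmonicOnC_logPotential hρ hμK hd hθm hθ (hint z)).1⟩
  have hUK : U ⊆ Kᶜ := fun z hz hzK => by
    obtain ⟨n, _, hw⟩ := Set.mem_iUnion₂.mp hzK
    exact hw.2 hz
  have hbK : ball b (((2 : ℝ) ^ M)⁻¹ / 2) ⊆ Kᶜ := fun z hz hzK => by
    rw [mem_ball, dist_eq_norm] at hz
    exact hz.not_ge (hKb z hzK).1
  have hr : 0 < ((2 : ℝ) ^ M)⁻¹ / 2 := by positivity
  have hgrad := h u u _ hr
    ⟨hharm U hUK, littleHolderOn_logPotential hα0 hα1 hC.le hb1 hμu hμ hθm hθ hμo _⟩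
    (hharm _ (Set.union_subset hUK hbK)) fun _ _ => rfl
  have hnorm : HNorm α U u ≤ N := by
    refine HNorm_le (b := b) (R := max R 0) (by positivity) (by positivity)
      (closure_minimal (hR.trans (closedBall_subset_closedBall (le_max_left R 0)))
          isClosed_closedBall)
      (fun z hz => ?_)
      (fun x y hxy => norm_logPotential_sub_le_rpow hα0 hα1 hC.le hb1 hμu hμ hθm hθ hxy)
    rw [mem_closedBall, dist_eq_norm] at hz
    exact norm_logPotential_le hα0 hα1 hC.le hz hb1 hμu hμ hθ
  obtain ⟨ρ, hρ, hd⟩ := hdist b (hbK (mem_ball_self hr))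
  have hder := (harmonicOnC_logPotential hρ hμK hd hθm hθ (hint b)).2
  simp only [unitDir_div_sub, integral_complex_ofReal] at hder
  have hI : Integrable (fun w => ‖w - b‖⁻¹) μ := by
    refine (integrable_const (2 * ρ)⁻¹).mono' (by fun_prop) ?_
    filter_upwards [mem_ae_iff.mpr hμK] with w hw
    rw [Real.norm_of_nonneg (by positivity), norm_sub_rev]
    exact inv_anti₀ (by positivity) (hd w hw)
  rw [← ofReal_integral_eq_lintegral_ofReal hI (ae_of_all _ fun w => by positivity)]
  refine ENNReal.ofReal_le_ofReal ?_
  have hle := norm_sub_I_mul_le u b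
  rw [hder, Complex.norm_real] at hle
  calc ∫ w, ‖w - b‖⁻¹ ∂μ ≤ 2 * ‖gradPair u b‖ := (Real.le_norm_self _).trans hle
    _ ≤ 2 * (κ * N) := by
        have := hgrad.trans (mul_le_mul_of_nonneg_left hnorm hκ.le)
        linarith

/-- For `0 < α < 1`, `U ⊆ ℂ` bounded open and `b ∈ ∂U`, the `ℂ²`-valued
functional `h ↦ (∇h)(b)` (computed from the harmonic extension near `b`) is bounded on
`H^α_b(U)` with respect to the `H^α` norm if and only if `∑ 2^n M_*^α(A_n(b) \ U) < ∞`. -/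
theorem statement2 (α : ℝ) (hα0 : 0 < α) (hα1 : α < 1)
    (U : Set ℂ) (hUopen : IsOpen U) (hUbdd : Bornology.IsBounded U)
    (b : ℂ) (hb : b ∈ frontier U) :
    (∃ κ : ℝ, 0 < κ ∧ ∀ f h : ℂ → ℂ, ∀ r : ℝ, 0 < r →
        MemHalpha α U f → HarmonicOnC h (U ∪ Metric.ball b r) →
        (∀ z ∈ closure U, h z = f z) →
        ‖gradPair h b‖ ≤ κ * HNorm α U f) ↔
      ∑' n : ℕ, (2:ℝ≥0∞) ^ (n + 1) * lowerContent α (Ann b (n + 1) \ U) < ⊤ := by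
  constructor
  · rintro ⟨κ, hκ, h⟩
    exact tsum_lt_top_of_exists_gradPair_le hα0 hα1 hUopen hUbdd hκ h
  · exact exists_gradPair_le_of_tsum_lt_top hα0 hα1 hUopen (frontier_subset_closure hb)

end
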